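/- Let n ≥ 2, and let b₀ be a real number with 0 < |b₀| < 2/(3√3). Then the Cauchy problem for P is locally solvable at the origin in the Gevrey class of order 2: for any u₀, u₁, u₂ ∈ γ^(2)(ℝⁿ) there exist a neighborhood U of the origin in ℝ^{n+1} and a function u ∈ C^∞(U) such that Pu = 0 in U and D₀^j u(0, x') = u_j(x') for j = 0, 1, 2 whenever (0, x') ∈ U. -/

import Mathlib

open Complex

/-- Partial derivative in the `j`-th coordinate direction. -/
noncomputable def pd {N : ℕ} (j : Fin N) (f : (Fin N → ℝ) → ℂ) : (Fin N → ℝ) → ℂ :=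
  fun x => fderiv ℝ f x (Pi.single j 1)

/-- `D_j = -i ∂/∂x_j`. -/
noncomputable def Dop {N : ℕ} (j : Fin N) (f : (Fin N → ℝ) → ℂ) : (Fin N → ℝ) → ℂ :=
  fun x => -Complex.I * pd j f x

/-- Iterated mixed partial derivative `∂^α`. -/
noncomputable def pdMulti {N : ℕ} (α : Fin N → ℕ) (f : (Fin N → ℝ) → ℂ) : (Fin N → ℝ) → ℂ :=
  (List.finRange N).foldr (fun j g => (pd j)^[α j] g) f

/-- The Gevrey class `γ^(s)(ℝ^N)`. -/
def GevreyOn (s : ℝ) {N : ℕ} (f : (Fin N → ℝ) → ℂ) : Prop :=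
  ContDiff ℝ (⊤ : ℕ∞) f ∧ ∀ K : Set (Fin N → ℝ), IsCompact K →
    ∃ C > (0:ℝ), ∃ h > (0:ℝ), ∀ x ∈ K, ∀ α : Fin N → ℕ,
      ‖pdMulti α f x‖ ≤ C * h ^ (∑ j, α j) * ((Nat.factorial (∑ j, α j) : ℝ)) ^ s

/-- The operator `P u = D₀³u − (D₁² + x₁²Dₙ²)D₀u − b₀ x₁³ Dₙ³ u` on `ℝ^{n+1}`. -/
noncomputable def Pop (n : ℕ) (b₀ : ℝ) (u : (Fin (n+1) → ℝ) → ℂ) : (Fin (n+1) → ℝ) → ℂ :=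
  fun x =>
    Dop 0 (Dop 0 (Dop 0 u)) x
      - (Dop 1 (Dop 1 (Dop 0 u)) x
         + (↑(x 1) : ℂ)^2 * Dop (Fin.last n) (Dop (Fin.last n) (Dop 0 u)) x)
      - (b₀ : ℂ) * (↑(x 1) : ℂ)^3 *
          Dop (Fin.last n) (Dop (Fin.last n) (Dop (Fin.last n) u)) x

section GevreyCutoff

open scoped ContDiff

/-- Leibniz' rule for Gevrey bounds of order two at a point. -/
lemma norm_iteratedDeriv_mul_le_gevrey {A : Type*} [NormedRing A] [NormedAlgebra ℝ A]
    {f g : ℝ → A} (hf : ContDiff ℝ ∞ f) (hg : ContDiff ℝ ∞ g) (x : ℝ)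
    {C₁ C₂ h₁ h₂ : ℝ} (hC₁ : 0 ≤ C₁) (hh₁ : 0 ≤ h₁)
    (bf : ∀ l, ‖iteratedDeriv l f x‖ ≤ C₁ * h₁ ^ l * (l.factorial : ℝ) ^ 2)
    (bg : ∀ l, ‖iteratedDeriv l g x‖ ≤ C₂ * h₂ ^ l * (l.factorial : ℝ) ^ 2) (l : ℕ) :
    ‖iteratedDeriv l (fun y => f y * g y) x‖
      ≤ C₁ * C₂ * (h₁ + h₂) ^ l * (l.factorial : ℝ) ^ 2 := by
  rw [← norm_iteratedFDeriv_eq_norm_iteratedDeriv]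
  refine (norm_iteratedFDeriv_mul_le (n := l) (N := ∞) hf hg x (by exact_mod_cast le_top)).trans ?_
  rw [add_pow, Finset.mul_sum, Finset.sum_mul]
  refine Finset.sum_le_sum fun i hi => ?_
  have hil : i ≤ l := Nat.lt_succ_iff.mp (Finset.mem_range.mp hi)
  have hfac : ((i.factorial : ℝ) * ((l - i).factorial : ℝ)) ^ 2 ≤ (l.factorial : ℝ) ^ 2 := by
    gcongr
    exact_mod_cast Nat.le_of_dvd l.factorial_pos (Nat.factorial_mul_factorial_dvd_factorial hil)
  have hC₂ : 0 ≤ C₂ := by simpa using (norm_nonneg _).trans (bg 0)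
  have b2 := bg (l - i)
  have h0 := (norm_nonneg _).trans b2
  have key : 0 ≤ h₂ ^ (l - i) ∨ C₂ = 0 := by
    rcases hC₂.eq_or_lt with h | h
    · exact Or.inr h.symm
    · left
      have : 0 < (((l - i).factorial : ℕ) : ℝ) ^ 2 := by positivity
      exact nonneg_of_mul_nonneg_right (nonneg_of_mul_nonneg_left h0 this) h
  rw [norm_iteratedFDeriv_eq_norm_iteratedDeriv, norm_iteratedFDeriv_eq_norm_iteratedDeriv]
  calc (l.choose i : ℝ) * ‖iteratedDeriv i f x‖ * ‖iteratedDeriv (l - i) g x‖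
      ≤ (l.choose i : ℝ) * (C₁ * h₁ ^ i * (i.factorial : ℝ) ^ 2)
          * (C₂ * h₂ ^ (l - i) * ((l - i).factorial : ℝ) ^ 2) := by
        gcongr
        exact bf i
    _ = (C₁ * C₂ * (h₁ ^ i * h₂ ^ (l - i) * (l.choose i : ℝ)))
          * ((i.factorial : ℝ) * ((l - i).factorial : ℝ)) ^ 2 := by ring
    _ ≤ (C₁ * C₂ * (h₁ ^ i * h₂ ^ (l - i) * (l.choose i : ℝ))) * (l.factorial : ℝ) ^ 2 := by
        rcases key with k | k
        · gcongr
        · simp [k]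

/-- Smooth functions on the line with global Gevrey bounds of order two. -/
def GevreyBounded (f : ℝ → ℝ) : Prop :=
  ContDiff ℝ ∞ f ∧ ∃ C ≥ 0, ∃ h ≥ 0, ∀ l x,
    ‖iteratedDeriv l f x‖ ≤ C * h ^ l * (l.factorial : ℝ) ^ 2

lemma GevreyBounded.mul {f g : ℝ → ℝ} (hf : GevreyBounded f) (hg : GevreyBounded g) :
    GevreyBounded fun x => f x * g x := by
  obtain ⟨cf, C, hC, h, hh, bf⟩ := hf
  obtain ⟨cg, C', hC', h', hh', bg⟩ := hg
  exact ⟨cf.mul cg, C * C', by positivity, h + h', by positivity, fun l x =>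
    norm_iteratedDeriv_mul_le_gevrey cf cg x hC hh (bf · x) (bg · x) l⟩

lemma GevreyBounded.comp_affine {f : ℝ → ℝ} (hf : GevreyBounded f) (a b : ℝ) :
    GevreyBounded fun x => f (a * x + b) := by
  obtain ⟨cf, C, hC, h, hh, bf⟩ := hf
  refine ⟨cf.comp (by fun_prop), C, hC, |a| * h, by positivity, fun l x => ?_⟩
  have e : iteratedDeriv l (fun x => f (a * x + b)) x
      = a ^ l * iteratedDeriv l f (a * x + b) := by
    have h2 := iteratedDeriv_comp_const_mul (n := l) (f := fun y => f (y + b))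
      ((cf.comp (by fun_prop : ContDiff ℝ ∞ fun y : ℝ => y + b)).of_le
        (by exact_mod_cast le_top)) a
    rw [congrFun h2 x, iteratedDeriv_comp_add_const]
  rw [e, norm_mul, norm_pow, Real.norm_eq_abs]
  calc |a| ^ l * ‖iteratedDeriv l f (a * x + b)‖
      ≤ |a| ^ l * (C * h ^ l * (l.factorial : ℝ) ^ 2) := by gcongr; exact bf _ _
    _ = _ := by ring

lemma factorial_two_mul_le (l : ℕ) : ((2 * l).factorial : ℝ) ≤ 4 ^ l * (l.factorial : ℝ) ^ 2 := by
  have h := Nat.choose_mul_factorial_mul_factorial (show l ≤ 2 * l by lia)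
  have h2 : (2 * l).choose l ≤ 4 ^ l := by
    calc (2 * l).choose l ≤ 2 ^ (2 * l) := Nat.choose_le_two_pow _ _
      _ = 4 ^ l := by rw [pow_mul]; norm_num
  rw [show 2 * l - l = l by lia] at h
  rw [← h]
  push_cast
  have : ((2 * l).choose l : ℝ) ≤ 4 ^ l := by exact_mod_cast h2
  nlinarith [sq_nonneg (l.factorial : ℝ)]

lemma contDiff_inv_pow_mul_expNegInvGlue (j : ℕ) :
    ContDiff ℝ ∞ fun x : ℝ => x⁻¹ ^ j * expNegInvGlue x := by
  have := expNegInvGlue.contDiff_polynomial_eval_inv_mul (n := ⊤) (Polynomial.X ^ j)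
  simpa using this

lemma hasDerivAt_inv_pow_mul_expNegInvGlue (j : ℕ) (x : ℝ) :
    HasDerivAt (fun x : ℝ => x⁻¹ ^ j * expNegInvGlue x)
      (-(j : ℝ) * (x⁻¹ ^ (j + 1) * expNegInvGlue x) + x⁻¹ ^ (j + 2) * expNegInvGlue x) x := by
  have := expNegInvGlue.hasDerivAt_polynomial_eval_inv_mul (Polynomial.X ^ j) x
  simp only [Polynomial.eval_pow, Polynomial.eval_X] at this
  convert this using 1
  simp only [Polynomial.derivative_X_pow, Polynomial.eval_mul, Polynomial.eval_sub,
    Polynomial.eval_pow, Polynomial.eval_X, map_natCast, Polynomial.eval_natCast]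
  rcases j with _ | j
  · simp
  · simp; ring

lemma norm_iteratedDeriv_inv_pow_mul_expNegInvGlue_le (l : ℕ) : ∀ (j : ℕ) (x : ℝ),
    ‖iteratedDeriv l (fun x : ℝ => x⁻¹ ^ j * expNegInvGlue x) x‖
      ≤ 2 ^ l * ((j + 2 * l).factorial : ℝ) := by
  induction l with
  | zero =>
    intro j x
    simp only [iteratedDeriv_zero, pow_zero, mul_zero, add_zero, one_mul]
    rcases le_or_gt x 0 with hx | hx
    · simp [expNegInvGlue.zero_of_nonpos hx]
    · have hp : 0 < x⁻¹ := inv_pos.mpr hx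
      have := Real.pow_div_factorial_le_exp x⁻¹ hp.le j
      rw [expNegInvGlue, if_neg hx.not_ge, Real.norm_of_nonneg (by positivity), Real.exp_neg]
      rw [div_le_iff₀ (by positivity)] at this
      rw [← div_eq_mul_inv, div_le_iff₀ (Real.exp_pos _)]
      linarith
  | succ l ih =>
    intro j x
    have hd : deriv (fun x : ℝ => x⁻¹ ^ j * expNegInvGlue x)
        = fun x => -(j : ℝ) * (x⁻¹ ^ (j + 1) * expNegInvGlue x)
          + x⁻¹ ^ (j + 2) * expNegInvGlue x :=
      funext fun x => (hasDerivAt_inv_pow_mul_expNegInvGlue j x).deriv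
    rw [iteratedDeriv_succ', hd]
    have c1 := (contDiff_inv_pow_mul_expNegInvGlue (j + 1)).of_le
      (show (l : WithTop ℕ∞) ≤ ∞ by exact_mod_cast le_top)
    have c2 := (contDiff_inv_pow_mul_expNegInvGlue (j + 2)).of_le
      (show (l : WithTop ℕ∞) ≤ ∞ by exact_mod_cast le_top)
    have e := iteratedDeriv_fun_add (x := x) (n := l)
      (f := fun x : ℝ => -(j : ℝ) * (x⁻¹ ^ (j + 1) * expNegInvGlue x))
      (g := fun x : ℝ => x⁻¹ ^ (j + 2) * expNegInvGlue x)
      (contDiff_const.mul c1).contDiffAt c2.contDiffAt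
    rw [e, iteratedDeriv_const_mul_field]
    refine (norm_add_le _ _).trans ?_
    rw [norm_mul, norm_neg, Real.norm_natCast]
    have i1 := ih (j + 1) x
    have i2 := ih (j + 2) x
    have f1 : (j : ℝ) * ((j + 1 + 2 * l).factorial : ℝ) ≤ ((j + 2 * (l + 1)).factorial : ℝ) := by
      rw [show j + 2 * (l + 1) = (j + 1 + 2 * l) + 1 by ring, Nat.factorial_succ]
      push_cast
      gcongr
      linarith [(by positivity : (0 : ℝ) ≤ l)]
    rw [show j + 2 + 2 * l = j + 2 * (l + 1) by ring] at i2
    calc (j : ℝ) * ‖iteratedDeriv l (fun x : ℝ => x⁻¹ ^ (j + 1) * expNegInvGlue x) x‖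
          + ‖iteratedDeriv l (fun x : ℝ => x⁻¹ ^ (j + 2) * expNegInvGlue x) x‖
        ≤ (j : ℝ) * (2 ^ l * ((j + 1 + 2 * l).factorial : ℝ))
          + 2 ^ l * ((j + 2 * (l + 1)).factorial : ℝ) := by gcongr
      _ = 2 ^ l * ((j : ℝ) * ((j + 1 + 2 * l).factorial : ℝ))
          + 2 ^ l * ((j + 2 * (l + 1)).factorial : ℝ) := by ring
      _ ≤ 2 ^ l * ((j + 2 * (l + 1)).factorial : ℝ)
          + 2 ^ l * ((j + 2 * (l + 1)).factorial : ℝ) := by gcongr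
      _ = _ := by ring

lemma gevreyBounded_expNegInvGlue : GevreyBounded expNegInvGlue := by
  refine ⟨expNegInvGlue.contDiff, 1, by norm_num, 8, by norm_num, fun l x => ?_⟩
  have h := norm_iteratedDeriv_inv_pow_mul_expNegInvGlue_le l 0 x
  simp only [pow_zero, one_mul, zero_add] at h
  refine h.trans ?_
  calc (2 : ℝ) ^ l * ((2 * l).factorial : ℝ)
      ≤ 2 ^ l * (4 ^ l * (l.factorial : ℝ) ^ 2) := by gcongr; exact factorial_two_mul_le l
    _ = _ := by rw [← mul_assoc, ← mul_pow]; norm_num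

/-- A Gevrey step function: `0` on the left of `0` and `1` on the right of `1`. -/
lemma exists_gevreyBounded_step :
    ∃ ψ : ℝ → ℝ, GevreyBounded ψ ∧ (∀ x ≤ 0, ψ x = 0) ∧ ∀ x ≥ 1, ψ x = 1 := by
  set β : ℝ → ℝ := fun s => expNegInvGlue s * expNegInvGlue (1 - s) with hβ
  have gβ : GevreyBounded β := by
    have := gevreyBounded_expNegInvGlue.mul (gevreyBounded_expNegInvGlue.comp_affine (-1) 1)
    convert this using 3
    ring_nf
  obtain ⟨cβ, C, hC, h, hh, bβ⟩ := gβ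
  have contβ : Continuous β := cβ.continuous
  have β0 : ∀ s ≤ 0, β s = 0 := fun s hs => by simp [hβ, expNegInvGlue.zero_of_nonpos hs]
  have β1 : ∀ s ≥ 1, β s = 0 := fun s hs => by
    simp [hβ, expNegInvGlue.zero_of_nonpos (show 1 - s ≤ 0 by linarith)]
  set I := ∫ s in (0 : ℝ)..1, β s with hI
  have Ipos : 0 < I := by
    refine intervalIntegral.intervalIntegral_pos_of_pos_on (contβ.intervalIntegrable _ _)
      (fun s hs => ?_) one_pos
    exact mul_pos (expNegInvGlue.pos_of_pos hs.1) (expNegInvGlue.pos_of_pos (by linarith [hs.2]))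
  set ψ : ℝ → ℝ := fun x => I⁻¹ * ∫ s in (0 : ℝ)..x, β s with hψ
  have dψ : ∀ x, HasDerivAt ψ (I⁻¹ * β x) x := fun x =>
    (intervalIntegral.integral_hasDerivAt_right (contβ.intervalIntegrable _ _)
      (contβ.stronglyMeasurableAtFilter _ _) contβ.continuousAt).const_mul _
  have dψ' : deriv ψ = fun x => I⁻¹ * β x := funext fun x => (dψ x).deriv
  have ψ0 : ∀ x ≤ 0, ψ x = 0 := fun x hx => by
    have : ∫ s in (0 : ℝ)..x, β s = 0 := by
      rw [intervalIntegral.integral_symm, neg_eq_zero]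
      refine (intervalIntegral.integral_congr (g := fun _ => 0) fun s hs => ?_).trans (by simp)
      rw [Set.uIcc_of_le hx] at hs
      exact β0 s hs.2
    simp [hψ, this]
  have ψ1 : ∀ x ≥ 1, ψ x = 1 := fun x hx => by
    have : ∫ s in (1 : ℝ)..x, β s = 0 := by
      refine (intervalIntegral.integral_congr (g := fun _ => 0) fun s hs => ?_).trans (by simp)
      rw [Set.uIcc_of_le hx] at hs
      exact β1 s hs.1
    simp only [hψ]
    rw [← intervalIntegral.integral_add_adjacent_intervals (contβ.intervalIntegrable 0 1)
      (contβ.intervalIntegrable 1 x), this, add_zero, ← hI, inv_mul_cancel₀ Ipos.ne']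
  have mono : Monotone ψ := monotone_of_deriv_nonneg (fun x => (dψ x).differentiableAt) fun x => by
    rw [dψ']
    exact mul_nonneg (inv_nonneg.mpr Ipos.le)
      (mul_nonneg (expNegInvGlue.nonneg _) (expNegInvGlue.nonneg _))
  refine ⟨ψ, ⟨?_, max 1 (I⁻¹ * C), by positivity, max 1 h, by positivity, ?_⟩, ψ0, ψ1⟩
  · rw [contDiff_infty_iff_deriv, dψ']
    exact ⟨fun x => (dψ x).differentiableAt, contDiff_const.mul cβ⟩
  · intro l x
    rcases l with _ | l
    · simp only [iteratedDeriv_zero, pow_zero, mul_one, Nat.factorial_zero, Nat.cast_one, one_pow]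
      refine le_max_of_le_left ?_
      have l0 : 0 ≤ ψ x := by
        rw [← ψ0 (min x 0) (min_le_right _ _)]; exact mono (min_le_left _ _)
      have l1 : ψ x ≤ 1 := by
        rw [← ψ1 (max x 1) (le_max_right _ _)]; exact mono (le_max_left _ _)
      rwa [Real.norm_of_nonneg l0]
    · rw [iteratedDeriv_succ', dψ', iteratedDeriv_const_mul_field, norm_mul,
        Real.norm_of_nonneg (inv_nonneg.mpr Ipos.le)]
      calc I⁻¹ * ‖iteratedDeriv l β x‖ ≤ I⁻¹ * (C * h ^ l * (l.factorial : ℝ) ^ 2) := by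
            gcongr; exact bβ l x
        _ = (I⁻¹ * C) * h ^ l * (l.factorial : ℝ) ^ 2 := by ring
        _ ≤ max 1 (I⁻¹ * C) * max 1 h ^ (l + 1) * ((l + 1).factorial : ℝ) ^ 2 := by
            have : h ^ l ≤ max 1 h ^ (l + 1) :=
              (pow_le_pow_left₀ hh (le_max_right _ _) l).trans
                (pow_le_pow_right₀ (le_max_left _ _) (Nat.le_succ l))
            gcongr
            · exact le_max_right _ _
            · exact Nat.le_succ l

/-- A Gevrey cutoff: `1` near the origin, `0` away from it. -/
lemma exists_gevreyBounded_cutoff :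
    ∃ χ : ℝ → ℝ, GevreyBounded χ ∧ (∀ x, |x| ≤ 1 / 8 → χ x = 1) ∧
      ∀ x, 3 / 8 ≤ |x| → χ x = 0 := by
  obtain ⟨ψ, gψ, h0, h1⟩ := exists_gevreyBounded_step
  refine ⟨_, (gψ.comp_affine 4 (3 / 2)).mul (gψ.comp_affine (-4) (3 / 2)), fun x hx => ?_,
    fun x hx => ?_⟩
  · rw [abs_le] at hx
    rw [h1 _ (by linarith [hx.1]), h1 _ (by linarith [hx.2]), one_mul]
  · rcases le_abs.mp hx with hx | hx
    · rw [h0 (-4 * x + 3 / 2) (by linarith), mul_zero]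
    · rw [h0 (4 * x + 3 / 2) (by linarith), zero_mul]

end GevreyCutoff

section FourierCoefficients

open scoped ContDiff
open MeasureTheory

variable {N : ℕ}

/-- The character `x ↦ exp (2πi μ·x)`. -/
noncomputable def wave (μ : Fin N → ℤ) (x : Fin N → ℝ) : ℂ :=
  cexp (2 * Real.pi * I * ∑ j, (μ j : ℂ) * (x j : ℂ))

lemma contDiff_wave (μ : Fin N → ℤ) : ContDiff ℝ ∞ (wave μ) := by
  unfold wave
  refine ContDiff.cexp (contDiff_const.mul (ContDiff.sum fun j _ => contDiff_const.mul ?_))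
  exact Complex.ofRealCLM.contDiff.comp (contDiff_apply ℝ ℝ j)

lemma norm_wave (μ : Fin N → ℤ) (x : Fin N → ℝ) : ‖wave μ x‖ = 1 := by
  have : (2 * Real.pi * I * ∑ j, (μ j : ℂ) * (x j : ℂ) : ℂ)
      = ((2 * Real.pi * ∑ j, (μ j : ℝ) * x j : ℝ) : ℂ) * I := by
    push_cast; ring
  rw [wave, this, Complex.norm_exp_ofReal_mul_I]

lemma pd_wave (μ : Fin N → ℤ) (j : Fin N) (x : Fin N → ℝ) :
    pd j (wave μ) x = 2 * Real.pi * I * μ j * wave μ x := by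
  have h1 : HasFDerivAt (fun x : Fin N → ℝ => ∑ i, (μ i : ℂ) * (x i : ℂ))
      (∑ i, (μ i : ℂ) • (Complex.ofRealCLM.comp
        (ContinuousLinearMap.proj (R := ℝ) (φ := fun _ : Fin N => ℝ) i))) x := by
    refine HasFDerivAt.fun_sum fun i _ => HasFDerivAt.const_mul ?_ _
    exact Complex.ofRealCLM.hasFDerivAt.comp x (hasFDerivAt_apply i x)
  have h2 := (h1.const_mul (2 * Real.pi * I : ℂ)).cexp
  have h3 : fderiv ℝ (wave μ) x = _ := h2.fderiv
  rw [pd, h3]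
  have h4 : ∑ i, (μ i : ℂ) * ((Pi.single j (1 : ℝ) : Fin N → ℝ) i : ℂ) = μ j := by
    rw [Finset.sum_eq_single j (fun i _ h => by simp [h]) (by simp)]
    simp
  simp only [wave, FunLike.coe_smul, Pi.smul_apply, sum_apply,
    ContinuousLinearMap.coe_comp, Function.comp_apply, ContinuousLinearMap.proj_apply,
    Complex.ofRealCLM_apply, smul_eq_mul, h4]
  ring

/-- The `μ`-th Fourier coefficient of a function on `ℝ^N`. -/
noncomputable def fcoef (f : (Fin N → ℝ) → ℂ) (μ : Fin N → ℤ) : ℂ :=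
  ∫ x, f x * wave (-μ) x

/-- Smooth functions supported in the cube `|x_j| ≤ 3/8`. -/
def CubeSmooth (f : (Fin N → ℝ) → ℂ) : Prop :=
  ContDiff ℝ ∞ f ∧ tsupport f ⊆ {x | ∀ j, |x j| ≤ 3 / 8}

lemma isCompact_cube (r : ℝ) : IsCompact {x : Fin N → ℝ | ∀ j, |x j| ≤ r} := by
  have : {x : Fin N → ℝ | ∀ j, |x j| ≤ r} = Set.pi Set.univ fun _ => Set.Icc (-r) r := by
    ext x; simp only [Set.mem_ofPred_eq, abs_le, Set.mem_univ_pi, Set.mem_Icc]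
  rw [this]
  exact isCompact_univ_pi fun _ => isCompact_Icc

lemma CubeSmooth.hasCompactSupport {f : (Fin N → ℝ) → ℂ} (hf : CubeSmooth f) :
    HasCompactSupport f :=
  (isCompact_cube (3 / 8)).of_isClosed_subset (isClosed_tsupport f) hf.2

lemma contDiff_pd {f : (Fin N → ℝ) → ℂ} (hf : ContDiff ℝ ∞ f) (j : Fin N) :
    ContDiff ℝ ∞ (pd j f) :=
  (hf.fderiv_right (m := ∞) (by simp)).clm_apply contDiff_const

lemma CubeSmooth.pd {f : (Fin N → ℝ) → ℂ} (hf : CubeSmooth f) (j : Fin N) :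
    CubeSmooth (pd j f) := by
  refine ⟨contDiff_pd hf.1 j, ?_⟩
  refine (closure_minimal ?_ (isClosed_tsupport f)).trans hf.2
  intro x hx
  refine support_fderiv_subset ℝ (f := f) ?_
  intro h
  exact hx (by simp [_root_.pd, h])

lemma CubeSmooth.integrable_mul {f g : (Fin N → ℝ) → ℂ} (hf : CubeSmooth f) (hg : Continuous g) :
    Integrable fun x => f x * g x :=
  (hf.1.continuous.mul hg).integrable_of_hasCompactSupport hf.hasCompactSupport.mul_right

lemma fcoef_pd {f : (Fin N → ℝ) → ℂ} (hf : CubeSmooth f) (j : Fin N) (μ : Fin N → ℤ) :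
    fcoef (pd j f) μ = 2 * Real.pi * I * μ j * fcoef f μ := by
  have cw := contDiff_wave (-μ)
  have h := integral_mul_fderiv_eq_neg_fderiv_mul_of_integrable (μ := volume) (f := f)
    (g := wave (-μ)) (v := Pi.single j 1)
    ((hf.pd j).integrable_mul cw.continuous)
    (hf.integrable_mul (contDiff_pd cw j).continuous)
    (hf.integrable_mul cw.continuous)
    (fun x _ => (hf.1.differentiable (by simp)).differentiableAt)
    (fun x _ => (cw.differentiable (by simp)).differentiableAt)
  have h' : fcoef (pd j f) μ = -∫ x, f x * pd j (wave (-μ)) x := by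
    rw [fcoef]; simp only [pd]; rw [h, neg_neg]
  rw [h', fcoef, ← integral_const_mul, ← integral_neg]
  refine integral_congr_ae (.of_forall fun x => ?_)
  simp only [pd_wave, Pi.neg_apply, Int.cast_neg]
  ring

lemma norm_fcoef_le {f : (Fin N → ℝ) → ℂ} (hf : CubeSmooth f) {C : ℝ}
    (hC : ∀ x, ‖f x‖ ≤ C) (μ : Fin N → ℤ) : ‖fcoef f μ‖ ≤ C := by
  have hC0 : 0 ≤ C := (norm_nonneg _).trans (hC 0)
  have hs : fcoef f μ = ∫ x in Set.pi Set.univ fun _ => Set.Icc (-(1 / 2) : ℝ) (1 / 2),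
      f x * wave (-μ) x := by
    rw [fcoef, setIntegral_eq_integral_of_forall_compl_eq_zero]
    intro x hx
    have : f x = 0 := by
      by_contra h
      refine hx fun j _ => ?_
      have := hf.2 (subset_tsupport f h) j
      rw [abs_le] at this
      exact ⟨by linarith [this.1], by linarith [this.2]⟩
    simp [this]
  have hv : volume (Set.pi Set.univ fun _ : Fin N => Set.Icc (-(1 / 2) : ℝ) (1 / 2)) = 1 := by
    rw [volume_pi_pi]
    simp only [Real.volume_Icc]
    norm_num
  rw [hs]
  refine (norm_setIntegral_le_of_norm_le_const (C := C) (by rw [hv]; simp) fun x _ => ?_).trans ?_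
  · rw [norm_mul, norm_wave, mul_one]; exact hC x
  · rw [Measure.real, hv]; simp

lemma CubeSmooth.iterate_pd {f : (Fin N → ℝ) → ℂ} (hf : CubeSmooth f) (j : Fin N) (l : ℕ) :
    CubeSmooth ((_root_.pd j)^[l] f) := by
  induction l with
  | zero => exact hf
  | succ l ih => rw [Function.iterate_succ_apply']; exact ih.pd j

lemma fcoef_iterate_pd {f : (Fin N → ℝ) → ℂ} (hf : CubeSmooth f) (j : Fin N) (l : ℕ)
    (μ : Fin N → ℤ) :
    fcoef ((pd j)^[l] f) μ = (2 * Real.pi * I * μ j) ^ l * fcoef f μ := by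
  induction l with
  | zero => simp
  | succ l ih => rw [Function.iterate_succ_apply', fcoef_pd (hf.iterate_pd j l), ih]; ring

lemma le_exp_neg_sqrt_of_gevrey {a C X : ℝ} (ha : 0 ≤ a) (hX : 0 ≤ X)
    (h : ∀ l : ℕ, X ^ l * a ≤ C * (l.factorial : ℝ) ^ 2) :
    a ≤ 4 * C * Real.exp (-Real.sqrt X) := by
  have hC : 0 ≤ C := by simpa using ha.trans (by simpa using h 0)
  have hl : ∀ l : ℕ, (Real.sqrt X / 2) ^ l / l.factorial * Real.sqrt a
      ≤ Real.sqrt C * (1 / 2) ^ l := by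
    intro l
    have h1 : Real.sqrt (X ^ l * a) ≤ Real.sqrt (C * (l.factorial : ℝ) ^ 2) :=
      Real.sqrt_le_sqrt (h l)
    rw [Real.sqrt_mul (by positivity), Real.sqrt_mul hC, Real.sqrt_sq (by positivity)] at h1
    have h2 : Real.sqrt (X ^ l) = Real.sqrt X ^ l := by
      rw [← Real.sqrt_sq (by positivity : 0 ≤ Real.sqrt X ^ l), ← pow_mul, mul_comm l 2, pow_mul,
        Real.sq_sqrt hX]
    rw [h2] at h1
    rw [div_pow, div_pow, one_pow, div_div, div_mul_eq_mul_div, div_le_iff₀ (by positivity)]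
    calc Real.sqrt X ^ l * Real.sqrt a ≤ Real.sqrt C * l.factorial := h1
      _ = _ := by field_simp
  have hs1 : HasSum (fun l : ℕ => (Real.sqrt X / 2) ^ l / l.factorial * Real.sqrt a)
      (Real.exp (Real.sqrt X / 2) * Real.sqrt a) := by
    refine HasSum.mul_right _ ?_
    have := NormedSpace.expSeries_div_hasSum_exp (Real.sqrt X / 2)
    rwa [← Real.exp_eq_exp_ℝ] at this
  have hs2 : HasSum (fun l : ℕ => Real.sqrt C * (1 / 2 : ℝ) ^ l) (Real.sqrt C * 2) :=
    hasSum_geometric_two.mul_left _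
  have h3 := hasSum_le hl hs1 hs2
  have h4 : (Real.exp (Real.sqrt X / 2) * Real.sqrt a) ^ 2 ≤ (Real.sqrt C * 2) ^ 2 := by
    gcongr
  rw [mul_pow, mul_pow, Real.sq_sqrt ha, Real.sq_sqrt hC, ← Real.exp_nat_mul] at h4
  rw [Real.exp_neg, ← div_eq_mul_inv, le_div_iff₀ (Real.exp_pos _)]
  rw [show ((2 : ℕ) : ℝ) * (Real.sqrt X / 2) = Real.sqrt X by push_cast; ring] at h4
  linarith

/-- The norm attached to the Gevrey class of order two: the sum of the square roots. -/
noncomputable def sqrtSum (μ : Fin N → ℤ) : ℝ := ∑ j, Real.sqrt |(μ j : ℝ)|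

lemma exists_fcoef_decay {f : (Fin N → ℝ) → ℂ} (hf : CubeSmooth f)
    (hg : ∀ j, ∃ C ≥ 0, ∃ h > 0, ∀ l x,
      ‖(pd j)^[l] f x‖ ≤ C * h ^ l * (l.factorial : ℝ) ^ 2) :
    ∃ C ≥ 0, ∃ c > 0, ∀ μ : Fin N → ℤ, ‖fcoef f μ‖ ≤ C * Real.exp (-c * sqrtSum μ) := by
  choose C hC h hh hb using hg
  have key : ∀ j μ, ‖fcoef f μ‖ ≤ 4 * C j * Real.exp (-Real.sqrt (|(μ j : ℝ)| / h j)) := by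
    intro j μ
    refine le_exp_neg_sqrt_of_gevrey (norm_nonneg _) (by have := hh j; positivity) fun l => ?_
    have h1 := norm_fcoef_le (hf.iterate_pd j l) (hb j l) μ
    rw [fcoef_iterate_pd hf, norm_mul, norm_pow] at h1
    have h2 : |(μ j : ℝ)| ≤ ‖(2 * Real.pi * I * μ j : ℂ)‖ := by
      simp only [norm_mul, Complex.norm_ofNat, Complex.norm_real, Complex.norm_I, mul_one,
        Complex.norm_intCast, Real.norm_eq_abs, abs_of_pos Real.pi_pos]
      have := Real.pi_gt_three
      nlinarith [abs_nonneg (μ j : ℝ)]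
    have h3 : |(μ j : ℝ)| ^ l * ‖fcoef f μ‖ ≤ C j * h j ^ l * (l.factorial : ℝ) ^ 2 :=
      le_trans (by gcongr) h1
    have hp : 0 < h j ^ l := pow_pos (hh j) l
    rw [div_pow, div_mul_eq_mul_div, div_le_iff₀ hp]
    linarith
  rcases Nat.eq_zero_or_pos N with rfl | hN
  · exact ⟨‖fcoef f 0‖, norm_nonneg _, 1, one_pos, fun μ => by
      rw [Subsingleton.elim μ 0]; simp [sqrtSum]⟩
  set Cs := ∑ j, 4 * C j with hCs
  set hs := 1 + ∑ j, h j with hhs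
  have hC' : ∀ j, 4 * C j ≤ Cs := fun j =>
    Finset.single_le_sum (f := fun j => 4 * C j) (fun i _ => by have := hC i; positivity)
      (Finset.mem_univ j)
  have hh' : ∀ j, h j ≤ hs := fun j => by
    have := Finset.single_le_sum (f := h) (fun i _ => (hh i).le) (Finset.mem_univ j)
    simp only [hhs]; linarith
  have hs0 : 0 < hs := by
    have : 0 ≤ ∑ j, h j := Finset.sum_nonneg fun i _ => (hh i).le
    positivity
  have Cs0 : 0 ≤ Cs := Finset.sum_nonneg fun i _ => by have := hC i; positivity
  refine ⟨Cs, Cs0, (Real.sqrt hs)⁻¹ / N, by positivity, fun μ => ?_⟩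
  have kj : ∀ j, ‖fcoef f μ‖ ≤ Cs * Real.exp (-(Real.sqrt hs)⁻¹ * Real.sqrt |(μ j : ℝ)|) := by
    intro j
    refine (key j μ).trans ?_
    gcongr
    · exact hC' j
    · have : Real.sqrt (|(μ j : ℝ)| / hs) ≤ Real.sqrt (|(μ j : ℝ)| / h j) := by
        apply Real.sqrt_le_sqrt
        gcongr
        · exact hh j
        · exact hh' j
      rw [Real.sqrt_div (abs_nonneg _)] at this
      calc -Real.sqrt (|(μ j : ℝ)| / h j) ≤ -(Real.sqrt |(μ j : ℝ)| / Real.sqrt hs) :=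
            neg_le_neg this
        _ = _ := by ring
  obtain ⟨j, -, hj⟩ := Finset.exists_max_image Finset.univ (fun j => Real.sqrt |(μ j : ℝ)|)
    ⟨⟨0, hN⟩, Finset.mem_univ _⟩
  refine (kj j).trans (mul_le_mul_of_nonneg_left (Real.exp_le_exp.mpr ?_) Cs0)
  have hle : sqrtSum μ ≤ N * Real.sqrt |(μ j : ℝ)| := by
    have := Finset.sum_le_card_nsmul Finset.univ (fun j => Real.sqrt |(μ j : ℝ)|)
      (Real.sqrt |(μ j : ℝ)|) hj
    simpa [sqrtSum] using this
  have : (Real.sqrt hs)⁻¹ / N * sqrtSum μ ≤ (Real.sqrt hs)⁻¹ / N * (N * Real.sqrt |(μ j : ℝ)|) := by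
    gcongr
  have e : (Real.sqrt hs)⁻¹ / N * (N * Real.sqrt |(μ j : ℝ)|)
      = (Real.sqrt hs)⁻¹ * Real.sqrt |(μ j : ℝ)| := by
    field_simp
  linarith

/-- The function on the torus obtained from a function supported in the cube. -/
noncomputable def torusLift (f : (Fin N → ℝ) → ℂ) (θ : UnitAddTorus (Fin N)) : ℂ :=
  f fun j => (AddCircle.equivIoc 1 (-(1 / 2) : ℝ) (θ j) : ℝ)

lemma torusLift_coe (f : (Fin N → ℝ) → ℂ) {x : Fin N → ℝ}
    (hx : ∀ j, x j ∈ Set.Ioc (-(1 / 2) : ℝ) (-(1 / 2) + 1)) :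
    torusLift f (fun j => (x j : AddCircle (1 : ℝ))) = f x := by
  unfold torusLift
  congr 1
  funext j
  exact AddCircle.equivIoc_coe_of_mem (hx j)

lemma continuous_torusLift {f : (Fin N → ℝ) → ℂ} (hf : CubeSmooth f) :
    Continuous (torusLift f) := by
  rw [continuous_iff_continuousAt]
  intro θ
  by_cases h : ∀ j, ‖θ j‖ < 1 / 2
  · have hc : ∀ j, ContinuousAt (fun θ : UnitAddTorus (Fin N) =>
        (AddCircle.equivIoc 1 (-(1 / 2) : ℝ) (θ j) : ℝ)) θ := by
      intro j
      have hne : θ j ≠ ((-(1 / 2) : ℝ) : AddCircle (1 : ℝ)) := by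
        intro e
        have := h j
        rw [e, (AddCircle.norm_coe_eq_abs_iff (1 : ℝ) one_ne_zero).mpr (by norm_num [abs_of_pos])]
          at this
        norm_num [abs_of_pos] at this
      exact continuous_subtype_val.continuousAt.comp
        (ContinuousAt.comp (f := fun θ : UnitAddTorus (Fin N) => θ j)
          (AddCircle.continuousAt_equivIoc (1 : ℝ) _ hne) (continuous_apply j).continuousAt)
    exact hf.1.continuous.continuousAt.comp (continuousAt_pi.mpr hc)
  · push Not at h
    obtain ⟨j, hj⟩ := h
    have ho : {θ : UnitAddTorus (Fin N) | 3 / 8 < ‖θ j‖} ∈ nhds θ :=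
      (isOpen_lt continuous_const (continuous_apply j).norm).mem_nhds
        (show (3 / 8 : ℝ) < ‖θ j‖ by linarith)
    refine ContinuousAt.congr (f := fun _ => (0 : ℂ)) continuousAt_const ?_
    filter_upwards [ho] with η hη
    symm
    by_contra hne
    have := hf.2 (subset_tsupport f hne) j
    have e : η j = ((AddCircle.equivIoc 1 (-(1 / 2) : ℝ) (η j) : ℝ) : AddCircle (1 : ℝ)) :=
      AddCircle.coe_equivIoc.symm
    have hη' : 3 / 8 < ‖η j‖ := hη
    rw [e, (AddCircle.norm_coe_eq_abs_iff (1 : ℝ) one_ne_zero).mpr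
      (by rw [abs_one]; linarith)] at hη'
    linarith

lemma mFourier_coe (μ : Fin N → ℤ) (x : Fin N → ℝ) :
    UnitAddTorus.mFourier μ (fun j => (x j : AddCircle (1 : ℝ))) = wave μ x := by
  simp only [UnitAddTorus.mFourier, ContinuousMap.coe_mk, fourier_coe_apply, wave]
  rw [← Complex.exp_sum, Finset.mul_sum]
  congr 1
  refine Finset.sum_congr rfl fun j _ => ?_
  simp; ring

lemma mFourierCoeff_torusLift {f : (Fin N → ℝ) → ℂ} (hf : CubeSmooth f) (μ : Fin N → ℤ) :
    UnitAddTorus.mFourierCoeff (torusLift f) μ = fcoef f μ := by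
  rw [UnitAddTorus.mFourierCoeff_eq_integral _ _ fun _ => -(1 / 2), fcoef,
    ← setIntegral_eq_integral_of_forall_compl_eq_zero (f := fun x => f x * wave (-μ) x)
      (s := {x : Fin N → ℝ | ∀ i, x i ∈ Set.Ioc (-(1 / 2) : ℝ) (-(1 / 2) + 1)})]
  · refine setIntegral_congr_fun
      (MeasurableSet.univ_pi' fun i => measurableSet_Ioc (α := ℝ)) fun x hx => ?_
    rw [torusLift_coe f hx, mFourier_coe, smul_eq_mul, mul_comm]
  · intro x hx
    have : f x = 0 := by
      by_contra h
      refine hx fun j => ?_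
      have := hf.2 (subset_tsupport f h) j
      rw [abs_le] at this
      exact ⟨by linarith [this.1], by linarith [this.2]⟩
    simp [this]

lemma hasSum_fcoef {f : (Fin N → ℝ) → ℂ} (hf : CubeSmooth f) (hs : Summable (fcoef f))
    {x : Fin N → ℝ} (hx : ∀ j, |x j| < 1 / 2) :
    HasSum (fun μ => fcoef f μ * wave μ x) (f x) := by
  have e : UnitAddTorus.mFourierCoeff (torusLift f) = fcoef f :=
    funext (mFourierCoeff_torusLift hf)
  have h := UnitAddTorus.hasSum_mFourier_series_apply_of_summable
    (f := ⟨torusLift f, continuous_torusLift hf⟩) (by simpa [e] using hs)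
    (fun j => (x j : AddCircle (1 : ℝ)))
  simp only [ContinuousMap.coe_mk, e, mFourier_coe, smul_eq_mul] at h
  rwa [torusLift_coe f fun j => ?_] at h
  have := abs_lt.mp (hx j)
  exact ⟨by linarith [this.1], by linarith [this.2]⟩

end FourierCoefficients

section CauchyData

open scoped ContDiff

variable {N : ℕ}

lemma hasDerivAt_line {f : (Fin N → ℝ) → ℂ} (hf : ContDiff ℝ ∞ f) (j : Fin N) (x : Fin N → ℝ)
    (s : ℝ) :
    HasDerivAt (fun s : ℝ => f (x + s • Pi.single j 1)) (pd j f (x + s • Pi.single j 1)) s := by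
  have h1 : HasDerivAt (fun s : ℝ => x + s • (Pi.single j 1 : Fin N → ℝ)) (Pi.single j 1) s := by
    simpa using ((hasDerivAt_id s).smul_const (Pi.single j 1 : Fin N → ℝ)).const_add x
  exact ((hf.differentiable (by simp)).differentiableAt.hasFDerivAt).comp_hasDerivAt s h1

lemma iteratedDeriv_line {f : (Fin N → ℝ) → ℂ} (hf : ContDiff ℝ ∞ f) (j : Fin N) (l : ℕ)
    (x : Fin N → ℝ) :
    iteratedDeriv l (fun s : ℝ => f (x + s • Pi.single j 1))
      = fun s => (pd j)^[l] f (x + s • Pi.single j 1) := by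
  have hl : ∀ l, ContDiff ℝ ∞ ((pd j)^[l] f) := by
    intro l
    induction l with
    | zero => exact hf
    | succ l ih => rw [Function.iterate_succ_apply']; exact contDiff_pd ih j
  induction l with
  | zero => simp
  | succ l ih =>
    rw [iteratedDeriv_succ, ih]
    funext s
    rw [Function.iterate_succ_apply']
    exact (hasDerivAt_line (hl l) j x s).deriv

lemma contDiff_line {f : (Fin N → ℝ) → ℂ} (hf : ContDiff ℝ ∞ f) (j : Fin N) (x : Fin N → ℝ) :
    ContDiff ℝ ∞ (fun s : ℝ => f (x + s • Pi.single j 1)) :=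
  hf.comp (contDiff_const.add (contDiff_id.smul contDiff_const))

lemma pdMulti_single (f : (Fin N → ℝ) → ℂ) (j : Fin N) (l : ℕ) :
    pdMulti (Pi.single j l) f = (pd j)^[l] f := by
  have key : ∀ L : List (Fin N), L.Nodup →
      L.foldr (fun i g => (pd i)^[(Pi.single j l : Fin N → ℕ) i] g) f
        = if j ∈ L then (pd j)^[l] f else f := by
    intro L
    induction L with
    | nil => simp
    | cons a L ih =>
      intro h
      rw [List.nodup_cons] at h
      rw [List.foldr_cons, ih h.2]
      by_cases ha : a = j
      · subst ha
        simp [h.1]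
      · simp [ha, Ne.symm ha]
  rw [pdMulti, key _ (List.nodup_finRange N)]
  simp

lemma GevreyOn.bound_iterate_pd {u : (Fin N → ℝ) → ℂ} (hu : GevreyOn 2 u)
    {K : Set (Fin N → ℝ)} (hK : IsCompact K) :
    ∃ C > 0, ∃ h > 0, ∀ j, ∀ x ∈ K, ∀ l : ℕ,
      ‖(pd j)^[l] u x‖ ≤ C * h ^ l * (l.factorial : ℝ) ^ 2 := by
  obtain ⟨C, hC, h, hh, hb⟩ := hu.2 K hK
  refine ⟨C, hC, h, hh, fun j x hx l => ?_⟩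
  have := hb x hx (Pi.single j l)
  rw [pdMulti_single] at this
  simpa using this

lemma iteratedDeriv_ofReal_comp {χ : ℝ → ℝ} (hχ : ContDiff ℝ ∞ χ) (l : ℕ) :
    iteratedDeriv l (fun s => (χ s : ℂ)) = fun s => ((iteratedDeriv l χ s : ℝ) : ℂ) := by
  induction l with
  | zero => simp
  | succ l ih =>
    rw [iteratedDeriv_succ, ih]
    funext s
    rw [iteratedDeriv_succ]
    have : DifferentiableAt ℝ (iteratedDeriv l χ) s :=
      (hχ.differentiable_iteratedDeriv l (by exact_mod_cast ENat.natCast_lt_top l)).differentiableAt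
    exact this.hasDerivAt.ofReal_comp.deriv

/-- Gevrey functions can be cut off to the unit cube with Fourier coefficients decaying like
`exp (-c ∑ √|μ_j|)`. -/
lemma exists_gevrey_localization {u : (Fin N → ℝ) → ℂ} (hu : GevreyOn 2 u) :
    ∃ w : (Fin N → ℝ) → ℝ, CubeSmooth (fun x => w x * u x) ∧
      (∀ x, (∀ j, |x j| ≤ 1 / 8) → w x = 1) ∧
      ∃ C ≥ 0, ∃ c > 0, ∀ μ, ‖fcoef (fun x => w x * u x) μ‖ ≤ C * Real.exp (-c * sqrtSum μ) := by
  obtain ⟨χ, ⟨hχs, A, hA, B, hB, hχ⟩, h1, h0⟩ := exists_gevreyBounded_cutoff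
  have hws : ContDiff ℝ ∞ fun x : Fin N → ℝ => ∏ i, χ (x i) :=
    contDiff_prod fun i _ => hχs.comp (contDiff_apply ℝ ℝ i)
  have hcs : CubeSmooth fun x : Fin N → ℝ => ((∏ i, χ (x i) : ℝ) : ℂ) * u x := by
    refine ⟨(Complex.ofRealCLM.contDiff.comp hws).mul hu.1, ?_⟩
    refine closure_minimal ?_ (isCompact_cube _).isClosed
    intro x hx j
    by_contra hj
    refine hx ?_
    have : ∏ i, χ (x i) = 0 := Finset.prod_eq_zero (Finset.mem_univ j) (h0 _ (by push Not at hj; exact hj.le))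
    simp [this]
  refine ⟨fun x => ∏ i, χ (x i), hcs, fun x hx => Finset.prod_eq_one fun j _ => h1 _ (hx j), ?_⟩
  refine exists_fcoef_decay hcs fun j => ?_
  obtain ⟨C, hC, h, hh, hb⟩ := hu.bound_iterate_pd (isCompact_cube (3 / 8))
  refine ⟨A ^ N * (A * C), by positivity, B + h, by positivity, fun l x => ?_⟩
  by_cases hx : ∀ j, |x j| ≤ 3 / 8
  swap
  · have : (pd j)^[l] (fun x : Fin N → ℝ => ((∏ i, χ (x i) : ℝ) : ℂ) * u x) x = 0 := by
      by_contra hne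
      exact hx ((hcs.iterate_pd j l).2 (subset_tsupport _ hne))
    rw [this, norm_zero]
    positivity
  have hA1 : 1 ≤ A := by
    have := hχ 0 0
    rw [iteratedDeriv_zero, h1 0 (by norm_num)] at this
    simpa using this
  have e := congrFun (iteratedDeriv_line hcs.1 j l x) 0
  simp only [zero_smul, add_zero] at e
  rw [← e]
  have efun : (fun s : ℝ => ((∏ i, χ ((x + s • (Pi.single j 1 : Fin N → ℝ)) i) : ℝ) : ℂ)
        * u (x + s • Pi.single j 1))
      = fun s => ((∏ i ∈ Finset.univ.erase j, χ (x i) : ℝ) : ℂ) *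
        (((χ (s + x j) : ℝ) : ℂ) * u (x + s • Pi.single j 1)) := by
    funext s
    rw [← Finset.mul_prod_erase Finset.univ _ (Finset.mem_univ j)]
    have : ∏ i ∈ Finset.univ.erase j, χ ((x + s • (Pi.single j 1 : Fin N → ℝ)) i)
        = ∏ i ∈ Finset.univ.erase j, χ (x i) := by
      refine Finset.prod_congr rfl fun i hi => ?_
      simp [(Finset.mem_erase.mp hi).1]
    rw [this]
    simp only [Pi.add_apply, Pi.smul_apply, Pi.single_eq_same, smul_eq_mul, mul_one, add_comm (x j)]
    push_cast
    ring
  rw [efun, iteratedDeriv_const_mul_field, norm_mul]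
  have hχx : ContDiff ℝ ∞ fun s => χ (s + x j) := hχs.comp (contDiff_id.add contDiff_const)
  have b1 : ∀ l : ℕ, ‖iteratedDeriv l (fun s => ((χ (s + x j) : ℝ) : ℂ)) 0‖
      ≤ A * B ^ l * (l.factorial : ℝ) ^ 2 := by
    intro l
    rw [iteratedDeriv_ofReal_comp hχx, Complex.norm_real, iteratedDeriv_comp_add_const]
    exact hχ _ _
  have b2 : ∀ l : ℕ, ‖iteratedDeriv l (fun s : ℝ => u (x + s • Pi.single j 1)) 0‖
      ≤ C * h ^ l * (l.factorial : ℝ) ^ 2 := by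
    intro l
    rw [iteratedDeriv_line hu.1]
    simpa using hb j x hx l
  have b3 := norm_iteratedDeriv_mul_le_gevrey (Complex.ofRealCLM.contDiff.comp hχx)
    (contDiff_line hu.1 j x) 0 hA hB b1 b2 l
  have b4 : ‖((∏ i ∈ Finset.univ.erase j, χ (x i) : ℝ) : ℂ)‖ ≤ A ^ N := by
    rw [Complex.norm_real, norm_prod]
    calc ∏ i ∈ Finset.univ.erase j, ‖χ (x i)‖ ≤ ∏ i ∈ Finset.univ.erase j, A := by
          refine Finset.prod_le_prod (fun _ _ => norm_nonneg _) fun i _ => ?_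
          have := hχ 0 (x i)
          simpa using this
      _ = A ^ (N - 1) := by simp
      _ ≤ A ^ N := pow_le_pow_right₀ hA1 (Nat.sub_le _ _)
  calc _ ≤ A ^ N * (A * C * (B + h) ^ l * (l.factorial : ℝ) ^ 2) := by
        gcongr
        exact b3
    _ = _ := by ring

lemma gevreyOn_coord_zero : GevreyOn 2 fun x : Fin 1 → ℝ => (x 0 : ℂ) := by
  have hs : ContDiff ℝ ∞ fun x : Fin 1 → ℝ => (x 0 : ℂ) :=
    Complex.ofRealCLM.contDiff.comp (contDiff_apply ℝ ℝ 0)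
  have h1 : pd 0 (fun x : Fin 1 → ℝ => (x 0 : ℂ)) = fun _ => 1 := by
    funext x
    have : HasFDerivAt (fun x : Fin 1 → ℝ => (x 0 : ℂ)) _ x :=
      Complex.ofRealCLM.hasFDerivAt.comp x (hasFDerivAt_apply (𝕜 := ℝ) 0 x)
    rw [pd, this.fderiv]
    simp
  have h2 : ∀ l, (pd 0)^[l] (fun _ : Fin 1 → ℝ => (0 : ℂ)) = fun _ => 0 := by
    intro l
    induction l with
    | zero => rfl
    | succ l ih => rw [Function.iterate_succ_apply', ih]; funext x; simp [pd]
  refine ⟨hs, fun K hK => ?_⟩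
  obtain ⟨C, hC⟩ := hK.exists_bound_of_continuousOn hs.continuous.continuousOn
  refine ⟨|C| + 1, by positivity, 1, one_pos, fun x hx α => ?_⟩
  have e : pdMulti α (fun x : Fin 1 → ℝ => (x 0 : ℂ)) = (pd 0)^[α 0] fun x => (x 0 : ℂ) := by
    simp [pdMulti, List.finRange_succ]
  have hb : ‖pdMulti α (fun x : Fin 1 → ℝ => (x 0 : ℂ)) x‖ ≤ |C| + 1 := by
    rw [e]
    rcases α 0 with _ | _ | l
    · exact (hC x hx).trans ((le_abs_self C).trans (by simp))
    · simp [h1]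
    · rw [Function.iterate_succ_apply, Function.iterate_succ_apply, h1]
      have : pd 0 (fun _ : Fin 1 → ℝ => (1 : ℂ)) = fun _ => 0 := by funext x; simp [pd]
      rw [this, h2]
      simp; positivity
  refine hb.trans ?_
  rw [one_pow, mul_one]
  have : (1 : ℝ) ≤ ((∑ j, α j).factorial : ℝ) := by exact_mod_cast Nat.factorial_pos _
  have := Real.one_le_rpow this (by norm_num : (0 : ℝ) ≤ 2)
  nlinarith [abs_nonneg C]

/-- There is a rapidly decaying Hermitian kernel on `ℤ` whose Fourier series is `x` near `0`. -/
lemma exists_kernel : ∃ K : ℤ → ℂ, (∀ j, K (-j) = (starRingEnd ℂ) (K j)) ∧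
    (∃ C ≥ 0, ∃ c > 0, ∀ j, ‖K j‖ ≤ C * Real.exp (-c * Real.sqrt |(j : ℝ)|)) ∧
    (Summable K → ∀ x : ℝ, |x| ≤ 1 / 8 →
      HasSum (fun j => K j * cexp (2 * Real.pi * I * j * x)) x) := by
  obtain ⟨w, hw, hw1, C, hC, c, hc, hd⟩ := exists_gevrey_localization gevreyOn_coord_zero
  let e : ℤ ≃ (Fin 1 → ℤ) := (Equiv.funUnique (Fin 1) ℤ).symm
  refine ⟨fun j => fcoef (fun x => w x * (x 0 : ℂ)) (e j), fun j => ?_, ⟨C, hC, c, hc, fun j => ?_⟩,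
    fun hs x hx => ?_⟩
  · simp only [fcoef]
    rw [← integral_conj]
    refine MeasureTheory.integral_congr_ae (.of_forall fun x => ?_)
    simp only [wave, map_mul, Complex.conj_ofReal, ← Complex.exp_conj, e]
    simp [Equiv.funUnique, Complex.conj_ofNat]
  · have := hd (e j)
    simpa [sqrtSum, e, Equiv.funUnique] using this
  · have := hasSum_fcoef hw (e.summable_iff.mp hs) (x := fun _ => x)
      (fun j => lt_of_le_of_lt hx (by norm_num))
    rw [hw1 _ fun _ => hx, ← e.hasSum_iff] at this
    simpa [wave, e, Equiv.funUnique, Function.comp_def, mul_assoc] using this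

end CauchyData

section EnergyEstimate

open scoped InnerProductSpace

/-- Two symmetric operators `D`, `Z`, commuting with the complex structure `J`, whose commutator
`[D, Z]` and double commutator `[D, [D, Z]]` are bounded by `κ L ^ 2`. -/
structure SymmPair {H : Type} [NormedAddCommGroup H] [InnerProductSpace ℝ H]
    (D Z J : H →L[ℝ] H) (κ L : ℝ) : Prop where
  symm_D : ∀ x y, ⟪D x, y⟫_ℝ = ⟪x, D y⟫_ℝ
  symm_Z : ∀ x y, ⟪Z x, y⟫_ℝ = ⟪x, Z y⟫_ℝ
  skew_J : ∀ x y, ⟪J x, y⟫_ℝ = -⟪x, J y⟫_ℝ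
  norm_J : ∀ x, ‖J x‖ = ‖x‖
  J_D : ∀ x, J (D x) = D (J x)
  J_Z : ∀ x, J (Z x) = Z (J x)
  comm : ∀ x, ‖D (Z x) - Z (D x)‖ ≤ κ * L ^ 2 * ‖x‖
  comm_comm : ∀ x, ‖D (D (Z x) - Z (D x)) - (D (Z (D x)) - Z (D (D x)))‖ ≤ κ * L ^ 2 * ‖x‖

namespace SymmPair

variable {H : Type} [NormedAddCommGroup H] [InnerProductSpace ℝ H] {D Z J : H →L[ℝ] H} {κ L : ℝ}

lemma inner_J_cube (h : SymmPair D Z J κ L) (x : H) : ⟪J (Z (Z (Z x))), x⟫_ℝ = 0 := by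
  have h1 : ⟪J (Z (Z (Z x))), x⟫_ℝ = -⟪J (Z (Z (Z x))), x⟫_ℝ := by
    conv_lhs => rw [h.skew_J, h.symm_Z, h.symm_Z, h.symm_Z, ← h.J_Z, ← h.J_Z, ← h.J_Z,
      real_inner_comm]
  linarith

lemma inner_J_Z (h : SymmPair D Z J κ L) (x : H) : ⟪J x, Z x⟫_ℝ = 0 := by
  have h1 : ⟪J x, Z x⟫_ℝ = -⟪J x, Z x⟫_ℝ := by
    conv_lhs => rw [h.skew_J, h.J_Z, ← h.symm_Z, real_inner_comm]
  linarith

lemma norm_sq_D (h : SymmPair D Z J κ L) (x : H) : ‖D x‖ ^ 2 ≤ ‖D (D x)‖ * ‖x‖ := by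
  rw [← real_inner_self_eq_norm_sq, ← h.symm_D]
  exact real_inner_le_norm _ _

lemma norm_sq_Z (h : SymmPair D Z J κ L) (x : H) : ‖Z x‖ ^ 2 ≤ ‖Z (Z x)‖ * ‖x‖ := by
  rw [← real_inner_self_eq_norm_sq, ← h.symm_Z]
  exact real_inner_le_norm _ _

/-- The principal part of the energy density. -/
noncomputable def weight (D Z : H →L[ℝ] H) (L : ℝ) (a b c : H) : ℝ :=
  ‖c‖ ^ 2 + ‖D b‖ ^ 2 + ‖Z b‖ ^ 2 + ‖D (D a)‖ ^ 2 + ‖Z (Z a)‖ ^ 2 + ‖Z (D a)‖ ^ 2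
    + L ^ 2 * ‖b‖ ^ 2 + L ^ 4 * ‖a‖ ^ 2

/-- The energy functional. -/
noncomputable def energy (D Z J : H →L[ℝ] H) (L β M : ℝ) (a b c : H) : ℝ :=
  3 * ‖c‖ ^ 2 + 2 * ⟪c, D (D a) + Z (Z a)⟫_ℝ + ‖D (D a) + Z (Z a)‖ ^ 2
    + 2 * (‖D b‖ ^ 2 + ‖Z b‖ ^ 2) + 6 * β * ⟪J (Z (Z (Z a))), b⟫_ℝ
    + M * (L ^ 4 * ‖a‖ ^ 2 + L ^ 2 * ‖b‖ ^ 2)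

lemma inner_cube_le (h : SymmPair D Z J κ L) (hκ : 0 ≤ κ) (hL : 1 ≤ L) (a b c : H) :
    |⟪J (Z (Z (Z a))), D (D a)⟫_ℝ| ≤ (4 * κ + κ ^ 2) * L * weight D Z L a b c := by
  set C : H → H := fun x => D (Z x) - Z (D x) with hC
  set p := ‖D (D a)‖ with hp
  set q := ‖Z (Z a)‖ with hq
  set r := ‖Z (D a)‖ with hr
  have hCJ : ∀ x, J (C x) = C (J x) := fun x => by
    simp only [hC, map_sub, h.J_D, h.J_Z]
  have hDZ : ∀ x, D (Z x) = Z (D x) + C x := fun x => by simp [hC]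
  have e1 : D (J (Z (Z (Z a)))) = J (Z (Z (Z (D a)))) + J (Z (Z (C a))) + J (Z (C (Z a)))
      + J (C (Z (Z a))) := by
    rw [← h.J_D, hDZ, hDZ, hDZ]
    simp only [map_add]
  have t3 : ⟪J (Z (Z (C a))), D a⟫_ℝ
      = ⟪J (D (C a)), Z (Z a)⟫_ℝ - ⟪J (C a), C (Z a)⟫_ℝ := by
    have e : Z (Z (D a)) = D (Z (Z a)) - C (Z a) - Z (C a) := by
      rw [hDZ, hDZ, map_add]; abel
    rw [h.J_Z, h.symm_Z, h.J_Z, h.symm_Z, e, inner_sub_right, inner_sub_right, h.inner_J_Z,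
      ← h.symm_D, ← h.J_D, sub_zero]
  have T : ⟪J (Z (Z (Z a))), D (D a)⟫_ℝ = ⟪J (C (Z (Z a))), D a⟫_ℝ + ⟪J (C (Z a)), Z (D a)⟫_ℝ
      + (⟪J (D (C a)), Z (Z a)⟫_ℝ - ⟪J (C a), C (Z a)⟫_ℝ) := by
    rw [← h.symm_D, e1, inner_add_left, inner_add_left, inner_add_left, h.inner_J_cube, t3,
      h.J_Z (C (Z a)), h.symm_Z]
    ring
  have bJ : ∀ x y, |⟪J x, y⟫_ℝ| ≤ ‖x‖ * ‖y‖ := fun x y => by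
    rw [← h.norm_J x]; exact abs_real_inner_le_norm _ _
  have bC : ∀ x, ‖C x‖ ≤ κ * L ^ 2 * ‖x‖ := h.comm
  have bDC : ‖D (C a)‖ ≤ κ * L ^ 2 * ‖D a‖ + κ * L ^ 2 * ‖a‖ := by
    have e : D (C a) = C (D a) + (D (C a) - C (D a)) := by abel
    rw [e]
    exact (norm_add_le _ _).trans (add_le_add (bC _) (h.comm_comm a))
  have hN : ∀ x : ℝ, x ∈ ({q, r, L * ‖D a‖, L * ‖Z a‖, L ^ 2 * ‖a‖} : Set ℝ) →
      x ^ 2 ≤ weight D Z L a b c := by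
    have s : 0 ≤ ‖c‖ ^ 2 + ‖D b‖ ^ 2 + ‖Z b‖ ^ 2 + L ^ 2 * ‖b‖ ^ 2 := by positivity
    have n := norm_nonneg a
    have hD := h.norm_sq_D a
    have hZ := h.norm_sq_Z a
    have hp0 : 0 ≤ p := norm_nonneg _
    have hq0 : 0 ≤ q := norm_nonneg _
    rintro x (rfl | rfl | rfl | rfl | rfl) <;> unfold weight
    · nlinarith [sq_nonneg p, sq_nonneg r, sq_nonneg (L ^ 2 * ‖a‖)]
    · nlinarith [sq_nonneg p, sq_nonneg q, sq_nonneg (L ^ 2 * ‖a‖)]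
    · have : L ^ 2 * ‖D a‖ ^ 2 ≤ L ^ 2 * (p * ‖a‖) := by gcongr
      nlinarith [sq_nonneg (p - L ^ 2 * ‖a‖), sq_nonneg p, sq_nonneg q, sq_nonneg r,
        sq_nonneg (L ^ 2 * ‖a‖)]
    · have : L ^ 2 * ‖Z a‖ ^ 2 ≤ L ^ 2 * (q * ‖a‖) := by gcongr
      nlinarith [sq_nonneg (q - L ^ 2 * ‖a‖), sq_nonneg p, sq_nonneg q, sq_nonneg r,
        sq_nonneg (L ^ 2 * ‖a‖)]
    · nlinarith [sq_nonneg p, sq_nonneg q, sq_nonneg r, sq_nonneg (L ^ 2 * ‖a‖)]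
  set W := weight D Z L a b c with hW
  have hmul : ∀ x y : ℝ, x ^ 2 ≤ W → y ^ 2 ≤ W → x * y ≤ W := fun x y hx hy => by
    nlinarith [sq_nonneg (x - y)]
  have m1 : q * (L * ‖D a‖) ≤ W := hmul _ _ (hN _ (by simp)) (hN _ (by simp))
  have m2 : (L * ‖Z a‖) * r ≤ W := hmul _ _ (hN _ (by simp)) (hN _ (by simp))
  have m3 : (L ^ 2 * ‖a‖) * q ≤ W := hmul _ _ (hN _ (by simp)) (hN _ (by simp))
  have m4 : (L ^ 2 * ‖a‖) * (L * ‖Z a‖) ≤ W := hmul _ _ (hN _ (by simp)) (hN _ (by simp))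
  have W0 : 0 ≤ W := (sq_nonneg _).trans (hN q (by simp))
  have k1 : |⟪J (C (Z (Z a))), D a⟫_ℝ| ≤ κ * L * W := by
    calc _ ≤ ‖C (Z (Z a))‖ * ‖D a‖ := bJ _ _
      _ ≤ κ * L ^ 2 * q * ‖D a‖ := by gcongr; exact bC _
      _ = κ * L * (q * (L * ‖D a‖)) := by ring
      _ ≤ _ := by gcongr
  have k2 : |⟪J (C (Z a)), Z (D a)⟫_ℝ| ≤ κ * L * W := by
    calc _ ≤ ‖C (Z a)‖ * r := bJ _ _
      _ ≤ κ * L ^ 2 * ‖Z a‖ * r := by gcongr; exact bC _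
      _ = κ * L * (L * ‖Z a‖ * r) := by ring
      _ ≤ _ := by gcongr
  have k3 : |⟪J (D (C a)), Z (Z a)⟫_ℝ| ≤ 2 * κ * L * W := by
    calc _ ≤ ‖D (C a)‖ * q := bJ _ _
      _ ≤ (κ * L ^ 2 * ‖D a‖ + κ * L ^ 2 * ‖a‖) * q := by gcongr
      _ = κ * L * (q * (L * ‖D a‖)) + κ * 1 * (L ^ 2 * ‖a‖ * q) := by ring
      _ ≤ κ * L * W + κ * L * W := by gcongr
      _ = _ := by ring
  have k4 : |⟪J (C a), C (Z a)⟫_ℝ| ≤ κ ^ 2 * L * W := by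
    calc _ ≤ ‖C a‖ * ‖C (Z a)‖ := bJ _ _
      _ ≤ (κ * L ^ 2 * ‖a‖) * (κ * L ^ 2 * ‖Z a‖) := by gcongr <;> exact bC _
      _ = κ ^ 2 * L * ((L ^ 2 * ‖a‖) * (L * ‖Z a‖)) := by ring
      _ ≤ _ := by gcongr
  rw [T]
  rw [abs_le] at *
  constructor <;> linarith [k1.1, k1.2, k2.1, k2.2, k3.1, k3.2, k4.1, k4.2]

lemma energy_le_weight (h : SymmPair D Z J κ L) {β M : ℝ} (hM : 0 ≤ M) (a b c : H) :
    energy D Z J L β M a b c ≤ (10 + 6 * |β| + M) * weight D Z L a b c := by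
  have h1 : ⟪c, D (D a) + Z (Z a)⟫_ℝ ≤ ‖c‖ * ‖D (D a) + Z (Z a)‖ := real_inner_le_norm _ _
  have h2 : ‖D (D a) + Z (Z a)‖ ≤ ‖D (D a)‖ + ‖Z (Z a)‖ := norm_add_le _ _
  have h3 : β * ⟪J (Z (Z (Z a))), b⟫_ℝ ≤ |β| * (‖Z (Z a)‖ * ‖Z b‖) := by
    refine (le_abs_self _).trans ?_
    rw [abs_mul, h.J_Z, h.symm_Z, ← h.norm_J (Z (Z a))]
    gcongr
    exact abs_real_inner_le_norm _ _
  unfold energy weight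
  have hb := abs_nonneg β
  have n0 := norm_nonneg (D (D a) + Z (Z a))
  have h4 : ‖D (D a) + Z (Z a)‖ ^ 2 ≤ 2 * ‖D (D a)‖ ^ 2 + 2 * ‖Z (Z a)‖ ^ 2 := by
    nlinarith [sq_nonneg (‖D (D a)‖ - ‖Z (Z a)‖), norm_nonneg (D (D a)), norm_nonneg (Z (Z a))]
  have h5 : ‖Z (Z a)‖ * ‖Z b‖ ≤ (‖Z (Z a)‖ ^ 2 + ‖Z b‖ ^ 2) := by
    nlinarith [sq_nonneg (‖Z (Z a)‖ - ‖Z b‖), sq_nonneg ‖Z (Z a)‖, sq_nonneg ‖Z b‖]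
  have h6 : |β| * (‖Z (Z a)‖ * ‖Z b‖) ≤ |β| * (‖Z (Z a)‖ ^ 2 + ‖Z b‖ ^ 2) := by gcongr
  have h7 : 2 * (‖c‖ * ‖D (D a) + Z (Z a)‖) ≤ ‖c‖ ^ 2 + ‖D (D a) + Z (Z a)‖ ^ 2 := by
    nlinarith [sq_nonneg (‖c‖ - ‖D (D a) + Z (Z a)‖)]
  set s := ‖c‖ ^ 2 + ‖D b‖ ^ 2 + ‖Z (D a)‖ ^ 2 + ‖D (D a)‖ ^ 2 with hs
  have s0 : 0 ≤ s := by positivity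
  have x1 : 0 ≤ |β| * s := by positivity
  have x2 : 0 ≤ M * (s + (‖Z (Z a)‖ ^ 2 + ‖Z b‖ ^ 2)) := by positivity
  have x3 : 0 ≤ |β| * (L ^ 2 * ‖b‖ ^ 2 + L ^ 4 * ‖a‖ ^ 2) := by positivity
  have x4 : 0 ≤ L ^ 2 * ‖b‖ ^ 2 := by positivity
  have x5 : 0 ≤ L ^ 4 * ‖a‖ ^ 2 := by positivity
  have x6 := sq_nonneg ‖c‖
  have x7 := sq_nonneg ‖D b‖
  have x8 := sq_nonneg ‖Z (D a)‖
  have x9 := sq_nonneg ‖D (D a)‖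
  have x10 := sq_nonneg ‖Z (Z a)‖
  have x11 := sq_nonneg ‖Z b‖
  simp only [hs] at x1 x2
  nlinarith

lemma weight_le_energy (h : SymmPair D Z J κ L) (hκ : 0 ≤ κ) {β θ : ℝ}
    (hθ : |β| = θ * (2 / (3 * √3))) (h0 : 0 ≤ θ) (h1 : θ < 1) (a b c : H) :
    weight D Z L a b c
      ≤ (8 / (1 - θ)) * energy D Z J L β (1 + κ ^ 2 + κ ^ 2 / (1 - θ)) a b c := by
  set p := ‖D (D a)‖ with hp
  set q := ‖Z (Z a)‖ with hq
  set r := ‖Z (D a)‖ with hr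
  set α := L ^ 2 * ‖a‖ with hα
  set A := D (D a) + Z (Z a) with hA
  have hp0 : 0 ≤ p := norm_nonneg _
  have hq0 : 0 ≤ q := norm_nonneg _
  have hr0 : 0 ≤ r := norm_nonneg _
  have hα0 : 0 ≤ α := by positivity
  have hδ : 0 < 1 - θ := by linarith
  have hcr : r ^ 2 - κ * r * α - κ * ((p + q) * α / 2) ≤ ⟪D (D a), Z (Z a)⟫_ℝ := by
    have e1 : ⟪D (D a), Z (Z a)⟫_ℝ = r ^ 2 + ⟪Z (D a), D (Z a) - Z (D a)⟫_ℝ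
        + ⟪D a, D (Z (Z a)) - Z (D (Z a))⟫_ℝ := by
      rw [h.symm_D, inner_sub_right, inner_sub_right, hr, ← real_inner_self_eq_norm_sq,
        h.symm_Z (D a) (D (Z a))]
      ring
    have e2 : -(r * (κ * L ^ 2 * ‖a‖)) ≤ ⟪Z (D a), D (Z a) - Z (D a)⟫_ℝ := by
      refine le_trans ?_ (abs_le.mp (abs_real_inner_le_norm _ _)).1
      rw [neg_le_neg_iff]
      gcongr
      exact h.comm a
    have e3 : -(‖D a‖ * (κ * L ^ 2 * ‖Z a‖)) ≤ ⟪D a, D (Z (Z a)) - Z (D (Z a))⟫_ℝ := by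
      refine le_trans ?_ (abs_le.mp (abs_real_inner_le_norm _ _)).1
      rw [neg_le_neg_iff]
      gcongr
      exact h.comm (Z a)
    have e4 : ‖D a‖ * ‖Z a‖ ≤ (p + q) * ‖a‖ / 2 := by
      nlinarith [h.norm_sq_D a, h.norm_sq_Z a, sq_nonneg (‖D a‖ - ‖Z a‖)]
    have e5 : κ * L ^ 2 * (‖D a‖ * ‖Z a‖) ≤ κ * L ^ 2 * ((p + q) * ‖a‖ / 2) := by gcongr
    rw [e1]
    simp only [hα]
    linarith
  have hA2 : ‖A‖ ^ 2 = p ^ 2 + q ^ 2 + 2 * ⟪D (D a), Z (Z a)⟫_ℝ := by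
    rw [hA, norm_add_sq_real]; ring
  have hAl : (1 + θ) / 2 * (p ^ 2 + q ^ 2) + r ^ 2 - (κ ^ 2 + κ ^ 2 / (1 - θ)) * α ^ 2
      ≤ ‖A‖ ^ 2 := by
    have f1 : ∀ s : ℝ, κ * s * α ≤ (1 - θ) / 2 * s ^ 2 + κ ^ 2 / (1 - θ) / 2 * α ^ 2 := by
      intro s
      have : (1 - θ) / 2 * s ^ 2 + κ ^ 2 / (1 - θ) / 2 * α ^ 2 - κ * s * α
          = ((1 - θ) * s - κ * α) ^ 2 / (2 * (1 - θ)) := by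
        field_simp; ring
      have : 0 ≤ ((1 - θ) * s - κ * α) ^ 2 / (2 * (1 - θ)) := by positivity
      linarith
    have f2 := f1 p
    have f3 := f1 q
    have f4 : 2 * (κ * r * α) ≤ r ^ 2 + κ ^ 2 * α ^ 2 := by nlinarith [sq_nonneg (r - κ * α)]
    rw [hA2]
    linarith
  have hβ : -(θ * (2 * ‖Z b‖ ^ 2 + 2 / 3 * q ^ 2)) ≤ 6 * β * ⟪J (Z (Z (Z a))), b⟫_ℝ := by
    have g1 : |β * ⟪J (Z (Z (Z a))), b⟫_ℝ| ≤ |β| * (q * ‖Z b‖) := by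
      rw [abs_mul, h.J_Z, h.symm_Z, hq, ← h.norm_J (Z (Z a))]
      gcongr
      exact abs_real_inner_le_norm _ _
    have g2 := (abs_le.mp g1).1
    have s3 : √3 ^ 2 = 3 := Real.sq_sqrt (by norm_num)
    have s3' : 0 < √3 := by positivity
    have g3 : 6 * (|β| * (q * ‖Z b‖)) ≤ θ * (2 * ‖Z b‖ ^ 2 + 2 / 3 * q ^ 2) := by
      have : 2 / (3 * √3) * 6 = 4 * √3 / 3 := by
        field_simp; nlinarith
      have : 6 * (|β| * (q * ‖Z b‖)) = θ * (4 * √3 / 3 * (q * ‖Z b‖)) := by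
        rw [hθ, ← this]; ring
      rw [this]
      gcongr
      nlinarith [sq_nonneg (√3 * ‖Z b‖ - q)]
    linarith
  have hE : 3 * ‖c + (1 / 3 : ℝ) • A‖ ^ 2 = 3 * ‖c‖ ^ 2 + 2 * ⟪c, A⟫_ℝ + 1 / 3 * ‖A‖ ^ 2 := by
    rw [norm_add_sq_real, inner_smul_right, norm_smul]
    norm_num
    ring
  have hc : ‖c‖ ^ 2 ≤ 2 * ‖c + (1 / 3 : ℝ) • A‖ ^ 2 + 2 / 9 * ‖A‖ ^ 2 := by
    have : ‖c + (2 / 3 : ℝ) • A‖ ^ 2 = ‖c‖ ^ 2 + 4 / 3 * ⟪c, A⟫_ℝ + 4 / 9 * ‖A‖ ^ 2 := by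
      rw [norm_add_sq_real, inner_smul_right, norm_smul]
      norm_num
      ring
    linarith only [sq_nonneg ‖c + (2 / 3 : ℝ) • A‖, hE, this]
  have hA3 : ‖A‖ ^ 2 ≤ 2 * p ^ 2 + 2 * q ^ 2 := by
    have h2 := pow_le_pow_left₀ (norm_nonneg A) (norm_add_le (D (D a)) (Z (Z a))) 2
    linarith only [h2, sq_nonneg (p - q), hp, hq, show (p + q) ^ 2 = p ^ 2 + 2 * p * q + q ^ 2 by ring]
  have hE2 : energy D Z J L β (1 + κ ^ 2 + κ ^ 2 / (1 - θ)) a b c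
      = 3 * ‖c + (1 / 3 : ℝ) • A‖ ^ 2 + 2 / 3 * ‖A‖ ^ 2 + 2 * (‖D b‖ ^ 2 + ‖Z b‖ ^ 2)
        + 6 * β * ⟪J (Z (Z (Z a))), b⟫_ℝ
        + (1 + κ ^ 2 + κ ^ 2 / (1 - θ)) * (α ^ 2 + L ^ 2 * ‖b‖ ^ 2) := by
    rw [hE, energy]; ring
  have hW : weight D Z L a b c = ‖c‖ ^ 2 + ‖D b‖ ^ 2 + ‖Z b‖ ^ 2 + p ^ 2 + q ^ 2 + r ^ 2
      + L ^ 2 * ‖b‖ ^ 2 + α ^ 2 := by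
    rw [weight]; ring
  have hb0 : 0 ≤ L ^ 2 * ‖b‖ ^ 2 := by positivity
  have hk0 : 0 ≤ κ ^ 2 + κ ^ 2 / (1 - θ) := by positivity
  set k := κ ^ 2 + κ ^ 2 / (1 - θ) with hk
  have hM : 1 + κ ^ 2 + κ ^ 2 / (1 - θ) = 1 + k := by rw [hk]; ring
  rw [hM] at hE2 ⊢
  clear_value p q r α k A
  set R := ‖D b‖ ^ 2 + ‖Z b‖ ^ 2 + p ^ 2 + q ^ 2 + r ^ 2 + L ^ 2 * ‖b‖ ^ 2 + α ^ 2 with hR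
  clear_value R
  have hD0 := sq_nonneg ‖D b‖
  have hZ0 := sq_nonneg ‖Z b‖
  have low : 3 * ‖c + (1 / 3 : ℝ) • A‖ ^ 2 + (1 - θ) / 3 * R
      ≤ energy D Z J L β (1 + k) a b c := by
    rw [hE2, hR]
    have u1 : 0 ≤ k * (L ^ 2 * ‖b‖ ^ 2) := by positivity
    have u2 : 0 ≤ k * α ^ 2 := by positivity
    have u3 : 0 ≤ θ * p ^ 2 := by positivity
    have u4 : 0 ≤ θ * r ^ 2 := by positivity
    have u5 : 0 ≤ θ * ‖D b‖ ^ 2 := by positivity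
    have u6 : 0 ≤ θ * (L ^ 2 * ‖b‖ ^ 2) := by positivity
    have u7 : 0 ≤ θ * α ^ 2 := by positivity
    have u8 : 0 ≤ (1 - θ) * ‖Z b‖ ^ 2 := by positivity
    have u9 : 0 ≤ (1 - θ) * p ^ 2 := by positivity
    have u10 := sq_nonneg r
    have u11 := sq_nonneg α
    linarith only [u1, u2, u3, u4, u5, u6, u7, u8, u9, u10, u11, hAl, hβ, hD0, hZ0, hb0]
  have hR0 : 0 ≤ R := by rw [hR]; positivity
  have n0 := sq_nonneg ‖c + (1 / 3 : ℝ) • A‖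
  have up : weight D Z L a b c ≤ 2 * ‖c + (1 / 3 : ℝ) • A‖ ^ 2 + 2 * R := by
    rw [hW, hR]; linarith only [hc, hA3, hD0, hZ0, hb0, sq_nonneg p, sq_nonneg q, sq_nonneg r, sq_nonneg α]
  rw [div_mul_eq_mul_div, le_div_iff₀ hδ]
  have v1 : 0 ≤ θ * ‖c + (1 / 3 : ℝ) • A‖ ^ 2 := by positivity
  have v2 : 0 ≤ (1 - θ) * R := by positivity
  have v3 : weight D Z L a b c * (1 - θ) ≤ (2 * ‖c + (1 / 3 : ℝ) • A‖ ^ 2 + 2 * R) * (1 - θ) := by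
    gcongr
  linarith only [v1, v2, v3, low, n0]

end SymmPair

lemma le_exp_mul_of_abs_deriv_le {E E' : ℝ → ℝ} {k : ℝ} (hE : ∀ t, HasDerivAt E (E' t) t)
    (hb : ∀ t, |E' t| ≤ k * E t) (t : ℝ) : E t ≤ E 0 * Real.exp (k * |t|) := by
  have key : ∀ s : ℝ, |s| ≤ 1 → ∀ t, 0 ≤ t → E (s * t) ≤ E 0 * Real.exp (k * t) := by
    intro s hs t ht
    have hd : ∀ t, HasDerivAt (fun t => E (s * t) * Real.exp (-k * t))
        (E' (s * t) * s * Real.exp (-k * t) + E (s * t) * (Real.exp (-k * t) * -k)) t := by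
      intro t
      have h1 : HasDerivAt (fun t => s * t) s t := by simpa using (hasDerivAt_id t).const_mul s
      have h2 : HasDerivAt (fun t => -k * t) (-k) t := by
        simpa using (hasDerivAt_id t).const_mul (-k)
      exact ((hE (s * t)).comp t h1).mul h2.exp
    have anti : Antitone fun t => E (s * t) * Real.exp (-k * t) := by
      refine antitone_of_deriv_nonpos (fun t => (hd t).differentiableAt) fun t => ?_
      rw [(hd t).deriv]
      have h3 : E' (s * t) * s ≤ k * E (s * t) := by
        refine (le_abs_self _).trans ?_
        rw [abs_mul]
        exact (mul_le_of_le_one_right (abs_nonneg _) hs).trans (hb _)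
      nlinarith [Real.exp_pos (-k * t)]
    have := anti ht
    simp only [mul_zero, Real.exp_zero, mul_one] at this
    rw [neg_mul, Real.exp_neg] at this
    rwa [← div_eq_mul_inv, div_le_iff₀ (Real.exp_pos _)] at this
  rcases le_total 0 t with ht | ht
  · have := key 1 (by simp) t ht
    rw [one_mul] at this
    rwa [abs_of_nonneg ht]
  · have := key (-1) (by simp) (-t) (by linarith)
    rw [neg_mul_neg, one_mul] at this
    rwa [abs_of_nonpos ht]

/-- The energy estimate for `u''' + (D² + Z²) u' + β J Z³ u = 0`. -/
lemma exists_energy_estimate {β : ℝ} (hβ : |β| < 2 / (3 * √3)) {κ : ℝ} (hκ : 0 ≤ κ) :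
    ∃ C ≥ 0, ∀ (H : Type) [NormedAddCommGroup H] [InnerProductSpace ℝ H] (D Z J : H →L[ℝ] H)
      (L : ℝ), 1 ≤ L → SymmPair D Z J κ L → ∀ a b c : ℝ → H,
      (∀ t, HasDerivAt a (b t) t) → (∀ t, HasDerivAt b (c t) t) →
      (∀ t, HasDerivAt c (-(D (D (b t)) + Z (Z (b t))) - β • J (Z (Z (Z (a t))))) t) →
      ∀ t, ‖a t‖ ^ 2 ≤ C * Real.exp (C * L * |t|) * SymmPair.weight D Z L (a 0) (b 0) (c 0) := by
  set θ := |β| / (2 / (3 * √3)) with hθd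
  have hs : 0 < 2 / (3 * √3) := by positivity
  have hθ : |β| = θ * (2 / (3 * √3)) := by rw [hθd]; field_simp
  have h0 : 0 ≤ θ := by positivity
  have h1 : θ < 1 := by rw [hθd, div_lt_one hs]; exact hβ
  have hδ : 0 < 1 - θ := by linarith
  set M := 1 + κ ^ 2 + κ ^ 2 / (1 - θ) with hM
  have hM0 : 0 ≤ M := by positivity
  set C₁ := 2 * |β| * (4 * κ + κ ^ 2) + 4 * M with hC₁
  set C₂ := 8 / (1 - θ) with hC₂
  set C₃ := 10 + 6 * |β| + M with hC₃
  have hC₁0 : 0 ≤ C₁ := by positivity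
  have hC₂0 : 0 ≤ C₂ := by positivity
  have hC₃0 : 0 ≤ C₃ := by positivity
  refine ⟨C₂ * C₃ + C₁ * C₂, by positivity, ?_⟩
  intro H _ _ D Z J L hL h a b c ha hb hc t
  have hDa : ∀ (T : H →L[ℝ] H) {f : ℝ → H} {f' : H} {t : ℝ}, HasDerivAt f f' t →
      HasDerivAt (fun t => T (f t)) (T f') t := fun T _ _ _ hf =>
    T.hasFDerivAt.comp_hasDerivAt _ hf
  set E := fun t => SymmPair.energy D Z J L β M (a t) (b t) (c t) with hE
  set W := fun t => SymmPair.weight D Z L (a t) (b t) (c t) with hW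
  set E' := fun t => -2 * β * ⟪J (Z (Z (Z (a t)))), D (D (a t))⟫_ℝ
    + M * (L ^ 4 * (2 * ⟪a t, b t⟫_ℝ) + L ^ 2 * (2 * ⟪b t, c t⟫_ℝ)) with hE'
  have hd : ∀ t, HasDerivAt E (E' t) t := by
    intro t
    have hA := (hDa D (hDa D (ha t))).add (hDa Z (hDa Z (ha t)))
    have d1 := ((hc t).norm_sq).const_mul 3
    have d2 := ((hc t).inner ℝ hA).const_mul 2
    have d3 := hA.norm_sq
    have d4 := (((hDa D (hb t)).norm_sq).add (hDa Z (hb t)).norm_sq).const_mul 2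
    have d5 := ((hDa J (hDa Z (hDa Z (hDa Z (ha t))))).inner ℝ (hb t)).const_mul (6 * β)
    have d6 := ((((ha t).norm_sq).const_mul (L ^ 4)).add
      (((hb t).norm_sq).const_mul (L ^ 2))).const_mul M
    have d := ((((d1.add d2).add d3).add d4).add d5).add d6
    refine d.congr_deriv ?_
    have z1 := h.inner_J_cube (b t)
    have z2 : ⟪J (Z (Z (Z (a t)))), Z (Z (a t))⟫_ℝ = 0 := by
      rw [h.J_Z, h.symm_Z]; exact h.inner_J_Z _
    have z3 : ⟪D (b t), D (c t)⟫_ℝ = ⟪c t, D (D (b t))⟫_ℝ := by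
      rw [← h.symm_D, real_inner_comm]
    have z4 : ⟪Z (b t), Z (c t)⟫_ℝ = ⟪c t, Z (Z (b t))⟫_ℝ := by
      rw [← h.symm_Z, real_inner_comm]
    simp only [hE', inner_sub_right, inner_sub_left, inner_add_right, inner_add_left,
      inner_neg_right, inner_neg_left, inner_smul_left, inner_smul_right, z1, z2, z3, z4,
      Pi.add_apply, conj_trivial]
    rw [real_inner_comm (c t) (J (Z (Z (Z (a t))))), real_inner_comm (D (D (a t))) (D (D (b t))),
      real_inner_comm (Z (Z (a t))) (D (D (b t))), real_inner_comm (D (D (a t))) (Z (Z (b t))),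
      real_inner_comm (Z (Z (a t))) (Z (Z (b t)))]
    ring
  have hEW : ∀ t, W t ≤ C₂ * E t := fun t => h.weight_le_energy hκ hθ h0 h1 _ _ _
  have hdb : ∀ t, |E' t| ≤ (C₁ * C₂ * L) * E t := by
    intro t
    have hL0 : 0 ≤ L := by linarith
    have e1 := h.inner_cube_le hκ hL (a t) (b t) (c t)
    have hin : ∀ x y : ℝ, x ^ 2 ≤ W t → y ^ 2 ≤ W t → x * y ≤ W t := fun x y hx hy => by
      nlinarith [sq_nonneg (x - y)]
    have w1 : (L ^ 2 * ‖a t‖) ^ 2 ≤ W t := by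
      have : 0 ≤ ‖c t‖ ^ 2 + ‖D (b t)‖ ^ 2 + ‖Z (b t)‖ ^ 2 + ‖D (D (a t))‖ ^ 2
        + ‖Z (Z (a t))‖ ^ 2 + ‖Z (D (a t))‖ ^ 2 + L ^ 2 * ‖b t‖ ^ 2 := by positivity
      simp only [hW, SymmPair.weight]; nlinarith
    have w2 : (L * ‖b t‖) ^ 2 ≤ W t := by
      have : 0 ≤ ‖c t‖ ^ 2 + ‖D (b t)‖ ^ 2 + ‖Z (b t)‖ ^ 2 + ‖D (D (a t))‖ ^ 2
        + ‖Z (Z (a t))‖ ^ 2 + ‖Z (D (a t))‖ ^ 2 + L ^ 4 * ‖a t‖ ^ 2 := by positivity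
      simp only [hW, SymmPair.weight]; nlinarith
    have w3 : ‖c t‖ ^ 2 ≤ W t := by
      have : 0 ≤ L ^ 2 * ‖b t‖ ^ 2 + ‖D (b t)‖ ^ 2 + ‖Z (b t)‖ ^ 2 + ‖D (D (a t))‖ ^ 2
        + ‖Z (Z (a t))‖ ^ 2 + ‖Z (D (a t))‖ ^ 2 + L ^ 4 * ‖a t‖ ^ 2 := by positivity
      simp only [hW, SymmPair.weight]; nlinarith
    have e2 : |L ^ 4 * ⟪a t, b t⟫_ℝ| ≤ L * W t := by
      rw [abs_mul, abs_of_nonneg (by positivity : 0 ≤ L ^ 4)]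
      calc L ^ 4 * |⟪a t, b t⟫_ℝ| ≤ L ^ 4 * (‖a t‖ * ‖b t‖) := by
            gcongr; exact abs_real_inner_le_norm _ _
        _ = L * (L ^ 2 * ‖a t‖ * (L * ‖b t‖)) := by ring
        _ ≤ _ := by gcongr; exact hin _ _ w1 w2
    have e3 : |L ^ 2 * ⟪b t, c t⟫_ℝ| ≤ L * W t := by
      rw [abs_mul, abs_of_nonneg (by positivity : 0 ≤ L ^ 2)]
      calc L ^ 2 * |⟪b t, c t⟫_ℝ| ≤ L ^ 2 * (‖b t‖ * ‖c t‖) := by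
            gcongr; exact abs_real_inner_le_norm _ _
        _ = L * (L * ‖b t‖ * ‖c t‖) := by ring
        _ ≤ _ := by gcongr; exact hin _ _ w2 w3
    have e4 : |-2 * β * ⟪J (Z (Z (Z (a t)))), D (D (a t))⟫_ℝ|
        ≤ 2 * |β| * ((4 * κ + κ ^ 2) * L * W t) := by
      rw [abs_mul, abs_mul, abs_neg, abs_two]
      gcongr
    have e5 : |M * (L ^ 4 * (2 * ⟪a t, b t⟫_ℝ) + L ^ 2 * (2 * ⟪b t, c t⟫_ℝ))|
        ≤ M * (4 * L * W t) := by
      rw [abs_mul, abs_of_nonneg hM0]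
      gcongr
      rw [abs_le] at *
      constructor <;> linarith [e2.1, e2.2, e3.1, e3.2]
    calc |E' t| ≤ _ := abs_add_le _ _
      _ ≤ 2 * |β| * ((4 * κ + κ ^ 2) * L * W t) + M * (4 * L * W t) := add_le_add e4 e5
      _ = C₁ * L * W t := by rw [hC₁]; ring
      _ ≤ C₁ * L * (C₂ * E t) := by gcongr; exact hEW t
      _ = _ := by ring
  have hfin := le_exp_mul_of_abs_deriv_le hd hdb t
  have W0 : 0 ≤ W 0 := by simp only [hW, SymmPair.weight]; positivity
  have hat : ‖a t‖ ^ 2 ≤ W t := by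
    have : 0 ≤ L ^ 2 * ‖b t‖ ^ 2 + ‖D (b t)‖ ^ 2 + ‖Z (b t)‖ ^ 2 + ‖D (D (a t))‖ ^ 2
        + ‖Z (Z (a t))‖ ^ 2 + ‖Z (D (a t))‖ ^ 2 + ‖c t‖ ^ 2 := by positivity
    have : 1 * ‖a t‖ ^ 2 ≤ L ^ 4 * ‖a t‖ ^ 2 := by gcongr; exact one_le_pow₀ hL
    simp only [hW, SymmPair.weight]; linarith
  calc ‖a t‖ ^ 2 ≤ W t := hat
    _ ≤ C₂ * E t := hEW t
    _ ≤ C₂ * (E 0 * Real.exp (C₁ * C₂ * L * |t|)) := by gcongr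
    _ ≤ C₂ * ((C₃ * W 0) * Real.exp (C₁ * C₂ * L * |t|)) := by
        gcongr; exact h.energy_le_weight hM0 _ _ _
    _ = (C₂ * C₃) * Real.exp (C₁ * C₂ * L * |t|) * W 0 := by ring
    _ ≤ (C₂ * C₃ + C₁ * C₂) * Real.exp ((C₂ * C₃ + C₁ * C₂) * L * |t|) * W 0 := by
        have : 0 ≤ C₁ * C₂ := by positivity
        have : 0 ≤ C₂ * C₃ := by positivity
        gcongr <;> linarith

end EnergyEstimate

section TameSequences

/-- The weight `1 + |m|` on `ℤ`. -/
noncomputable def intWeight (m : ℤ) : ℝ := 1 + |(m : ℝ)|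

lemma one_le_intWeight (m : ℤ) : 1 ≤ intWeight m := by
  unfold intWeight; linarith [abs_nonneg (m : ℝ)]

lemma intWeight_pos (m : ℤ) : 0 < intWeight m := lt_of_lt_of_le one_pos (one_le_intWeight m)

lemma intWeight_le_mul (m j : ℤ) : intWeight m ≤ intWeight j * intWeight (m - j) := by
  unfold intWeight
  push_cast
  have h1 : |(m : ℝ)| ≤ |(j : ℝ)| + |(m : ℝ) - j| := by
    calc |(m : ℝ)| = |(j : ℝ) + (m - j)| := by ring_nf
      _ ≤ _ := abs_add_le _ _
  nlinarith [abs_nonneg (j : ℝ), abs_nonneg ((m : ℝ) - j)]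

/-- Sequences decaying faster than any power of `1 + |m|`. -/
def RapidDecay (K : ℤ → ℂ) : Prop := ∀ s : ℕ, Summable fun j => ‖K j‖ * intWeight j ^ s

/-- Convolution with `K`, cut off to `S`. -/
noncomputable def cutConv (K : ℤ → ℂ) (S : Set ℤ) (f : ℤ → ℂ) : ℤ → ℂ :=
  S.indicator fun m => ∑' j, K j * f (m - j)

lemma norm_conv_term_le {K f : ℤ → ℂ} {B : ℝ} {s : ℕ} (hf : ∀ m, ‖f m‖ * intWeight m ^ s ≤ B)
    (m j : ℤ) : ‖K j * f (m - j)‖ * intWeight m ^ s ≤ ‖K j‖ * intWeight j ^ s * B := by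
  have h1 : intWeight m ^ s ≤ intWeight j ^ s * intWeight (m - j) ^ s := by
    rw [← mul_pow]
    exact pow_le_pow_left₀ (intWeight_pos m).le (intWeight_le_mul m j) s
  have h2 : 0 ≤ intWeight j ^ s := pow_nonneg (intWeight_pos j).le s
  calc ‖K j * f (m - j)‖ * intWeight m ^ s
      ≤ ‖K j‖ * ‖f (m - j)‖ * (intWeight j ^ s * intWeight (m - j) ^ s) := by
        rw [norm_mul]; gcongr
    _ = ‖K j‖ * intWeight j ^ s * (‖f (m - j)‖ * intWeight (m - j) ^ s) := by ring
    _ ≤ _ := by gcongr; exact hf _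

lemma norm_cutConv_le {K f : ℤ → ℂ} (hK : RapidDecay K) (S : Set ℤ) {B : ℝ} {s : ℕ}
    (hf : ∀ m, ‖f m‖ * intWeight m ^ s ≤ B) (m : ℤ) :
    ‖cutConv K S f m‖ * intWeight m ^ s ≤ (∑' j, ‖K j‖ * intWeight j ^ s) * B := by
  have hB : 0 ≤ B := (mul_nonneg (norm_nonneg _) (pow_nonneg (intWeight_pos 0).le s)).trans (hf 0)
  have hw : 0 < intWeight m ^ s := pow_pos (intWeight_pos m) s
  have h0 : ‖∑' j, K j * f (m - j)‖ ≤ ((∑' j, ‖K j‖ * intWeight j ^ s) * B) / intWeight m ^ s := by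
    refine tsum_of_norm_bounded (((hK s).hasSum.mul_right B).div_const _) fun j => ?_
    rw [le_div_iff₀ hw]
    exact norm_conv_term_le hf m j
  rw [← le_div_iff₀ hw]
  exact (norm_indicator_le_norm_self _ _).trans h0

variable {Q : Type*} {L R : Q → ℝ}

/-- Families of sequences whose `(1 + |m|) ^ s`-weighted sup norm is bounded by a polynomial in
`L` times `R`. -/
def Tame (L R : Q → ℝ) (s : ℕ) (F : Q → ℤ → ℂ) : Prop :=
  ∃ G ≥ 0, ∃ P : ℕ, ∀ q m, ‖F q m‖ * intWeight m ^ s ≤ G * L q ^ P * R q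

namespace Tame

variable {s : ℕ} {F G : Q → ℤ → ℂ}

lemma mono {s' : ℕ} (h : Tame L R s F) (hs : s' ≤ s) : Tame L R s' F := by
  obtain ⟨A, hA, P, h⟩ := h
  refine ⟨A, hA, P, fun q m => le_trans ?_ (h q m)⟩
  gcongr
  exact one_le_intWeight m

lemma add (hL : ∀ q, 1 ≤ L q) (hR : ∀ q, 0 ≤ R q) (hF : Tame L R s F) (hG : Tame L R s G) :
    Tame L R s (fun q m => F q m + G q m) := by
  obtain ⟨A, hA, P, hF⟩ := hF
  obtain ⟨B, hB, P', hG⟩ := hG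
  refine ⟨A + B, by positivity, P + P', fun q m => ?_⟩
  have h1 : A * L q ^ P * R q ≤ A * L q ^ (P + P') * R q := by
    have := hR q; have := hL q; gcongr; omega
  have h2 : B * L q ^ P' * R q ≤ B * L q ^ (P + P') * R q := by
    have := hR q; have := hL q; gcongr; omega
  have h3 : 0 ≤ intWeight m ^ s := pow_nonneg (intWeight_pos m).le s
  calc ‖F q m + G q m‖ * intWeight m ^ s ≤ (‖F q m‖ + ‖G q m‖) * intWeight m ^ s := by
        gcongr; exact norm_add_le _ _
    _ = ‖F q m‖ * intWeight m ^ s + ‖G q m‖ * intWeight m ^ s := by ring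
    _ ≤ (A + B) * L q ^ (P + P') * R q := by linarith [hF q m, hG q m]

lemma const_mul (hL : ∀ q, 1 ≤ L q) (hF : Tame L R s F) {a : Q → ℂ} {A : ℝ} {k : ℕ}
    (ha : ∀ q, ‖a q‖ ≤ A * L q ^ k) : Tame L R s (fun q m => a q * F q m) := by
  obtain ⟨B, hB, P, hF⟩ := hF
  refine ⟨|A| * B, by positivity, k + P, fun q m => ?_⟩
  have h0 : 0 ≤ L q := by linarith [hL q]
  have h1 : ‖a q‖ ≤ |A| * L q ^ k := (ha q).trans (by gcongr; exact le_abs_self A)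
  have h3 : 0 ≤ intWeight m ^ s := pow_nonneg (intWeight_pos m).le s
  calc ‖a q * F q m‖ * intWeight m ^ s = ‖a q‖ * (‖F q m‖ * intWeight m ^ s) := by
        rw [norm_mul]; ring
    _ ≤ (|A| * L q ^ k) * (B * L q ^ P * R q) := by
        refine mul_le_mul h1 (hF q m) (by positivity) (by positivity)
    _ = _ := by ring

lemma neg (hF : Tame L R s F) : Tame L R s (fun q m => -F q m) := by
  simpa only [Tame, norm_neg] using hF

lemma intMul (hF : Tame L R (s + 1) F) : Tame L R s (fun q m => 2 * Real.pi * m * F q m) := by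
  obtain ⟨B, hB, P, hF⟩ := hF
  refine ⟨2 * Real.pi * B, by positivity, P, fun q m => ?_⟩
  have h1 : ‖(2 * Real.pi * m : ℂ)‖ ≤ 2 * Real.pi * intWeight m := by
    simp only [norm_mul, Complex.norm_ofNat, Complex.norm_real, Real.norm_eq_abs,
      abs_of_pos Real.pi_pos, Complex.norm_intCast]
    gcongr
    unfold intWeight; linarith
  have h3 : 0 ≤ intWeight m ^ s := pow_nonneg (intWeight_pos m).le s
  calc ‖2 * Real.pi * m * F q m‖ * intWeight m ^ s
      ≤ 2 * Real.pi * intWeight m * ‖F q m‖ * intWeight m ^ s := by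
        rw [norm_mul]; gcongr
    _ = 2 * Real.pi * (‖F q m‖ * intWeight m ^ (s + 1)) := by ring
    _ ≤ 2 * Real.pi * (B * L q ^ P * R q) :=
        mul_le_mul_of_nonneg_left (hF q m) (by positivity)
    _ = _ := by ring

lemma conv {K : ℤ → ℂ} (hK : RapidDecay K) (S : Q → Set ℤ) (hF : Tame L R s F) :
    Tame L R s (fun q => cutConv K (S q) (F q)) := by
  obtain ⟨B, hB, P, hF⟩ := hF
  have h0 : 0 ≤ ∑' j, ‖K j‖ * intWeight j ^ s :=
    tsum_nonneg fun j => mul_nonneg (norm_nonneg _) (pow_nonneg (intWeight_pos j).le s)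
  refine ⟨(∑' j, ‖K j‖ * intWeight j ^ s) * B, by positivity, P, fun q m => ?_⟩
  refine (norm_cutConv_le hK (S q) (hF q) m).trans (le_of_eq (by ring))

end Tame

/-- The lower order part `σ² T² g + iβσ³ T³ f` of the fibre operator, `T` being the cut-off
convolution. -/
noncomputable def fibreLower (K : ℤ → ℂ) (β : ℝ) (S : Set ℤ) (σ : ℝ) (f g : ℤ → ℂ) (m : ℤ) : ℂ :=
  (σ : ℂ) ^ 2 * cutConv K S (cutConv K S g) m
    + I * β * (σ : ℂ) ^ 3 * cutConv K S (cutConv K S (cutConv K S f)) m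

lemma Tame.lower {K : ℤ → ℂ} (hK : RapidDecay K) {s : ℕ} {F G : Q → ℤ → ℂ}
    (hL : ∀ q, 1 ≤ L q) (hR : ∀ q, 0 ≤ R q) (β : ℝ) (S : Q → Set ℤ)
    {σ : Q → ℝ} (hσ : ∀ q, |σ q| ≤ 2 * Real.pi * L q ^ 2) (hF : Tame L R s F)
    (hG : Tame L R s G) : Tame L R s (fun q => fibreLower K β (S q) (σ q) (F q) (G q)) := by
  unfold fibreLower
  have hσ0 : ∀ q, ∀ k : ℕ, ‖(σ q : ℂ) ^ k‖ ≤ (2 * Real.pi) ^ k * L q ^ (2 * k) := by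
    intro q k
    rw [norm_pow, Complex.norm_real, Real.norm_eq_abs, pow_mul, ← mul_pow]
    exact pow_le_pow_left₀ (abs_nonneg _) (hσ q) k
  refine Tame.add hL hR ?_ ?_
  · exact ((hG.conv hK S).conv hK S).const_mul hL fun q => hσ0 q 2
  · refine (((hF.conv hK S).conv hK S).conv hK S).const_mul hL (A := |β| * (2 * Real.pi) ^ 3) (k := 6)
      fun q => ?_
    rw [norm_mul, norm_mul, Complex.norm_I, Complex.norm_real, Real.norm_eq_abs, one_mul, mul_assoc]
    exact mul_le_mul_of_nonneg_left (hσ0 q 3) (abs_nonneg _)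

/-- The fibre equation
`f_{i+3} = -(2πm)² f_{i+1} - σ² T² f_{i+1} - iβσ³ T³ f_i` and its time derivatives. -/
def FibreRec (K : ℤ → ℂ) (β : ℝ) (S : Set ℤ) (σ : ℝ) (f : ℕ → ℤ → ℂ) : Prop :=
  ∀ i m, f (i + 3) m = -((2 * Real.pi * m) * (2 * Real.pi * m * f (i + 1) m))
    - fibreLower K β S σ (f i) (f (i + 1)) m

/-- Solving the fibre equation for its highest time derivative. -/
lemma Tame.of_recursion {K : ℤ → ℂ} (hK : RapidDecay K)
    (hL : ∀ q, 1 ≤ L q) (hR : ∀ q, 0 ≤ R q) {β : ℝ} {S : Q → Set ℤ}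
    {σ : Q → ℝ} (hσ : ∀ q, |σ q| ≤ 2 * Real.pi * L q ^ 2) {F : ℕ → Q → ℤ → ℂ}
    (hrec : ∀ q, FibreRec K β (S q) (σ q) fun i => F i q)
    (h0 : ∀ s, Tame L R s (F 0)) (h1 : ∀ s, Tame L R s (F 1)) (h2 : ∀ s, Tame L R s (F 2))
    (i : ℕ) : ∀ s, Tame L R s (F i) := by
  induction i using Nat.strong_induction_on with
  | _ i ih =>
    match i with
    | 0 => exact h0
    | 1 => exact h1
    | 2 => exact h2
    | i + 3 =>
      intro s
      have := ((ih (i + 1) (by omega) (s + 1 + 1)).intMul.intMul).neg.add hL hR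
        (Tame.lower hK hL hR β S hσ (ih i (by omega) s) (ih (i + 1) (by omega) s)).neg
      refine (congrArg (Tame L R s) ?_).mpr this
      funext q m
      rw [show F (i + 3) q m = _ from hrec q i m, sub_eq_add_neg]

/-- Solving the fibre equation for the second order term in `m` gains two powers of `1 + |m|`. -/
lemma Tame.gain_two {K : ℤ → ℂ} (hK : RapidDecay K)
    (hL : ∀ q, 1 ≤ L q) (hR : ∀ q, 0 ≤ R q) {β : ℝ} {S : Q → Set ℤ}
    {σ : Q → ℝ} (hσ : ∀ q, |σ q| ≤ 2 * Real.pi * L q ^ 2) {F : ℕ → Q → ℤ → ℂ}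
    (hrec : ∀ q, FibreRec K β (S q) (σ q) fun i => F i q) {s : ℕ}
    (h : ∀ i, Tame L R s (F i)) (i : ℕ) : Tame L R (s + 2) (F (i + 1)) := by
  have h1 : Tame L R s fun q m => (2 * Real.pi * m) * (2 * Real.pi * m * F (i + 1) q m) := by
    have := ((h (i + 3)).add hL hR (Tame.lower hK hL hR β S hσ (h i) (h (i + 1)))).neg
    refine (congrArg (Tame L R s) ?_).mpr this
    funext q m
    rw [show F (i + 3) q m = _ from hrec q i m]; ring
  obtain ⟨A, hA, P, h2⟩ := (Tame.add hL hR ((h (i + 1)).const_mul hL (a := fun _ => 2) (A := 2)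
    (k := 0) (by simp)) (h1.const_mul hL (a := fun _ => 2) (A := 2) (k := 0) (by simp)))
  refine ⟨A, hA, P, fun q m => le_trans ?_ (h2 q m)⟩
  have e1 : 2 * F (i + 1) q m + 2 * (2 * Real.pi * m * (2 * Real.pi * m * F (i + 1) q m))
      = ((2 + 2 * (2 * Real.pi * m) ^ 2 : ℝ) : ℂ) * F (i + 1) q m := by push_cast; ring
  have h4 : 0 ≤ intWeight m ^ s := pow_nonneg (intWeight_pos m).le s
  have h5 : intWeight m ^ 2 ≤ 2 + 2 * (2 * Real.pi * m) ^ 2 := by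
    unfold intWeight
    have : (1 : ℝ) ≤ (2 * Real.pi) ^ 2 := by nlinarith [Real.pi_gt_three]
    nlinarith [sq_abs (m : ℝ), sq_nonneg (|(m : ℝ)| - 1), sq_nonneg (m : ℝ)]
  beta_reduce
  rw [e1, norm_mul, Complex.norm_real, Real.norm_of_nonneg (by positivity), pow_add]
  calc ‖F (i + 1) q m‖ * (intWeight m ^ s * intWeight m ^ 2)
      = intWeight m ^ 2 * (‖F (i + 1) q m‖ * intWeight m ^ s) := by ring
    _ ≤ (2 + 2 * (2 * Real.pi * m) ^ 2) * (‖F (i + 1) q m‖ * intWeight m ^ s) := by gcongr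
    _ = _ := by ring

end TameSequences

section TruncatedFibre

open scoped InnerProductSpace

/-- The operator with kernel `k` on the finite section `S`. -/
noncomputable def kernelOp (S : Finset ℤ) (k : ℤ → ℤ → ℂ) :
    EuclideanSpace ℂ S →L[ℝ] EuclideanSpace ℂ S :=
  (Matrix.toEuclideanCLM (n := S) (𝕜 := ℂ) (Matrix.of fun i j : S => k i j)).restrictScalars ℝ

/-- Multiplication by `i`. -/
noncomputable def mulI (S : Finset ℤ) : EuclideanSpace ℂ S →L[ℝ] EuclideanSpace ℂ S :=
  (I • ContinuousLinearMap.id ℂ (EuclideanSpace ℂ S)).restrictScalars ℝ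

variable {S : Finset ℤ}

lemma kernelOp_apply (k : ℤ → ℤ → ℂ) (x : EuclideanSpace ℂ S) (i : S) :
    kernelOp S k x i = ∑ j : S, k i j * x j := by
  have := congrFun (Matrix.ofLp_toEuclideanCLM (Matrix.of fun i j : S => k i j) x) i
  exact this

lemma mulI_apply (x : EuclideanSpace ℂ S) (i : S) : mulI S x i = I * x i := rfl

lemma inner_eq_sum (x y : EuclideanSpace ℂ S) :
    ⟪x, y⟫_ℝ = ∑ i, ((starRingEnd ℂ) (x i) * y i).re := by
  rw [PiLp.inner_apply]
  refine Finset.sum_congr rfl fun i _ => ?_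
  rw [Complex.inner, mul_comm]

lemma sum_subtype_le_tsum {a : ℤ → ℝ} (ha : ∀ j, 0 ≤ a j) (hs : Summable a) {f : S → ℤ}
    (hf : Function.Injective f) : ∑ j, a (f j) ≤ ∑' j, a j := by
  calc ∑ j, a (f j) = ∑ j ∈ Finset.univ.map ⟨f, hf⟩, a j := by simp
    _ ≤ _ := hs.sum_le_tsum _ fun j _ => ha j

lemma norm_kernelOp_le {k : ℤ → ℤ → ℂ} {a : ℤ → ℝ} (hs : Summable a)
    (hk : ∀ i j, ‖k i j‖ ≤ a (i - j)) (x : EuclideanSpace ℂ S) :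
    ‖kernelOp S k x‖ ≤ (∑' j, a j) * ‖x‖ := by
  have ha : ∀ j, 0 ≤ a j := fun j => by simpa using (norm_nonneg _).trans (hk j 0)
  have hA : 0 ≤ ∑' j, a j := tsum_nonneg ha
  refine le_of_sq_le_sq ?_ (by positivity)
  rw [mul_pow, EuclideanSpace.norm_sq_eq, EuclideanSpace.norm_sq_eq]
  have h1 : ∀ i : S, ‖kernelOp S k x i‖ ^ 2
      ≤ (∑' j, a j) * ∑ j : S, a (i - j) * ‖x j‖ ^ 2 := by
    intro i
    have h2 : ‖kernelOp S k x i‖ ≤ ∑ j : S, a (i - j) * ‖x j‖ := by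
      rw [kernelOp_apply]
      refine (norm_sum_le _ _).trans (Finset.sum_le_sum fun j _ => ?_)
      rw [norm_mul]
      exact mul_le_mul_of_nonneg_right (hk _ _) (norm_nonneg _)
    have h3 : (∑ j : S, a (i - j) * ‖x j‖) ^ 2
        ≤ (∑ j : S, a (i - j)) * ∑ j : S, a (i - j) * ‖x j‖ ^ 2 := by
      refine Finset.sum_sq_le_sum_mul_sum_of_sq_le_mul _ (fun j _ => ha _)
        (fun j _ => mul_nonneg (ha _) (sq_nonneg _)) fun j _ => le_of_eq (by ring)
    refine (pow_le_pow_left₀ (norm_nonneg _) h2 2).trans (h3.trans ?_)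
    refine mul_le_mul_of_nonneg_right (sum_subtype_le_tsum ha hs fun j j' h => ?_)
      (Finset.sum_nonneg fun j _ => mul_nonneg (ha _) (sq_nonneg _))
    exact Subtype.ext (by simpa using h)
  calc ∑ i, ‖kernelOp S k x i‖ ^ 2
      ≤ ∑ i : S, (∑' j, a j) * ∑ j : S, a (i - j) * ‖x j‖ ^ 2 := Finset.sum_le_sum fun i _ => h1 i
    _ = (∑' j, a j) * ∑ j : S, (∑ i : S, a (i - j)) * ‖x j‖ ^ 2 := by
        rw [← Finset.mul_sum, Finset.sum_comm]
        simp only [Finset.sum_mul]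
    _ ≤ (∑' j, a j) * ∑ j : S, (∑' j, a j) * ‖x j‖ ^ 2 := by
        refine mul_le_mul_of_nonneg_left (Finset.sum_le_sum fun j _ => ?_) hA
        refine mul_le_mul_of_nonneg_right (sum_subtype_le_tsum ha hs fun i i' h => ?_) (sq_nonneg _)
        exact Subtype.ext (by simpa using h)
    _ = _ := by rw [← Finset.mul_sum]; ring

lemma inner_kernelOp_left {k : ℤ → ℤ → ℂ} (hk : ∀ i j, k j i = (starRingEnd ℂ) (k i j))
    (x y : EuclideanSpace ℂ S) : ⟪kernelOp S k x, y⟫_ℝ = ⟪x, kernelOp S k y⟫_ℝ := by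
  rw [inner_eq_sum, inner_eq_sum]
  simp only [kernelOp_apply, map_sum, map_mul, Finset.sum_mul, Finset.mul_sum, Complex.re_sum,
    ← hk]
  rw [Finset.sum_comm]
  refine Finset.sum_congr rfl fun i _ => Finset.sum_congr rfl fun j _ => ?_
  congr 1; ring

lemma mulI_kernelOp (k : ℤ → ℤ → ℂ) (x : EuclideanSpace ℂ S) :
    mulI S (kernelOp S k x) = kernelOp S k (mulI S x) := by
  ext i
  simp only [mulI_apply, kernelOp_apply, Finset.mul_sum]
  exact Finset.sum_congr rfl fun j _ => by ring

/-- The kernel of the differentiation operator. -/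
noncomputable def diagKernel (i j : ℤ) : ℂ := if i = j then ((2 * Real.pi * i : ℝ) : ℂ) else 0

lemma diagOp_apply (x : EuclideanSpace ℂ S) (i : S) :
    kernelOp S diagKernel x i = 2 * Real.pi * (i : ℤ) * x i := by
  rw [kernelOp_apply, Finset.sum_eq_single i]
  · simp [diagKernel]
  · intro j _ h
    have : (i : ℤ) ≠ j := fun e => h (Subtype.ext e.symm)
    simp [diagKernel, this]
  · simp

lemma commutator_kernelOp (k : ℤ → ℤ → ℂ) (x : EuclideanSpace ℂ S) :
    kernelOp S diagKernel (kernelOp S k x) - kernelOp S k (kernelOp S diagKernel x)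
      = kernelOp S (fun i j => 2 * Real.pi * (i - j) * k i j) x := by
  ext i
  rw [PiLp.sub_apply, diagOp_apply, kernelOp_apply, kernelOp_apply, kernelOp_apply,
    Finset.mul_sum, ← Finset.sum_sub_distrib]
  refine Finset.sum_congr rfl fun j _ => ?_
  rw [diagOp_apply]; ring

lemma symmPair_fibre {K : ℤ → ℂ} (hK : RapidDecay K)
    (hsymm : ∀ j, K (-j) = (starRingEnd ℂ) (K j)) {σ L : ℝ} (hσ : |σ| ≤ 2 * Real.pi * L ^ 2)
    (S : Finset ℤ) :
    SymmPair (kernelOp S diagKernel) (kernelOp S fun i j => σ * K (i - j)) (mulI S)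
      (2 * Real.pi * ((2 * Real.pi) ^ 2 * ∑' j, ‖K j‖ * intWeight j ^ 2)) L := by
  have hb : ∀ (k : ℤ → ℤ → ℂ), (∀ i j, ‖k i j‖ ≤
      (2 * Real.pi) ^ 2 * |σ| * (‖K (i - j)‖ * intWeight (i - j) ^ 2)) →
      ∀ x : EuclideanSpace ℂ S, ‖kernelOp S k x‖ ≤
        2 * Real.pi * ((2 * Real.pi) ^ 2 * ∑' j, ‖K j‖ * intWeight j ^ 2) * L ^ 2 * ‖x‖ := by
    intro k hk x
    refine (norm_kernelOp_le ((hK 2).mul_left _) hk x).trans ?_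
    rw [tsum_mul_left]
    refine mul_le_mul_of_nonneg_right ?_ (norm_nonneg _)
    have h0 : 0 ≤ ∑' j, ‖K j‖ * intWeight j ^ 2 :=
      tsum_nonneg fun j => mul_nonneg (norm_nonneg _) (sq_nonneg _)
    calc (2 * Real.pi) ^ 2 * |σ| * ∑' j, ‖K j‖ * intWeight j ^ 2
        ≤ (2 * Real.pi) ^ 2 * (2 * Real.pi * L ^ 2) * ∑' j, ‖K j‖ * intWeight j ^ 2 := by gcongr
      _ = _ := by ring
  have hw : ∀ i j : ℤ, ‖(2 * Real.pi * (i - j) : ℂ)‖ ≤ 2 * Real.pi * intWeight (i - j) := by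
    intro i j
    rw [norm_mul, norm_mul, Complex.norm_ofNat, Complex.norm_real, Real.norm_of_nonneg
      Real.pi_pos.le, ← Int.cast_sub, Complex.norm_intCast]
    gcongr
    unfold intWeight; linarith
  have hσK : ∀ j, ‖(σ * K j : ℂ)‖ = |σ| * ‖K j‖ := fun j => by
    rw [norm_mul, Complex.norm_real, Real.norm_eq_abs]
  have hp : 1 ≤ 2 * Real.pi := by linarith [Real.pi_gt_three]
  refine ⟨inner_kernelOp_left fun i j => ?_, inner_kernelOp_left fun i j => ?_, fun x y => ?_,
    fun x => ?_, mulI_kernelOp _, mulI_kernelOp _, fun x => ?_, fun x => ?_⟩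
  · unfold diagKernel
    rcases eq_or_ne i j with rfl | h
    · rw [if_pos rfl, Complex.conj_ofReal]
    · rw [if_neg h, if_neg h.symm, map_zero]
  · rw [map_mul, Complex.conj_ofReal, ← hsymm, neg_sub]
  · rw [inner_eq_sum, inner_eq_sum, ← Finset.sum_neg_distrib]
    refine Finset.sum_congr rfl fun i _ => ?_
    rw [mulI_apply, mulI_apply, ← Complex.neg_re]
    congr 1
    rw [map_mul, Complex.conj_I]; ring
  · rw [EuclideanSpace.norm_eq, EuclideanSpace.norm_eq]
    simp [mulI_apply]
  · rw [commutator_kernelOp]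
    refine hb _ (fun i j => ?_) x
    have h1 := one_le_intWeight (i - j)
    rw [norm_mul, hσK]
    calc _ ≤ 2 * Real.pi * intWeight (i - j) * (|σ| * ‖K (i - j)‖) := by
          gcongr; exact hw i j
      _ ≤ 2 * Real.pi * intWeight (i - j) * (|σ| * ‖K (i - j)‖) *
          (2 * Real.pi * intWeight (i - j)) := by
          refine le_mul_of_one_le_right (by positivity) ?_
          nlinarith
      _ = _ := by ring
  · have h3 : kernelOp S diagKernel (kernelOp S (fun i j => σ * K (i - j)) (kernelOp S diagKernel x))
        - kernelOp S (fun i j => σ * K (i - j)) (kernelOp S diagKernel (kernelOp S diagKernel x))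
        = _ := commutator_kernelOp _ (kernelOp S diagKernel x)
    rw [commutator_kernelOp, h3, commutator_kernelOp]
    refine hb _ (fun i j => ?_) x
    rw [norm_mul, norm_mul (2 * (Real.pi : ℂ) * _) (σ * K _ : ℂ), hσK]
    calc _ ≤ 2 * Real.pi * intWeight (i - j) * (2 * Real.pi * intWeight (i - j) *
          (|σ| * ‖K (i - j)‖)) := by
          have h1 := intWeight_pos (i - j)
          gcongr <;> exact hw i j
      _ = _ := by ring

end TruncatedFibre

section ThirdOrderODE

variable {H : Type*} [NormedAddCommGroup H] [NormedSpace ℝ H] [CompleteSpace H]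

/-- A linear third order Cauchy problem in a Banach space has a smooth solution. -/
lemma exists_third_order_solution (A B : H →L[ℝ] H) (v₀ v₁ v₂ : H) :
    ∃ U : ℕ → ℝ → H, (∀ i t, HasDerivAt (U i) (U (i + 1) t) t) ∧ U 0 0 = v₀ ∧ U 1 0 = v₁ ∧
      U 2 0 = v₂ ∧ ∀ i t, U (i + 3) t = -A (U (i + 1) t) - B (U i t) := by
  let E := H × H × H
  let p₀ : E →L[ℝ] H := ContinuousLinearMap.fst ℝ H (H × H)
  let p₁ : E →L[ℝ] H := (ContinuousLinearMap.fst ℝ H H).comp (ContinuousLinearMap.snd ℝ H (H × H))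
  let p₂ : E →L[ℝ] H := (ContinuousLinearMap.snd ℝ H H).comp (ContinuousLinearMap.snd ℝ H (H × H))
  let T : E →L[ℝ] E := p₁.prod (p₂.prod (-A.comp p₁ - B.comp p₀))
  let y₀ : E := (v₀, v₁, v₂)
  have hT : ∀ y : E, T y = (y.2.1, y.2.2, -A y.2.1 - B y.1) := fun y => rfl
  refine ⟨fun i t => (NormedSpace.exp (t • T) ((T ^ i) y₀)).1, fun i t => ?_, ?_, ?_, ?_,
    fun i t => ?_⟩
  · have h1 := hasDerivAt_exp_smul_const (𝕂 := ℝ) T t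
    have h2 : HasDerivAt (fun t : ℝ => NormedSpace.exp (t • T) ((T ^ i) y₀))
        ((NormedSpace.exp (t • T) * T) ((T ^ i) y₀)) t := by
      have := (ContinuousLinearMap.apply ℝ E ((T ^ i) y₀)).hasFDerivAt.comp_hasDerivAt t h1
      exact this
    have h3 := p₀.hasFDerivAt.comp_hasDerivAt t h2
    beta_reduce
    rw [pow_succ']
    exact h3
  · simp [y₀]
  · simp [y₀, hT]
  · simp [y₀, pow_succ, hT]
  · have hc : ∀ y, NormedSpace.exp (t • T) (T y) = T (NormedSpace.exp (t • T) y) := by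
      intro y
      have h : Commute (NormedSpace.exp (t • T)) T :=
        ((Commute.refl T).smul_left t).exp_left
      exact congrArg (fun X : E →L[ℝ] E => X y) h.eq
    have h1 : ∀ k y, (T ^ (k + 1)) y = T ((T ^ k) y) := fun k y => by rw [pow_succ']; rfl
    simp only [h1, hc]
    simp only [hT]

end ThirdOrderODE

section Extension

variable {S : Finset ℤ}

/-- Extension by zero of a vector indexed by `S` to a sequence on `ℤ`. -/
noncomputable def extendZero (x : EuclideanSpace ℂ S) (m : ℤ) : ℂ :=
  if h : m ∈ S then x ⟨m, h⟩ else 0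

lemma extendZero_diagOp (x : EuclideanSpace ℂ S) (m : ℤ) :
    extendZero (kernelOp S diagKernel x) m = 2 * Real.pi * m * extendZero x m := by
  unfold extendZero
  split_ifs with h
  · exact diagOp_apply x ⟨m, h⟩
  · simp

lemma extendZero_convOp (K : ℤ → ℂ) (σ : ℝ) (x : EuclideanSpace ℂ S) (m : ℤ) :
    extendZero (kernelOp S (fun i j => σ * K (i - j)) x) m
      = σ * cutConv K S (extendZero x) m := by
  by_cases h : m ∈ S
  · have h1 : cutConv K S (extendZero x) m = ∑ j : S, K (m - j) * x j := by
      rw [cutConv, Set.indicator_of_mem (by exact_mod_cast h), ← (Equiv.subLeft m).tsum_eq,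
        tsum_eq_sum (s := S), ← Finset.sum_coe_sort S]
      · refine Finset.sum_congr rfl fun j _ => ?_
        simp [extendZero]
      · intro j hj
        simp [extendZero, hj]
    rw [h1, extendZero, dif_pos h, kernelOp_apply, Finset.mul_sum]
    exact Finset.sum_congr rfl fun j _ => by ring
  · rw [extendZero, dif_neg h, cutConv, Set.indicator_of_notMem (by exact_mod_cast h), mul_zero]

lemma extendZero_convOp_funext (K : ℤ → ℂ) (σ : ℝ) (x : EuclideanSpace ℂ S) :
    extendZero (kernelOp S (fun i j => σ * K (i - j)) x)
      = fun m => σ * cutConv K S (extendZero x) m := funext (extendZero_convOp K σ x)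

lemma cutConv_const_mul (K : ℤ → ℂ) (S : Set ℤ) (a : ℂ) (f : ℤ → ℂ) (m : ℤ) :
    cutConv K S (fun j => a * f j) m = a * cutConv K S f m := by
  unfold cutConv
  by_cases h : m ∈ S
  · rw [Set.indicator_of_mem h, Set.indicator_of_mem h, ← tsum_mul_left]
    exact tsum_congr fun j => by ring
  · rw [Set.indicator_of_notMem h, Set.indicator_of_notMem h, mul_zero]

lemma hasDerivAt_extendZero {U : ℝ → EuclideanSpace ℂ S} {U' : EuclideanSpace ℂ S} {t : ℝ}
    (h : HasDerivAt U U' t) (m : ℤ) :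
    HasDerivAt (fun t => extendZero (U t) m) (extendZero U' m) t := by
  unfold extendZero
  split_ifs with hm
  · exact (PiLp.proj (𝕜 := ℝ) 2 (fun _ : S => ℂ) ⟨m, hm⟩).hasFDerivAt.comp_hasDerivAt t h
  · exact hasDerivAt_const t _

lemma norm_extendZero_le (x : EuclideanSpace ℂ S) (m : ℤ) : ‖extendZero x m‖ ≤ ‖x‖ := by
  unfold extendZero
  split_ifs with hm
  · exact PiLp.norm_apply_le x _
  · simp

lemma summable_intWeight : Summable fun m : ℤ => (intWeight m ^ 2)⁻¹ := by
  have h1 : Summable fun m : ℤ => 1 / (m : ℝ) ^ 2 := Real.summable_one_div_int_pow.2 one_lt_two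
  have h2 : Summable fun m : ℤ => 1 / (m : ℝ) ^ 2 + if m = 0 then 1 else 0 :=
    h1.add (summable_of_ne_finset_zero (s := {0}) fun m hm => by simp at hm; simp [hm])
  refine Summable.of_nonneg_of_le (fun m => inv_nonneg.2 (sq_nonneg _)) (fun m => ?_) h2
  rcases eq_or_ne m 0 with rfl | hm
  · simp [intWeight]
  · have h3 : 0 < |(m : ℝ)| := abs_pos.2 (by exact_mod_cast hm)
    rw [if_neg hm, add_zero, one_div, ← sq_abs (m : ℝ)]
    unfold intWeight
    gcongr
    linarith

lemma norm_sq_le_of_extendZero {x : EuclideanSpace ℂ S} {B : ℝ}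
    (h : ∀ m, ‖extendZero x m‖ * intWeight m ^ 1 ≤ B) :
    ‖x‖ ^ 2 ≤ (∑' m, (intWeight m ^ 2)⁻¹) * B ^ 2 := by
  have h1 : ∀ m : S, ‖x m‖ ^ 2 ≤ (intWeight m ^ 2)⁻¹ * B ^ 2 := by
    intro m
    have h2 := h m
    rw [extendZero, dif_pos m.2, pow_one] at h2
    have h3 := intWeight_pos m
    rw [inv_mul_eq_div, le_div_iff₀ (by positivity), ← mul_pow]
    exact pow_le_pow_left₀ (by positivity) h2 2
  rw [EuclideanSpace.norm_sq_eq]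
  calc ∑ m, ‖x m‖ ^ 2 ≤ ∑ m : S, (intWeight m ^ 2)⁻¹ * B ^ 2 := Finset.sum_le_sum fun m _ => h1 m
    _ = (∑ m : S, (intWeight m ^ 2)⁻¹) * B ^ 2 := by rw [Finset.sum_mul]
    _ ≤ _ := by
      refine mul_le_mul_of_nonneg_right ?_ (sq_nonneg _)
      exact sum_subtype_le_tsum (fun m => inv_nonneg.2 (sq_nonneg _)) summable_intWeight
        Subtype.val_injective

end Extension

section TruncatedSolution

open SymmPair

/-- The fibre problem on the finite section `S`, with the energy estimate. -/
lemma exists_truncated_solution {K : ℤ → ℂ} (hK : RapidDecay K)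
    (hsymm : ∀ j, K (-j) = (starRingEnd ℂ) (K j)) {β : ℝ} (hβ : |β| < 2 / (3 * √3)) :
    ∃ C ≥ (0 : ℝ), ∀ (S : Finset ℤ) (σ L : ℝ), 1 ≤ L → |σ| ≤ 2 * Real.pi * L ^ 2 →
      ∀ a₀ a₁ a₂ : ℤ → ℂ, ∃ U : ℕ → ℝ → EuclideanSpace ℂ S,
        (∀ i t, HasDerivAt (U i) (U (i + 1) t) t) ∧
        extendZero (U 0 0) = (S : Set ℤ).indicator a₀ ∧
        extendZero (U 1 0) = (S : Set ℤ).indicator a₁ ∧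
        extendZero (U 2 0) = (S : Set ℤ).indicator a₂ ∧
        (∀ t, FibreRec K β S σ fun i => extendZero (U i t)) ∧
        ∀ i t, ‖U i t‖ ^ 2 ≤ C * Real.exp (C * L * |t|) *
          weight (kernelOp S diagKernel) (kernelOp S fun i j => σ * K (i - j)) L
            (U i 0) (U (i + 1) 0) (U (i + 2) 0) := by
  have h0 : 0 ≤ ∑' j, ‖K j‖ * intWeight j ^ 2 :=
    tsum_nonneg fun j => mul_nonneg (norm_nonneg _) (sq_nonneg _)
  obtain ⟨C, hC, h⟩ := exists_energy_estimate hβ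
    (κ := 2 * Real.pi * ((2 * Real.pi) ^ 2 * ∑' j, ‖K j‖ * intWeight j ^ 2)) (by positivity)
  refine ⟨C, hC, fun S σ L hL hσ a₀ a₁ a₂ => ?_⟩
  set D := kernelOp S diagKernel with hD
  set Z := kernelOp S fun i j => σ * K (i - j) with hZ
  have hsp := symmPair_fibre hK hsymm hσ S
  let v : (ℤ → ℂ) → EuclideanSpace ℂ S := fun a => WithLp.toLp 2 fun m : S => a m
  have hv : ∀ a, extendZero (v a) = (S : Set ℤ).indicator a := by
    intro a
    funext m
    by_cases hm : m ∈ S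
    · rw [extendZero, dif_pos hm, Set.indicator_of_mem (by exact_mod_cast hm)]
    · rw [extendZero, dif_neg hm, Set.indicator_of_notMem (by exact_mod_cast hm)]
  obtain ⟨U, hU, h0, h1, h2, h3⟩ := exists_third_order_solution (D.comp D + Z.comp Z)
    (β • (mulI S).comp (Z.comp (Z.comp Z))) (v a₀) (v a₁) (v a₂)
  have h4 : ∀ i t, U (i + 3) t = -(D (D (U (i + 1) t)) + Z (Z (U (i + 1) t)))
      - β • mulI S (Z (Z (Z (U i t)))) := h3
  refine ⟨U, hU, by rw [h0, hv], by rw [h1, hv], by rw [h2, hv], fun t i m => ?_, fun i t => ?_⟩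
  · have e : ∀ x y z : EuclideanSpace ℂ S, extendZero (-(x + y) - β • mulI S z) m
        = -extendZero x m - (extendZero y m + I * β * extendZero z m) := by
      intro x y z
      unfold extendZero
      split_ifs
      · simp only [PiLp.sub_apply, PiLp.neg_apply, PiLp.add_apply, PiLp.smul_apply, mulI_apply,
          Complex.real_smul]
        ring
      · simp
    show extendZero (U (i + 3) t) m = _
    rw [h4, e, hD, hZ]
    simp only [extendZero_diagOp, extendZero_convOp_funext, cutConv_const_mul, fibreLower]
    ring
  · exact h (EuclideanSpace ℂ S) D Z (mulI S) L hL hsp (U i) (U (i + 1)) (U (i + 2)) (hU i)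
      (hU (i + 1)) (fun t => h4 i t ▸ hU (i + 2) t) t

end TruncatedSolution

section UniformBounds

open SymmPair

variable {Q : Type*} {L R : Q → ℝ}

/-- Real families bounded by a polynomial in `L` times `R`. -/
def PolyBdd (L R X : Q → ℝ) : Prop := ∃ G ≥ 0, ∃ P : ℕ, ∀ q, X q ≤ G * L q ^ P * R q

lemma PolyBdd.add {X Y : Q → ℝ} (hL : ∀ q, 1 ≤ L q) (hR : ∀ q, 0 ≤ R q) (hX : PolyBdd L R X)
    (hY : PolyBdd L R Y) : PolyBdd L R fun q => X q + Y q := by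
  obtain ⟨A, hA, P, hX⟩ := hX
  obtain ⟨B, hB, P', hY⟩ := hY
  refine ⟨A + B, by positivity, P + P', fun q => ?_⟩
  have h1 : A * L q ^ P * R q ≤ A * L q ^ (P + P') * R q := by
    have := hR q; have := hL q; gcongr; omega
  have h2 : B * L q ^ P' * R q ≤ B * L q ^ (P + P') * R q := by
    have := hR q; have := hL q; gcongr; omega
  linarith [hX q, hY q]

lemma PolyBdd.pow_mul {X : Q → ℝ} (hL : ∀ q, 1 ≤ L q) (hX : PolyBdd L R X) (k : ℕ) :
    PolyBdd L R fun q => L q ^ k * X q := by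
  obtain ⟨A, hA, P, hX⟩ := hX
  refine ⟨A, hA, k + P, fun q => ?_⟩
  have h0 : 0 ≤ L q ^ k := pow_nonneg (by linarith [hL q]) k
  calc L q ^ k * X q ≤ L q ^ k * (A * L q ^ P * R q) := by gcongr; exact hX q
    _ = _ := by ring

variable {S : Q → Finset ℤ}

lemma Tame.polyBdd_norm_sq {x : ∀ q, EuclideanSpace ℂ (S q)}
    (h : Tame L R 1 fun q => extendZero (x q)) :
    PolyBdd L (fun q => R q ^ 2) fun q => ‖x q‖ ^ 2 := by
  obtain ⟨A, hA, P, h⟩ := h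
  have h0 : 0 ≤ ∑' m, (intWeight m ^ 2)⁻¹ := tsum_nonneg fun m => inv_nonneg.2 (sq_nonneg _)
  refine ⟨(∑' m, (intWeight m ^ 2)⁻¹) * A ^ 2, by positivity, P * 2, fun q => ?_⟩
  refine (norm_sq_le_of_extendZero (h q)).trans (le_of_eq ?_)
  rw [mul_pow, mul_pow, ← pow_mul]; ring

lemma Tame.diagOp {s : ℕ} {x : ∀ q, EuclideanSpace ℂ (S q)}
    (h : Tame L R (s + 1) fun q => extendZero (x q)) :
    Tame L R s fun q => extendZero (kernelOp (S q) diagKernel (x q)) := by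
  have := h.intMul
  refine (congrArg (Tame L R s) ?_).mpr this
  funext q m
  exact extendZero_diagOp _ _

lemma Tame.convOp {K : ℤ → ℂ} (hK : RapidDecay K) {s : ℕ} {x : ∀ q, EuclideanSpace ℂ (S q)}
    (hL : ∀ q, 1 ≤ L q) {σ : Q → ℝ} (hσ : ∀ q, |σ q| ≤ 2 * Real.pi * L q ^ 2)
    (h : Tame L R s fun q => extendZero (x q)) :
    Tame L R s fun q => extendZero (kernelOp (S q) (fun i j => σ q * K (i - j)) (x q)) := by
  have := (h.conv hK fun q => (S q : Set ℤ)).const_mul hL (a := fun q => (σ q : ℂ)) fun q => by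
    rw [Complex.norm_real, Real.norm_eq_abs]; exact hσ q
  refine (congrArg (Tame L R s) ?_).mpr this
  funext q m
  exact extendZero_convOp _ _ _ _

lemma Tame.polyBdd_weight {K : ℤ → ℂ} (hK : RapidDecay K) {a b c : ∀ q, EuclideanSpace ℂ (S q)}
    (hL : ∀ q, 1 ≤ L q) {σ : Q → ℝ} (hσ : ∀ q, |σ q| ≤ 2 * Real.pi * L q ^ 2)
    (ha : ∀ s, Tame L R s fun q => extendZero (a q))
    (hb : ∀ s, Tame L R s fun q => extendZero (b q))
    (hc : ∀ s, Tame L R s fun q => extendZero (c q)) :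
    PolyBdd L (fun q => R q ^ 2) fun q => weight (kernelOp (S q) diagKernel)
      (kernelOp (S q) fun i j => σ q * K (i - j)) (L q) (a q) (b q) (c q) := by
  have hR2 : ∀ q, 0 ≤ R q ^ 2 := fun q => sq_nonneg _
  unfold weight
  refine PolyBdd.add hL hR2 (PolyBdd.add hL hR2 (PolyBdd.add hL hR2 (PolyBdd.add hL hR2
    (PolyBdd.add hL hR2 (PolyBdd.add hL hR2 (PolyBdd.add hL hR2 ?_ ?_) ?_) ?_) ?_) ?_) ?_) ?_
  · exact (hc 1).polyBdd_norm_sq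
  · exact (hb 2).diagOp.polyBdd_norm_sq
  · exact ((hb 1).convOp hK hL hσ).polyBdd_norm_sq
  · exact (ha 3).diagOp.diagOp.polyBdd_norm_sq
  · exact (((ha 1).convOp hK hL hσ).convOp hK hL hσ).polyBdd_norm_sq
  · exact ((ha 2).diagOp.convOp hK hL hσ).polyBdd_norm_sq
  · exact (hb 1).polyBdd_norm_sq.pow_mul hL 2
  · exact (ha 1).polyBdd_norm_sq.pow_mul hL 4

lemma Tame.indicator {Y : Type*} {L R : Y → ℝ} {s : ℕ} {a : Y → ℤ → ℂ} (h : Tame L R s a) :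
    Tame (fun q : Finset ℤ × Y => L q.2) (fun q => R q.2) s
      fun q => (q.1 : Set ℤ).indicator (a q.2) := by
  obtain ⟨A, hA, P, h⟩ := h
  refine ⟨A, hA, P, fun q m => le_trans ?_ (h q.2 m)⟩
  have := pow_nonneg (intWeight_pos m).le s
  gcongr
  exact norm_indicator_le_norm_self _ _

lemma exists_uniform_truncated_solution {K : ℤ → ℂ} (hK : RapidDecay K)
    (hsymm : ∀ j, K (-j) = (starRingEnd ℂ) (K j)) {β : ℝ} (hβ : |β| < 2 / (3 * √3)) :
    ∃ C ≥ (0 : ℝ), ∀ (Y : Type) (L R σ : Y → ℝ), (∀ p, 1 ≤ L p) → (∀ p, 0 ≤ R p) →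
      (∀ p, |σ p| ≤ 2 * Real.pi * L p ^ 2) → ∀ a₀ a₁ a₂ : Y → ℤ → ℂ,
      (∀ s, Tame L R s a₀) → (∀ s, Tame L R s a₁) → (∀ s, Tame L R s a₂) →
      ∃ V : Finset ℤ → Y → ℕ → ℝ → ℤ → ℂ,
        (∀ S p i t m, HasDerivAt (fun t => V S p i t m) (V S p (i + 1) t m) t) ∧
        (∀ (S : Finset ℤ) p, V S p 0 0 = (S : Set ℤ).indicator (a₀ p)) ∧
        (∀ (S : Finset ℤ) p, V S p 1 0 = (S : Set ℤ).indicator (a₁ p)) ∧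
        (∀ (S : Finset ℤ) p, V S p 2 0 = (S : Set ℤ).indicator (a₂ p)) ∧
        (∀ (S : Finset ℤ) p t, FibreRec K β S (σ p) fun i => V S p i t) ∧
        ∀ i, ∃ G ≥ 0, ∃ P : ℕ, ∀ S p t m,
          ‖V S p i t m‖ ≤ G * L p ^ P * (R p * Real.exp (C * L p * |t|)) := by
  obtain ⟨C, hC, hU⟩ := exists_truncated_solution hK hsymm hβ
  refine ⟨C, hC, fun Y L R σ hL hR hσ a₀ a₁ a₂ h₀ h₁ h₂ => ?_⟩
  choose U hd hU0 hU1 hU2 hrec hbd using fun S p => hU S (σ p) (L p) (hL p) (hσ p) (a₀ p) (a₁ p)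
    (a₂ p)
  have hinit : ∀ i s, Tame (fun q : Finset ℤ × Y => L q.2) (fun q => R q.2) s
      fun q => extendZero (U q.1 q.2 i 0) := by
    intro i
    refine Tame.of_recursion (Q := Finset ℤ × Y) hK (fun q => hL q.2) (fun q => hR q.2) (fun q => hσ q.2)
      (F := fun i q => extendZero (U q.1 q.2 i 0)) (fun q => hrec q.1 q.2 0) ?_ ?_ ?_ i
    · intro s; simp only [hU0]; exact (h₀ s).indicator
    · intro s; simp only [hU1]; exact (h₁ s).indicator
    · intro s; simp only [hU2]; exact (h₂ s).indicator
  refine ⟨fun S p i t => extendZero (U S p i t), fun S p i t m => hasDerivAt_extendZero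
    (hd S p i t) m, hU0, hU1, hU2, hrec, fun i => ?_⟩
  obtain ⟨G, hG, P, hW⟩ := Tame.polyBdd_weight hK (S := fun q : Finset ℤ × Y => q.1)
    (fun q => hL q.2) (fun q => hσ q.2) (hinit i) (hinit (i + 1)) (hinit (i + 2))
  refine ⟨(1 + C) * (1 + G), by positivity, P, fun S p t m => ?_⟩
  refine (norm_extendZero_le _ _).trans ?_
  have hLp := hL p
  have hRp := hR p
  have hE : 1 ≤ Real.exp (C * L p * |t|) := Real.one_le_exp (by positivity)
  have hLP : 1 ≤ L p ^ P := one_le_pow₀ hLp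
  refine le_of_sq_le_sq ?_ (by positivity)
  calc ‖U S p i t‖ ^ 2 ≤ C * Real.exp (C * L p * |t|) * _ := hbd S p i t
    _ ≤ C * Real.exp (C * L p * |t|) * (G * L p ^ P * R p ^ 2) := by
        gcongr; exact hW (S, p)
    _ = C * G * L p ^ P * R p ^ 2 * Real.exp (C * L p * |t|) := by ring
    _ ≤ ((1 + C) * (1 + G)) ^ 2 * (L p ^ P) ^ 2 * R p ^ 2 * Real.exp (C * L p * |t|) ^ 2 := by
        have e1 : C * G ≤ ((1 + C) * (1 + G)) ^ 2 := by nlinarith [mul_nonneg hC hG]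
        have e2 : L p ^ P ≤ (L p ^ P) ^ 2 := by nlinarith
        have e3 : Real.exp (C * L p * |t|) ≤ Real.exp (C * L p * |t|) ^ 2 := by nlinarith
        gcongr
    _ = _ := by ring

end UniformBounds

section PointwiseLimits

open Filter Topology

/-- Second order Taylor bound for a function with derivative `g`, where `g` has derivative `h`. -/
lemma norm_taylor_one_le {f g h : ℝ → ℂ} (hf : ∀ t, HasDerivAt f (g t) t)
    (hg : ∀ t, HasDerivAt g (h t) t) {t₀ t M : ℝ} (hM : ∀ τ, |τ - t₀| ≤ 1 → ‖h τ‖ ≤ M)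
    (ht : |t - t₀| ≤ 1) : ‖f t - f t₀ - (t - t₀) • g t₀‖ ≤ M * ‖t - t₀‖ ^ 2 := by
  have hM0 : 0 ≤ M := (norm_nonneg _).trans (hM t₀ (by simp))
  have hsub : ∀ τ ∈ Set.uIcc t₀ t, |τ - t₀| ≤ |t - t₀| := fun τ hτ => Set.abs_sub_left_of_mem_uIcc hτ
  have h1 : ∀ τ ∈ Set.uIcc t₀ t, ‖g τ - g t₀‖ ≤ M * ‖t - t₀‖ := by
    intro τ hτ
    refine (Convex.norm_image_sub_le_of_norm_hasDerivWithin_le (s := Set.uIcc t₀ t)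
      (fun x _ => (hg x).hasDerivWithinAt) (fun x hx => hM x ((hsub x hx).trans ht))
      (convex_uIcc t₀ t) Set.left_mem_uIcc hτ).trans ?_
    gcongr
    simpa only [Real.norm_eq_abs] using hsub τ hτ
  have h2 : ∀ τ ∈ Set.uIcc t₀ t, HasDerivWithinAt (fun τ => f τ - (τ - t₀) • g t₀) (g τ - g t₀)
      (Set.uIcc t₀ t) τ := by
    intro τ _
    have := (hf τ).sub (((hasDerivAt_id τ).sub_const t₀).smul_const (g t₀))
    rw [one_smul] at this
    exact this.hasDerivWithinAt
  have h3 := Convex.norm_image_sub_le_of_norm_hasDerivWithin_le h2 h1 (convex_uIcc t₀ t)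
    Set.left_mem_uIcc Set.right_mem_uIcc
  simp only [sub_self, zero_smul, sub_zero] at h3
  calc _ = ‖f t - (t - t₀) • g t₀ - f t₀‖ := by congr 1; abel
    _ ≤ _ := h3
    _ = _ := by ring

/-- Pointwise limits of functions with locally bounded second derivatives are differentiable. -/
lemma hasDerivAt_of_tendsto_of_bounded {ι : Type*} {l : Filter ι} [l.NeBot]
    {f g h : ι → ℝ → ℂ} (hf : ∀ S t, HasDerivAt (f S) (g S t) t)
    (hg : ∀ S t, HasDerivAt (g S) (h S t) t) {t₀ M : ℝ}
    (hM : ∀ S τ, |τ - t₀| ≤ 1 → ‖h S τ‖ ≤ M) {f₀ g₀ : ℝ → ℂ}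
    (hf₀ : ∀ t, Tendsto (fun S => f S t) l (𝓝 (f₀ t)))
    (hg₀ : ∀ t, Tendsto (fun S => g S t) l (𝓝 (g₀ t))) : HasDerivAt f₀ (g₀ t₀) t₀ := by
  rw [hasDerivAt_iff_isLittleO]
  refine Asymptotics.IsBigO.trans_isLittleO (g := fun t => ‖t - t₀‖ ^ 2) ?_
    (Asymptotics.isLittleO_pow_sub_sub t₀ one_lt_two)
  refine Asymptotics.IsBigO.of_bound M ?_
  filter_upwards [Metric.closedBall_mem_nhds t₀ one_pos] with t ht
  rw [mem_closedBall_iff_norm, Real.norm_eq_abs] at ht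
  have h1 : Tendsto (fun S => ‖f S t - f S t₀ - (t - t₀) • g S t₀‖) l
      (𝓝 ‖f₀ t - f₀ t₀ - (t - t₀) • g₀ t₀‖) :=
    (((hf₀ t).sub (hf₀ t₀)).sub ((hg₀ t₀).const_smul _)).norm
  refine (le_of_tendsto h1 (Eventually.of_forall fun S =>
    norm_taylor_one_le (hf S) (hg S) (hM S) ht)).trans ?_
  rw [Real.norm_of_nonneg (sq_nonneg _)]

lemma norm_cutConv_le_of_bounded {K f : ℤ → ℂ} (hK : RapidDecay K) (S : Set ℤ) {B : ℝ}
    (hf : ∀ m, ‖f m‖ ≤ B) (m : ℤ) : ‖cutConv K S f m‖ ≤ (∑' j, ‖K j‖) * B := by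
  simpa using norm_cutConv_le hK S (s := 0) (by simpa using hf) m

lemma tendsto_cutConv {K : ℤ → ℂ} (hK : RapidDecay K) {l : Filter (Finset ℤ)} (hl : l ≤ atTop)
    {f : Finset ℤ → ℤ → ℂ} {f₀ : ℤ → ℂ} {B : ℝ} (hf : ∀ S m, ‖f S m‖ ≤ B)
    (hf₀ : ∀ m, Tendsto (fun S => f S m) l (𝓝 (f₀ m))) (m : ℤ) :
    Tendsto (fun S : Finset ℤ => cutConv K (S : Set ℤ) (f S) m) l (𝓝 (cutConv K Set.univ f₀ m)) := by
  have h1 : Tendsto (fun S => ∑' j, K j * f S (m - j)) l (𝓝 (∑' j, K j * f₀ (m - j))) := by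
    refine tendsto_tsum_of_dominated_convergence (bound := fun j => ‖K j‖ * B) ?_
      (fun j => (hf₀ _).const_mul _) (Eventually.of_forall fun S j => ?_)
    · have := hK 0
      simp only [pow_zero, mul_one] at this
      exact this.mul_right B
    · rw [norm_mul]
      exact mul_le_mul_of_nonneg_left (hf S _) (norm_nonneg _)
  rw [cutConv, Set.indicator_univ]
  refine h1.congr' ?_
  filter_upwards [hl (eventually_ge_atTop {m})] with S hS
  rw [cutConv, Set.indicator_of_mem]
  exact_mod_cast hS (Finset.mem_singleton_self m)

lemma tendsto_fibreLower {K : ℤ → ℂ} (hK : RapidDecay K) {l : Filter (Finset ℤ)} (hl : l ≤ atTop)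
    (β σ : ℝ) {f g : Finset ℤ → ℤ → ℂ} {f₀ g₀ : ℤ → ℂ} {A B : ℝ} (hf : ∀ S m, ‖f S m‖ ≤ A)
    (hf₀ : ∀ m, Tendsto (fun S => f S m) l (𝓝 (f₀ m))) (hg : ∀ S m, ‖g S m‖ ≤ B)
    (hg₀ : ∀ m, Tendsto (fun S => g S m) l (𝓝 (g₀ m))) (m : ℤ) :
    Tendsto (fun S : Finset ℤ => fibreLower K β (S : Set ℤ) σ (f S) (g S) m) l
      (𝓝 (fibreLower K β Set.univ σ f₀ g₀ m)) := by
  have hf1 := fun S : Finset ℤ => norm_cutConv_le_of_bounded hK (S : Set ℤ) (hf S)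
  have hf2 := fun S : Finset ℤ => norm_cutConv_le_of_bounded hK (S : Set ℤ) (hf1 S)
  have hg1 := fun S : Finset ℤ => norm_cutConv_le_of_bounded hK (S : Set ℤ) (hg S)
  refine ((tendsto_cutConv hK hl hg1 (tendsto_cutConv hK hl hg hg₀) m).const_mul _).add
    ((tendsto_cutConv hK hl hf2 (tendsto_cutConv hK hl hf1 (tendsto_cutConv hK hl hf hf₀))
      m).const_mul _)

/-- Passing to the limit in a family of truncated solutions with uniform bounds. -/
lemma exists_limit_solution {K : ℤ → ℂ} (hK : RapidDecay K) {β σ : ℝ}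
    {V : Finset ℤ → ℕ → ℝ → ℤ → ℂ}
    (hV : ∀ S i t m, HasDerivAt (fun t => V S i t m) (V S (i + 1) t m) t)
    (hrec : ∀ (S : Finset ℤ) t, FibreRec K β S σ fun i => V S i t)
    {G : ℕ → ℝ} (hG : ∀ i, 0 ≤ G i) {k : ℝ} (hk : 0 ≤ k)
    (hbd : ∀ S i t m, ‖V S i t m‖ ≤ G i * Real.exp (k * |t|)) :
    ∃ c : ℕ → ℝ → ℤ → ℂ, (∀ i t m, HasDerivAt (fun t => c i t m) (c (i + 1) t m) t) ∧
      (∀ t, FibreRec K β Set.univ σ fun i => c i t) ∧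
      (∀ i t m, ‖c i t m‖ ≤ G i * Real.exp (k * |t|)) ∧
      ∀ i t a, (∀ S, V S i t = (S : Set ℤ).indicator a) → c i t = a := by
  let l : Ultrafilter (Finset ℤ) := Ultrafilter.of atTop
  have hl : (l : Filter (Finset ℤ)) ≤ atTop := Ultrafilter.of_le atTop
  have hlim : ∀ i t m, ∃ z, Tendsto (fun S => V S i t m) l (𝓝 z) := by
    intro i t m
    obtain ⟨z, -, hz⟩ := (isCompact_closedBall (0 : ℂ) (G i * Real.exp (k * |t|))).ultrafilter_le_nhds
      (l.map fun S => V S i t m) (by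
        rw [le_principal_iff]
        exact Eventually.of_forall (f := (l : Filter (Finset ℤ))) fun S => by
          rw [mem_closedBall_zero_iff]; exact hbd S i t m)
    exact ⟨z, hz⟩
  choose c hc using hlim
  refine ⟨c, fun i t m => ?_, fun t i m => ?_, fun i t m => ?_, fun i t a ha => ?_⟩
  · refine hasDerivAt_of_tendsto_of_bounded (l := (l : Filter (Finset ℤ))) (fun S t => hV S i t m)
      (fun S t => hV S (i + 1) t m) (M := G (i + 2) * Real.exp (k * (|t| + 1)))
      (fun S τ hτ => ?_) (fun t => hc i t m) fun t => hc (i + 1) t m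
    refine (hbd S (i + 2) τ m).trans ?_
    have h1 : |τ| ≤ |t| + 1 := by
      calc |τ| = |t + (τ - t)| := by ring_nf
        _ ≤ |t| + |τ - t| := abs_add_le _ _
        _ ≤ _ := by linarith
    have := hG (i + 2)
    gcongr
  · have h1 : Tendsto (fun S => V S (i + 3) t m) l _ := hc (i + 3) t m
    refine tendsto_nhds_unique h1 ?_
    simp only [show ∀ S : Finset ℤ, V S (i + 3) t m = _ from fun S => hrec S t i m]
    refine Tendsto.sub ?_ (tendsto_fibreLower hK hl β σ (fun S m => hbd S i t m) (hc i t)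
      (fun S m => hbd S (i + 1) t m) (hc (i + 1) t) m)
    exact (((hc (i + 1) t m).const_mul _).const_mul _).neg
  · exact le_of_tendsto (hc i t m).norm (Eventually.of_forall fun S => hbd S i t m)
  · funext m
    refine tendsto_nhds_unique (hc i t m) (tendsto_const_nhds.congr' ?_)
    filter_upwards [hl (eventually_ge_atTop {m})] with S hS
    rw [ha, Set.indicator_of_mem]
    exact_mod_cast hS (Finset.mem_singleton_self m)

end PointwiseLimits

section FibreSolution

/-- Solvability of the fibre problem, uniformly in the parameter. -/
lemma exists_fibre_solution {K : ℤ → ℂ} (hK : RapidDecay K)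
    (hsymm : ∀ j, K (-j) = (starRingEnd ℂ) (K j)) {β : ℝ} (hβ : |β| < 2 / (3 * √3)) :
    ∃ C ≥ (0 : ℝ), ∀ (Y : Type) (L R σ : Y → ℝ), (∀ p, 1 ≤ L p) → (∀ p, 0 ≤ R p) →
      (∀ p, |σ p| ≤ 2 * Real.pi * L p ^ 2) → ∀ a₀ a₁ a₂ : Y → ℤ → ℂ,
      (∀ s, Tame L R s a₀) → (∀ s, Tame L R s a₁) → (∀ s, Tame L R s a₂) →
      ∃ c : Y → ℕ → ℝ → ℤ → ℂ,
        (∀ p i t m, HasDerivAt (fun t => c p i t m) (c p (i + 1) t m) t) ∧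
        (∀ p, c p 0 0 = a₀ p ∧ c p 1 0 = a₁ p ∧ c p 2 0 = a₂ p) ∧
        (∀ p t, FibreRec K β Set.univ (σ p) fun i => c p i t) ∧
        ∀ i s, ∃ G ≥ 0, ∃ P : ℕ, ∀ p t m, |t| ≤ 1 →
          ‖c p i t m‖ * intWeight m ^ s ≤ G * L p ^ P * (R p * Real.exp (C * L p * |t|)) := by
  obtain ⟨C, hC, hV⟩ := exists_uniform_truncated_solution hK hsymm hβ
  refine ⟨C, hC, fun Y L R σ hL hR hσ a₀ a₁ a₂ h₀ h₁ h₂ => ?_⟩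
  obtain ⟨V, hd, hV0, hV1, hV2, hrec, hbd⟩ := hV Y L R σ hL hR hσ a₀ a₁ a₂ h₀ h₁ h₂
  choose G hG P hbd using hbd
  have hL0 : ∀ p, 0 ≤ L p := fun p => by linarith [hL p]
  choose c hcd hcrec hcbd hcinit using fun p => exists_limit_solution hK
    (fun S i t m => hd S p i t m) (fun S t => hrec S p t)
    (G := fun i => G i * L p ^ P i * R p)
    (fun i => mul_nonneg (mul_nonneg (hG i) (pow_nonneg (hL0 p) _)) (hR p))
    (mul_nonneg hC (hL0 p))
    (fun S i t m => (hbd i S p t m).trans (le_of_eq (by ring)))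
  have hinit : ∀ p, c p 0 0 = a₀ p ∧ c p 1 0 = a₁ p ∧ c p 2 0 = a₂ p := fun p =>
    ⟨hcinit p 0 0 _ fun S => hV0 S p, hcinit p 1 0 _ fun S => hV1 S p,
      hcinit p 2 0 _ fun S => hV2 S p⟩
  refine ⟨c, hcd, hinit, hcrec, ?_⟩
  let T := {t : ℝ // |t| ≤ 1}
  let L' : Y × T → ℝ := fun q => L q.1
  let R' : Y × T → ℝ := fun q => R q.1 * Real.exp (C * L q.1 * |(q.2 : ℝ)|)
  let F : ℕ → Y × T → ℤ → ℂ := fun i q => c q.1 i q.2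
  have hR' : ∀ q, 0 ≤ R' q := fun q => mul_nonneg (hR _) (Real.exp_nonneg _)
  have base : ∀ i, Tame L' R' 0 (F i) := fun i => ⟨G i, hG i, P i, fun q m => by
    rw [pow_zero, mul_one]
    exact (hcbd q.1 i q.2 m).trans (le_of_eq (by ring))⟩
  have step : ∀ s, (∀ i, Tame L' R' s (F i)) → ∀ i, Tame L' R' (s + 2) (F i) := by
    intro s ih
    have hsucc : ∀ i, Tame L' R' (s + 2) (F (i + 1)) :=
      Tame.gain_two (Q := Y × T) hK (fun q => hL q.1) hR' (fun q => hσ q.1)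
        (fun q => hcrec q.1 q.2) ih
    intro i
    match i with
    | i + 1 => exact hsucc i
    | 0 =>
      obtain ⟨A, hA, k, h1⟩ := hsucc 0
      obtain ⟨B, hB, k', h2⟩ := h₀ (s + 2)
      have h3 : ∀ (q : Y × T) m, ‖F 0 q m‖ * intWeight m ^ (s + 2)
          ≤ B * L q.1 ^ k' * R q.1 + A * L q.1 ^ k * R' q := by
        rintro ⟨p, t, ht⟩ m
        have hw : 0 < intWeight m ^ (s + 2) := pow_pos (intWeight_pos m) _
        have h4 : ∀ τ ∈ Set.uIcc 0 t, ‖c p 1 τ m‖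
            ≤ A * L p ^ k * (R p * Real.exp (C * L p * |t|)) / intWeight m ^ (s + 2) := by
          intro τ hτ
          have hτt : |τ| ≤ |t| := by simpa using Set.abs_sub_left_of_mem_uIcc hτ
          rw [le_div_iff₀ hw]
          refine (h1 (p, ⟨τ, hτt.trans ht⟩) m).trans ?_
          have h5 := hL0 p
          have h6 := hR p
          show A * L p ^ k * (R p * Real.exp (C * L p * |τ|)) ≤ _
          gcongr
        have h5 := Convex.norm_image_sub_le_of_norm_hasDerivWithin_le
          (fun x _ => (hcd p 0 x m).hasDerivWithinAt) h4 (convex_uIcc 0 t)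
          Set.left_mem_uIcc Set.right_mem_uIcc
        simp only [(hinit p).1, sub_zero, Real.norm_eq_abs] at h5
        have h6 : 0 ≤ A * L p ^ k * (R p * Real.exp (C * L p * |t|)) / intWeight m ^ (s + 2) :=
          (norm_nonneg _).trans (h4 0 Set.left_mem_uIcc)
        have h7 : ‖c p 0 t m - a₀ p m‖ * intWeight m ^ (s + 2)
            ≤ A * L p ^ k * (R p * Real.exp (C * L p * |t|)) := by
          rw [← le_div_iff₀ hw]
          exact h5.trans (mul_le_of_le_one_right h6 ht)
        have h8 : ‖c p 0 t m‖ ≤ ‖a₀ p m‖ + ‖c p 0 t m - a₀ p m‖ := by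
          calc ‖c p 0 t m‖ = ‖a₀ p m + (c p 0 t m - a₀ p m)‖ := by rw [add_sub_cancel]
            _ ≤ _ := norm_add_le _ _
        show ‖c p 0 t m‖ * intWeight m ^ (s + 2)
          ≤ B * L p ^ k' * R p + A * L p ^ k * (R p * Real.exp (C * L p * |t|))
        nlinarith [h2 p m]
      have h4 : PolyBdd L' R' fun q => B * L q.1 ^ k' * R q.1 := by
        refine ⟨B, hB, k', fun q => ?_⟩
        have h5 := hL0 q.1
        have h6 := hR q.1
        have h7 : R q.1 ≤ R' q := le_mul_of_one_le_right h6 (Real.one_le_exp (by positivity))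
        exact mul_le_mul_of_nonneg_left h7 (by positivity)
      obtain ⟨B', hB', k'', h5⟩ := h4.add (fun q => hL q.1) hR'
        (Y := fun q => A * L q.1 ^ k * R' q) ⟨A, hA, k, fun q => le_rfl⟩
      exact ⟨B', hB', k'', fun q m => (h3 q m).trans (h5 q)⟩
  have all : ∀ n i, Tame L' R' (2 * n) (F i) := by
    intro n
    induction n with
    | zero => exact base
    | succ n ih => exact step _ ih
  intro i s
  obtain ⟨A, hA, k, h⟩ := (all s i).mono (show s ≤ 2 * s by omega)
  exact ⟨A, hA, k, fun p t m ht => h (p, ⟨t, ht⟩) m⟩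

end FibreSolution

section WaveSeries

open scoped ContDiff

variable {r : ℕ}

/-- A vector in a fixed finite dimensional space is determined by its values on the basis. -/
lemma clm_eq_sum_smulRight {N : ℕ} (A : (Fin N → ℝ) →L[ℝ] ℂ) :
    A = ∑ j, (ContinuousLinearMap.proj (R := ℝ) (φ := fun _ : Fin N => ℝ) j).smulRight
      (A (Pi.single j 1)) := by
  ext x
  simp only [sum_apply, ContinuousLinearMap.smulRight_apply, ContinuousLinearMap.proj_apply,
    ← map_smul, ← map_sum]
  congr 1
  conv_lhs => rw [← Finset.univ_sum_single x]
  refine Finset.sum_congr rfl fun j _ => ?_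
  rw [← Pi.single_smul, smul_eq_mul, mul_one]

/-- The weight `1 + ∑ |μ_j|` on multi-indices. -/
noncomputable def multiWeight {N : ℕ} (μ : Fin N → ℤ) : ℝ := 1 + ∑ j, |(μ j : ℝ)|

lemma one_le_multiWeight {N : ℕ} (μ : Fin N → ℤ) : 1 ≤ multiWeight μ := by
  unfold multiWeight
  linarith [Finset.sum_nonneg (s := Finset.univ) fun (j : Fin N) _ => abs_nonneg (μ j : ℝ)]

lemma abs_le_multiWeight {N : ℕ} (μ : Fin N → ℤ) (j : Fin N) : |(μ j : ℝ)| ≤ multiWeight μ := by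
  unfold multiWeight
  linarith [Finset.single_le_sum (fun (j : Fin N) _ => abs_nonneg (μ j : ℝ)) (Finset.mem_univ j)]

/-- Coefficient families, together with their time derivatives, that are summable against all
powers of the frequency, uniformly for `|t| < T`. -/
structure Admissible (T : ℝ) (g : ℕ → ℝ → (Fin r → ℤ) → ℂ) : Prop where
  deriv : ∀ i t μ, HasDerivAt (fun t => g i t μ) (g (i + 1) t μ) t
  bound : ∀ i k, ∃ u : (Fin r → ℤ) → ℝ, Summable u ∧
    ∀ t μ, |t| < T → ‖g i t μ‖ * multiWeight μ ^ k ≤ u μ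

/-- The function with coefficients `g 0`. -/
noncomputable def waveSeries (g : ℕ → ℝ → (Fin r → ℤ) → ℂ) (x : Fin (r + 1) → ℝ) : ℂ :=
  ∑' μ, g 0 (x 0) μ * wave (Fin.cons 0 μ) x

/-- The coefficients of a partial derivative of the series. -/
noncomputable def derivFamily (g : ℕ → ℝ → (Fin r → ℤ) → ℂ) (j : Fin (r + 1)) :
    ℕ → ℝ → (Fin r → ℤ) → ℂ :=
  Fin.cases (fun i => g (i + 1)) (fun j i t μ => 2 * Real.pi * I * μ j * g i t μ) j

namespace Admissible

variable {T : ℝ} {g : ℕ → ℝ → (Fin r → ℤ) → ℂ}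

lemma derivFamily (hg : Admissible T g) (j : Fin (r + 1)) : Admissible T (derivFamily g j) := by
  cases j using Fin.cases with
  | zero => exact ⟨fun i => hg.deriv (i + 1), fun i => hg.bound (i + 1)⟩
  | succ j =>
    refine ⟨fun i t μ => (hg.deriv i t μ).const_mul _, fun i k => ?_⟩
    obtain ⟨u, hu, h⟩ := hg.bound i (k + 1)
    refine ⟨fun μ => 2 * Real.pi * u μ, hu.mul_left _, fun t μ ht => ?_⟩
    have h1 : ‖(2 * Real.pi * I * μ j : ℂ)‖ ≤ 2 * Real.pi * multiWeight μ := by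
      simp only [norm_mul, Complex.norm_ofNat, Complex.norm_real, Real.norm_eq_abs,
        abs_of_pos Real.pi_pos, Complex.norm_intCast, Complex.norm_I, mul_one]
      gcongr
      exact abs_le_multiWeight μ j
    have h2 := one_le_multiWeight μ
    show ‖2 * Real.pi * I * μ j * g i t μ‖ * multiWeight μ ^ k ≤ _
    calc _ ≤ 2 * Real.pi * multiWeight μ * ‖g i t μ‖ * multiWeight μ ^ k := by
          rw [norm_mul]; gcongr
      _ = 2 * Real.pi * (‖g i t μ‖ * multiWeight μ ^ (k + 1)) := by ring
      _ ≤ _ := mul_le_mul_of_nonneg_left (h t μ ht) (by positivity)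

lemma summable (hg : Admissible T g) {x : Fin (r + 1) → ℝ} (hx : |x 0| < T) :
    Summable fun μ => g 0 (x 0) μ * wave (Fin.cons 0 μ) x := by
  obtain ⟨u, hu, h⟩ := hg.bound 0 0
  refine Summable.of_norm_bounded hu fun μ => ?_
  rw [norm_mul, norm_wave]
  simpa using h _ μ hx

lemma hasFDerivAt_term (hg : Admissible T g) (μ : Fin r → ℤ) (x : Fin (r + 1) → ℝ) :
    HasFDerivAt (fun x : Fin (r + 1) → ℝ => g 0 (x 0) μ * wave (Fin.cons 0 μ) x)
      (∑ j, (ContinuousLinearMap.proj (R := ℝ) (φ := fun _ : Fin (r + 1) => ℝ) j).smulRight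
        (_root_.derivFamily g j 0 (x 0) μ * wave (Fin.cons 0 μ) x)) x := by
  have h1 := HasFDerivAt.comp (g := fun t => g 0 t μ) x (hg.deriv 0 (x 0) μ).hasFDerivAt
    (hasFDerivAt_apply (𝕜 := ℝ) (0 : Fin (r + 1)) x)
  have h2 : HasFDerivAt (wave (Fin.cons 0 μ)) _ x :=
    ((contDiff_wave (Fin.cons 0 μ)).differentiable (by simp)).differentiableAt.hasFDerivAt
  have h3 := h1.mul h2
  rw [clm_eq_sum_smulRight (_ + _)] at h3
  refine h3.congr_fderiv (Finset.sum_congr rfl fun j _ => ?_)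
  congr 1
  have h4 : fderiv ℝ (wave (Fin.cons 0 μ)) x (Pi.single j 1)
      = 2 * Real.pi * I * (Fin.cons 0 μ : Fin (r + 1) → ℤ) j * wave (Fin.cons 0 μ) x := pd_wave _ j x
  cases j using Fin.cases with
  | zero => simp [h4, _root_.derivFamily, mul_comm]
  | succ j =>
    simp [h4, _root_.derivFamily]
    ring

lemma hasFDerivAt (hg : Admissible T g) {x : Fin (r + 1) → ℝ} (hx : |x 0| < T) :
    HasFDerivAt (waveSeries g)
      (∑ j, (ContinuousLinearMap.proj (R := ℝ) (φ := fun _ : Fin (r + 1) => ℝ) j).smulRight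
        (waveSeries (_root_.derivFamily g j) x)) x := by
  choose u hu hb using fun j => (hg.derivFamily j).bound 0 0
  have hs : IsOpen {x : Fin (r + 1) → ℝ | |x 0| < T} :=
    isOpen_lt (continuous_abs.comp (continuous_apply 0)) continuous_const
  have hc : Convex ℝ {x : Fin (r + 1) → ℝ | |x 0| < T} := by
    have : {x : Fin (r + 1) → ℝ | |x 0| < T}
        = (LinearMap.proj (R := ℝ) (φ := fun _ : Fin (r + 1) => ℝ) 0) ⁻¹' Metric.ball 0 T := by
      ext x; simp
    rw [this]
    exact (convex_ball (0 : ℝ) T).linear_preimage _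
  have hn : ∀ j : Fin (r + 1), ∀ z : ℂ,
      ‖(ContinuousLinearMap.proj (R := ℝ) (φ := fun _ : Fin (r + 1) => ℝ) j).smulRight z‖ ≤ ‖z‖ := by
    intro j z
    refine ContinuousLinearMap.opNorm_le_bound _ (norm_nonneg _) fun x => ?_
    rw [ContinuousLinearMap.smulRight_apply, norm_smul, mul_comm]
    exact mul_le_mul_of_nonneg_left (norm_le_pi_norm x j) (norm_nonneg _)
  have key := hasFDerivAt_tsum_of_isPreconnected (u := fun μ => ∑ j, u j μ)
    (summable_sum fun j _ => hu j) hs hc.isPreconnected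
    (fun μ x _ => hg.hasFDerivAt_term μ x) (fun μ x hx => ?_) hx (hg.summable hx) hx
  · refine key.congr_fderiv ?_
    rw [Summable.tsum_finsetSum]
    · refine Finset.sum_congr rfl fun j _ => ?_
      have h1 := ((hg.derivFamily j).summable hx).hasSum
      have h2 := h1.mapL ((ContinuousLinearMap.smulRightL ℝ (Fin (r + 1) → ℝ) ℂ
        (ContinuousLinearMap.proj (R := ℝ) (φ := fun _ : Fin (r + 1) => ℝ) j)))
      exact h2.tsum_eq
    · intro j _
      refine Summable.of_norm_bounded (hu j) fun μ => (hn j _).trans ?_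
      rw [norm_mul, norm_wave]
      simpa using hb j _ μ hx
  · refine (norm_sum_le _ _).trans (Finset.sum_le_sum fun j _ => (hn j _).trans ?_)
    rw [norm_mul, norm_wave]
    simpa using hb j _ μ hx

lemma pd_waveSeries (hg : Admissible T g) (j : Fin (r + 1)) {x : Fin (r + 1) → ℝ}
    (hx : |x 0| < T) : pd j (waveSeries g) x = waveSeries (_root_.derivFamily g j) x := by
  rw [pd, (hg.hasFDerivAt hx).fderiv, sum_apply, Finset.sum_eq_single j]
  · simp
  · intro i _ h; simp [h]
  · simp

lemma contDiffOn (hg : Admissible T g) :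
    ContDiffOn ℝ ∞ (waveSeries g) {x : Fin (r + 1) → ℝ | |x 0| < T} := by
  have hs : IsOpen {x : Fin (r + 1) → ℝ | |x 0| < T} :=
    isOpen_lt (continuous_abs.comp (continuous_apply 0)) continuous_const
  rw [contDiffOn_infty]
  intro n
  induction n generalizing g with
  | zero =>
    rw [Nat.cast_zero, contDiffOn_zero]
    exact fun x hx => (hg.hasFDerivAt hx).continuousAt.continuousWithinAt
  | succ n ih =>
    push_cast
    rw [contDiffOn_succ_iff_fderiv_of_isOpen hs]
    refine ⟨fun x hx => (hg.hasFDerivAt hx).differentiableAt.differentiableWithinAt, by simp, ?_⟩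
    have h1 : ContDiffOn ℝ n (fun x => ∑ j : Fin (r + 1), (ContinuousLinearMap.smulRightL ℝ
        (Fin (r + 1) → ℝ) ℂ (ContinuousLinearMap.proj (R := ℝ) (φ := fun _ : Fin (r + 1) => ℝ) j))
        (waveSeries (_root_.derivFamily g j) x)) {x : Fin (r + 1) → ℝ | |x 0| < T} :=
      ContDiffOn.sum fun j _ =>
        (ContinuousLinearMap.contDiff _).comp_contDiffOn (ih (hg.derivFamily j))
    exact h1.congr fun x hx => (hg.hasFDerivAt hx).fderiv

end Admissible

end WaveSeries

section StretchedExponentials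

lemma exists_intWeight_pow_mul_exp_le {a : ℝ} (ha : 0 < a) (k : ℕ) :
    ∃ A ≥ 0, ∀ n : ℤ, intWeight n ^ k * Real.exp (-a * Real.sqrt |(n : ℝ)|) ≤ A := by
  refine ⟨(2 * k).factorial * Real.exp a / a ^ (2 * k), by positivity, fun n => ?_⟩
  set y := Real.sqrt |(n : ℝ)| with hy
  have hy0 : 0 ≤ y := Real.sqrt_nonneg _
  have h1 : intWeight n ≤ (1 + y) ^ 2 := by
    have : y ^ 2 = |(n : ℝ)| := Real.sq_sqrt (abs_nonneg _)
    unfold intWeight; nlinarith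
  have h2 := Real.pow_div_factorial_le_exp (a * (1 + y)) (by positivity) (2 * k)
  rw [div_le_iff₀ (by positivity), mul_pow] at h2
  have h3 : Real.exp (a * (1 + y)) * Real.exp (-a * y) = Real.exp a := by
    rw [← Real.exp_add]; congr 1; ring
  rw [le_div_iff₀ (by positivity)]
  calc intWeight n ^ k * Real.exp (-a * y) * a ^ (2 * k)
      ≤ ((1 + y) ^ 2) ^ k * Real.exp (-a * y) * a ^ (2 * k) := by
        have := (intWeight_pos n).le; gcongr
    _ = (a ^ (2 * k) * (1 + y) ^ (2 * k)) * Real.exp (-a * y) := by rw [← pow_mul]; ring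
    _ ≤ Real.exp (a * (1 + y)) * (2 * k).factorial * Real.exp (-a * y) := by gcongr
    _ = (2 * k).factorial * (Real.exp (a * (1 + y)) * Real.exp (-a * y)) := by ring
    _ = _ := by rw [h3]

lemma summable_of_norm_mul_sq_le {f : ℤ → ℂ} {B : ℝ} (h : ∀ m, ‖f m‖ * intWeight m ^ 2 ≤ B) :
    Summable fun m => ‖f m‖ := by
  refine Summable.of_nonneg_of_le (fun _ => norm_nonneg _) (fun m => ?_)
    (summable_intWeight.mul_left B)
  have := intWeight_pos m
  rw [← div_eq_mul_inv, le_div_iff₀ (by positivity)]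
  exact h m

lemma rapidDecay_of_le_exp {K : ℤ → ℂ} {C c : ℝ} (hc : 0 < c) (hC : 0 ≤ C)
    (h : ∀ j, ‖K j‖ ≤ C * Real.exp (-c * Real.sqrt |(j : ℝ)|)) : RapidDecay K := by
  intro s
  obtain ⟨A, hA, hb⟩ := exists_intWeight_pow_mul_exp_le hc (s + 2)
  have := summable_of_norm_mul_sq_le (f := fun j => ((‖K j‖ * intWeight j ^ s : ℝ) : ℂ))
    (B := C * A) fun m => ?_
  · refine this.congr fun j => ?_
    rw [Complex.norm_real, Real.norm_of_nonneg]
    exact mul_nonneg (norm_nonneg _) (pow_nonneg (intWeight_pos j).le s)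
  · have hw := (intWeight_pos m).le
    rw [Complex.norm_real, Real.norm_of_nonneg (by positivity)]
    calc ‖K m‖ * intWeight m ^ s * intWeight m ^ 2
        ≤ C * Real.exp (-c * Real.sqrt |(m : ℝ)|) * intWeight m ^ s * intWeight m ^ 2 := by
          gcongr; exact h m
      _ = C * (intWeight m ^ (s + 2) * Real.exp (-c * Real.sqrt |(m : ℝ)|)) := by ring
      _ ≤ C * A := by gcongr; exact hb m

lemma multiWeight_cons_le {r : ℕ} (m : ℤ) (ν : Fin r → ℤ) :
    multiWeight (Fin.cons m ν : Fin (r + 1) → ℤ) ≤ intWeight m * multiWeight ν := by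
  unfold multiWeight intWeight
  rw [Fin.sum_univ_succ]
  simp only [Fin.cons_zero, Fin.cons_succ]
  have h1 := abs_nonneg (m : ℝ)
  have h2 : 0 ≤ ∑ j, |(ν j : ℝ)| := Finset.sum_nonneg fun j _ => abs_nonneg _
  nlinarith

lemma sqrtSum_cons {r : ℕ} (m : ℤ) (ν : Fin r → ℤ) :
    sqrtSum (Fin.cons m ν : Fin (r + 1) → ℤ) = Real.sqrt |(m : ℝ)| + sqrtSum ν := by
  unfold sqrtSum
  rw [Fin.sum_univ_succ]
  simp only [Fin.cons_zero, Fin.cons_succ]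

lemma summable_cons {r : ℕ} {u : ℤ → ℝ} {v : (Fin r → ℤ) → ℝ} (hu : Summable u) (hv : Summable v)
    (hu0 : ∀ m, 0 ≤ u m) (hv0 : ∀ ν, 0 ≤ v ν) :
    Summable fun μ : Fin (r + 1) → ℤ => u (μ 0) * v (Fin.tail μ) := by
  rw [← (Fin.consEquiv fun _ : Fin (r + 1) => ℤ).summable_iff]
  have := hu.mul_of_nonneg hv hu0 hv0
  exact this

lemma summable_multiWeight_mul_exp {a : ℝ} (ha : 0 < a) (k r : ℕ) :
    Summable fun ν : Fin r → ℤ => multiWeight ν ^ k * Real.exp (-a * sqrtSum ν) := by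
  induction r with
  | zero => exact Summable.of_finite
  | succ r ih =>
    have h1 : Summable fun m : ℤ => intWeight m ^ k * Real.exp (-a * Real.sqrt |(m : ℝ)|) := by
      have := rapidDecay_of_le_exp (K := fun j => (Real.exp (-a * Real.sqrt |(j : ℝ)|) : ℂ)) ha
        zero_le_one (fun j => by
          rw [Complex.norm_real, Real.norm_of_nonneg (Real.exp_nonneg _), one_mul]) k
      refine this.congr fun j => ?_
      beta_reduce
      rw [Complex.norm_real, Real.norm_of_nonneg (Real.exp_nonneg _), mul_comm]
    have hw : ∀ ν : Fin r → ℤ, 0 ≤ multiWeight ν := fun ν => by linarith [one_le_multiWeight ν]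
    refine Summable.of_nonneg_of_le (fun ν => ?_) (fun ν => ?_) (summable_cons h1 ih
      (fun m => mul_nonneg (pow_nonneg (intWeight_pos m).le k) (Real.exp_nonneg _))
      fun ν => mul_nonneg (pow_nonneg (hw ν) k) (Real.exp_nonneg _))
    · exact mul_nonneg (pow_nonneg (by linarith [one_le_multiWeight ν]) k) (Real.exp_nonneg _)
    · obtain ⟨m, ν, rfl⟩ : ∃ m ν', ν = Fin.cons m ν' := ⟨ν 0, Fin.tail ν, (Fin.cons_self_tail ν).symm⟩
      rw [sqrtSum_cons, Fin.cons_zero, Fin.tail_cons, mul_add, Real.exp_add]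
      have h2 : 0 ≤ multiWeight (Fin.cons m ν : Fin (r + 1) → ℤ) := by
        linarith [one_le_multiWeight (Fin.cons m ν : Fin (r + 1) → ℤ)]
      calc _ ≤ (intWeight m * multiWeight ν) ^ k * (Real.exp (-a * Real.sqrt |(m : ℝ)|) *
            Real.exp (-a * sqrtSum ν)) := by gcongr; exact multiWeight_cons_le m ν
        _ = _ := by ring

end StretchedExponentials

section ConvolutionMultiplication

/-- The exponential `x ↦ exp (2πi m x)`. -/
noncomputable def expWave (x : ℝ) (m : ℤ) : ℂ := cexp (2 * Real.pi * I * m * x)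

lemma norm_expWave (x : ℝ) (m : ℤ) : ‖expWave x m‖ = 1 := by
  have : (2 * Real.pi * I * m * x : ℂ) = ((2 * Real.pi * m * x : ℝ) : ℂ) * I := by
    push_cast; ring
  rw [expWave, this, Complex.norm_exp_ofReal_mul_I]

lemma expWave_add (x : ℝ) (m n : ℤ) : expWave x (m + n) = expWave x m * expWave x n := by
  unfold expWave
  rw [← Complex.exp_add]
  congr 1
  push_cast; ring

/-- The bijection `(m, j) ↦ (j, m - j)`. -/
def diagonalEquiv : ℤ × ℤ ≃ ℤ × ℤ where
  toFun p := (p.2, p.1 - p.2)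
  invFun p := (p.1 + p.2, p.1)
  left_inv p := by simp
  right_inv p := by simp

lemma hasSum_mul_prod {u v : ℤ → ℂ} {X Y : ℂ} (hu : HasSum u X) (hv : HasSum v Y)
    (hu' : Summable fun j => ‖u j‖) (hv' : Summable fun j => ‖v j‖) :
    HasSum (fun p : ℤ × ℤ => u p.1 * v p.2) (X * Y) := by
  have := summable_mul_of_summable_norm hu' hv'
  exact hu.mul hv this

lemma hasSum_cutConv_mul_expWave {K f : ℤ → ℂ} (hK : RapidDecay K) {B : ℝ}
    (hf : ∀ m, ‖f m‖ * intWeight m ^ 2 ≤ B) {x : ℝ} {X Y : ℂ}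
    (hX : HasSum (fun j => K j * expWave x j) X) (hY : HasSum (fun m => f m * expWave x m) Y) :
    HasSum (fun m => cutConv K Set.univ f m * expWave x m) (X * Y) := by
  have hK0 : Summable fun j => ‖K j * expWave x j‖ := by
    simpa [norm_expWave] using hK 0
  have hf0 : Summable fun j => ‖f j * expWave x j‖ := by
    simpa [norm_expWave] using summable_of_norm_mul_sq_le hf
  have h1 : HasSum (fun p : ℤ × ℤ => (K p.1 * expWave x p.1) * (f p.2 * expWave x p.2)) (X * Y) :=
    by have := hasSum_mul_prod hX hY hK0 hf0; exact this
  have h2 : HasSum (fun p : ℤ × ℤ => (K p.2 * expWave x p.2) *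
      (f (p.1 - p.2) * expWave x (p.1 - p.2))) (X * Y) :=
    (diagonalEquiv.hasSum_iff (f := fun p : ℤ × ℤ =>
      (K p.1 * expWave x p.1) * (f p.2 * expWave x p.2))).2 h1
  refine h2.prod_fiberwise fun m => ?_
  have hf' : ∀ m, ‖f m‖ * intWeight m ^ 0 ≤ B := fun m =>
    (mul_le_mul_of_nonneg_left (pow_le_pow_right₀ (one_le_intWeight m) zero_le_two)
      (norm_nonneg _)).trans (hf m)
  have h3 : Summable fun j => K j * f (m - j) := by
    refine Summable.of_norm_bounded ((hK 0).mul_right B) fun j => ?_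
    simpa using norm_conv_term_le (K := K) hf' m j
  have h4 := h3.hasSum.mul_right (expWave x m)
  rw [cutConv, Set.indicator_univ]
  refine h4.congr_fun fun j => ?_
  have h5 : expWave x m = expWave x j * expWave x (m - j) := by
    rw [← expWave_add, add_sub_cancel]
  simp only [h5]; ring

/-- On the Fourier side, the fibre equation is the equation
`c''' = -(2πm)² c' - σ² x² c' - iβσ³ x³ c`. -/
lemma fibreRec_sum {K : ℤ → ℂ} (hK : RapidDecay K) {β σ x : ℝ} {f : ℕ → ℤ → ℂ} {B : ℕ → ℝ}
    (hX : HasSum (fun j => K j * expWave x j) x)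
    (hf : ∀ i m, ‖f i m‖ * intWeight m ^ 2 ≤ B i) (hrec : FibreRec K β Set.univ σ f) :
    ∑' m, (f 3 m + (2 * Real.pi * m) * (2 * Real.pi * m * f 1 m)
      + (σ : ℂ) ^ 2 * (x : ℂ) ^ 2 * f 1 m + I * β * (σ : ℂ) ^ 3 * (x : ℂ) ^ 3 * f 0 m)
        * expWave x m = 0 := by
  have hs : ∀ i, HasSum (fun m => f i m * expWave x m) (∑' m, f i m * expWave x m) := fun i =>
    (Summable.of_norm (by simpa [norm_expWave] using summable_of_norm_mul_sq_le (hf i))).hasSum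
  have b1 := norm_cutConv_le hK Set.univ (hf 1)
  have b0 := norm_cutConv_le hK Set.univ (hf 0)
  have b00 := norm_cutConv_le hK Set.univ b0
  have h1 := hasSum_cutConv_mul_expWave hK b1 hX (hasSum_cutConv_mul_expWave hK (hf 1) hX (hs 1))
  have h0 := hasSum_cutConv_mul_expWave hK b00 hX
    (hasSum_cutConv_mul_expWave hK b0 hX (hasSum_cutConv_mul_expWave hK (hf 0) hX (hs 0)))
  have key := ((((hs 1).mul_left ((σ : ℂ) ^ 2 * (x : ℂ) ^ 2)).add
    ((hs 0).mul_left (I * β * (σ : ℂ) ^ 3 * (x : ℂ) ^ 3))).sub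
      (h1.mul_left ((σ : ℂ) ^ 2))).sub (h0.mul_left (I * β * (σ : ℂ) ^ 3))
  have := key.tsum_eq
  rw [show ∀ X Y : ℂ, (σ : ℂ) ^ 2 * (x : ℂ) ^ 2 * X + I * β * (σ : ℂ) ^ 3 * (x : ℂ) ^ 3 * Y
    - (σ : ℂ) ^ 2 * (x * (x * X)) - I * β * (σ : ℂ) ^ 3 * (x * (x * (x * Y))) = 0
    from fun X Y => by ring] at this
  rw [← this]
  refine tsum_congr fun m => ?_
  rw [show f 3 m = _ from hrec 0 m, fibreLower]
  ring

end ConvolutionMultiplication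

section Operator

variable {r d : ℕ} {T : ℝ}

/-- The coefficients of `Dop j` of a series. -/
noncomputable def dopFamily (g : ℕ → ℝ → (Fin r → ℤ) → ℂ) (j : Fin (r + 1)) :
    ℕ → ℝ → (Fin r → ℤ) → ℂ :=
  fun i t μ => -I * derivFamily g j i t μ

lemma Admissible.dopFamily {g : ℕ → ℝ → (Fin r → ℤ) → ℂ} (hg : Admissible T g) (j : Fin (r + 1)) :
    Admissible T (dopFamily g j) where
  deriv i t μ := ((hg.derivFamily j).deriv i t μ).const_mul _
  bound i k := by
    obtain ⟨u, hu, h⟩ := (hg.derivFamily j).bound i k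
    refine ⟨u, hu, fun t μ ht => ?_⟩
    have := h t μ ht
    simpa [_root_.dopFamily] using this

lemma dopFamily_zero (g : ℕ → ℝ → (Fin r → ℤ) → ℂ) (i : ℕ) (t : ℝ) (μ : Fin r → ℤ) :
    dopFamily g 0 i t μ = -I * g (i + 1) t μ := rfl

lemma dopFamily_succ (g : ℕ → ℝ → (Fin r → ℤ) → ℂ) (j : Fin r) (i : ℕ) (t : ℝ) (μ : Fin r → ℤ) :
    dopFamily g j.succ i t μ = 2 * Real.pi * μ j * g i t μ := by
  have : dopFamily g j.succ i t μ = -I * (2 * Real.pi * I * μ j * g i t μ) := rfl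
  rw [this]
  linear_combination (-(2 * Real.pi * μ j * g i t μ : ℂ)) * I_mul_I

lemma isOpen_abs_zero_lt (T : ℝ) : IsOpen {x : Fin (r + 1) → ℝ | |x 0| < T} :=
  isOpen_lt (continuous_apply 0).abs continuous_const

lemma eqOn_dop_waveSeries {g : ℕ → ℝ → (Fin r → ℤ) → ℂ} (hg : Admissible T g)
    {f : (Fin (r + 1) → ℝ) → ℂ} (hf : Set.EqOn f (waveSeries g) {x | |x 0| < T})
    (j : Fin (r + 1)) :
    Set.EqOn (Dop j f) (waveSeries (dopFamily g j)) {x | |x 0| < T} := by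
  intro x hx
  have h1 : fderiv ℝ f x = fderiv ℝ (waveSeries g) x :=
    (hf.eventuallyEq_of_mem ((isOpen_abs_zero_lt T).mem_nhds hx)).fderiv_eq
  have h2 : pd j f x = waveSeries (derivFamily g j) x := by
    rw [← hg.pd_waveSeries j hx, pd, pd, h1]
  show -I * pd j f x = _
  rw [h2, waveSeries, waveSeries, ← tsum_mul_left]
  simp only [dopFamily, mul_assoc]

/-- The symbol of the operator on the coefficients of a series. -/
noncomputable def popCoeff (b x : ℝ) (g : ℕ → (Fin (d + 2) → ℤ) → ℂ) (μ : Fin (d + 2) → ℤ) : ℂ :=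
  g 3 μ + (2 * Real.pi * μ 0) * (2 * Real.pi * μ 0 * g 1 μ)
    + ((2 * Real.pi * μ (Fin.last (d + 1)) : ℝ) : ℂ) ^ 2 * (x : ℂ) ^ 2 * g 1 μ
    + I * b * ((2 * Real.pi * μ (Fin.last (d + 1)) : ℝ) : ℂ) ^ 3 * (x : ℂ) ^ 3 * g 0 μ

lemma hasSum_pop_waveSeries {g : ℕ → ℝ → (Fin (d + 2) → ℤ) → ℂ} (hg : Admissible T g) (b : ℝ)
    {x : Fin (d + 3) → ℝ} (hx : |x 0| < T) :
    HasSum (fun μ => I * (popCoeff b (x 1) (fun i => g i (x 0)) μ * wave (Fin.cons 0 μ) x))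
      (Pop (d + 2) b (waveSeries g) x) := by
  have e0 : Set.EqOn (waveSeries g) (waveSeries g) {x | |x 0| < T} := fun _ _ => rfl
  have hx' : x ∈ {x : Fin (d + 3) → ℝ | |x 0| < T} := hx
  set n : Fin (d + 3) := Fin.last (d + 2) with hn
  have a0 := hg.dopFamily 0
  have f0 := eqOn_dop_waveSeries hg e0 0
  have an := hg.dopFamily n
  have fn := eqOn_dop_waveSeries hg e0 n
  have h000 := eqOn_dop_waveSeries (a0.dopFamily 0) (eqOn_dop_waveSeries a0 f0 0) 0 hx'
  have h110 := eqOn_dop_waveSeries (a0.dopFamily 1) (eqOn_dop_waveSeries a0 f0 1) 1 hx'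
  have hnn0 := eqOn_dop_waveSeries (a0.dopFamily n) (eqOn_dop_waveSeries a0 f0 n) n hx'
  have hnnn := eqOn_dop_waveSeries (an.dopFamily n) (eqOn_dop_waveSeries an fn n) n hx'
  have s000 := (((a0.dopFamily 0).dopFamily 0).summable hx).hasSum
  have s110 := (((a0.dopFamily 1).dopFamily 1).summable hx).hasSum
  have snn0 := (((a0.dopFamily n).dopFamily n).summable hx).hasSum
  have snnn := (((an.dopFamily n).dopFamily n).summable hx).hasSum
  have key := (s000.sub (s110.add (snn0.mul_left ((x 1 : ℂ) ^ 2)))).sub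
    (snnn.mul_left ((b : ℂ) * (x 1 : ℂ) ^ 3))
  rw [Pop, h000, h110, hnn0, hnnn]
  refine key.congr_fun fun μ => ?_
  have h1 : ∀ (g : ℕ → ℝ → (Fin (d + 2) → ℤ) → ℂ) i t,
      dopFamily g 1 i t μ = 2 * Real.pi * μ 0 * g i t μ := fun g i t => dopFamily_succ g 0 i t μ
  have h2 : ∀ (g : ℕ → ℝ → (Fin (d + 2) → ℤ) → ℂ) i t,
      dopFamily g n i t μ = 2 * Real.pi * μ (Fin.last (d + 1)) * g i t μ :=
    fun g i t => dopFamily_succ g (Fin.last (d + 1)) i t μ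
  simp only [dopFamily_zero, h1, h2, popCoeff]
  push_cast
  ring_nf
  simp only [I_sq, I_pow_three]
  ring

lemma wave_cons_cons (m : ℤ) (ν : Fin (d + 1) → ℤ) (x : Fin (d + 3) → ℝ) :
    wave (Fin.cons 0 (Fin.cons m ν : Fin (d + 2) → ℤ)) x = expWave (x 1) m *
      wave (Fin.cons 0 (Fin.cons 0 ν : Fin (d + 2) → ℤ)) x := by
  unfold wave expWave
  rw [← Complex.exp_add]
  congr 1
  simp only [Fin.sum_univ_succ, Fin.cons_zero, Fin.cons_succ]
  have h1 : (1 : Fin (d + 3)) = Fin.succ 0 := rfl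
  rw [h1]
  push_cast
  ring

lemma pop_waveSeries_eq_zero {g : ℕ → ℝ → (Fin (d + 2) → ℤ) → ℂ} (hg : Admissible T g) {b : ℝ}
    {x : Fin (d + 3) → ℝ} (hx : |x 0| < T)
    (h : ∀ ν : Fin (d + 1) → ℤ, ∑' m : ℤ, popCoeff b (x 1) (fun i => g i (x 0)) (Fin.cons m ν)
      * expWave (x 1) m = 0) :
    Pop (d + 2) b (waveSeries g) x = 0 := by
  have hs := hasSum_pop_waveSeries hg b hx
  let e : (Fin (d + 1) → ℤ) × ℤ ≃ (Fin (d + 2) → ℤ) :=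
    (Equiv.prodComm _ _).trans (Fin.consEquiv fun _ : Fin (d + 2) => ℤ)
  have h1 := e.hasSum_iff.2 hs
  rw [← h1.tsum_eq, h1.summable.tsum_prod]
  convert tsum_zero with ν
  have h2 : ∀ m : ℤ, I * (popCoeff b (x 1) (fun i => g i (x 0)) (Fin.cons m ν)
      * wave (Fin.cons 0 (Fin.cons m ν : Fin (d + 2) → ℤ)) x) =
      I * wave (Fin.cons 0 (Fin.cons 0 ν : Fin (d + 2) → ℤ)) x *
      (popCoeff b (x 1) (fun i => g i (x 0)) (Fin.cons m ν) * expWave (x 1) m) := fun m => by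
    rw [wave_cons_cons]; ring
  show ∑' m : ℤ, I * (popCoeff b (x 1) (fun i => g i (x 0)) (Fin.cons m ν)
      * wave (Fin.cons 0 (Fin.cons m ν : Fin (d + 2) → ℤ)) x) = 0
  simp only [h2]
  rw [tsum_mul_left, h ν, mul_zero]

lemma waveSeries_cons_zero (g : ℕ → ℝ → (Fin r → ℤ) → ℂ) (x : Fin r → ℝ) :
    waveSeries g (Fin.cons 0 x : Fin (r + 1) → ℝ) = ∑' μ, g 0 0 μ * wave μ x := by
  refine tsum_congr fun μ => ?_
  congr 1
  unfold wave
  simp only [Fin.sum_univ_succ, Fin.cons_zero, Fin.cons_succ]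
  simp

end Operator

section CauchyProblem

variable {r : ℕ}

lemma sqrt_abs_le_sqrtSum (ν : Fin r → ℤ) (j : Fin r) : Real.sqrt |(ν j : ℝ)| ≤ sqrtSum ν :=
  Finset.single_le_sum (f := fun j => Real.sqrt |(ν j : ℝ)|) (fun _ _ => Real.sqrt_nonneg _)
    (Finset.mem_univ j)

lemma sqrtSum_nonneg (ν : Fin r → ℤ) : 0 ≤ sqrtSum ν :=
  Finset.sum_nonneg fun _ _ => Real.sqrt_nonneg _

lemma sqrt_one_add_le_one_add_sqrtSum (ν : Fin r → ℤ) (j : Fin r) :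
    Real.sqrt (1 + |(ν j : ℝ)|) ≤ 1 + sqrtSum ν := by
  have h1 := Real.sq_sqrt (abs_nonneg (ν j : ℝ))
  have h2 := Real.sqrt_nonneg |(ν j : ℝ)|
  refine le_trans (Real.sqrt_le_iff.2 ⟨by positivity, ?_⟩)
    (add_le_add_right (sqrt_abs_le_sqrtSum ν j) 1)
  nlinarith

lemma sqrt_one_add_le_multiWeight (ν : Fin r → ℤ) (j : Fin r) :
    Real.sqrt (1 + |(ν j : ℝ)|) ≤ multiWeight ν := by
  have h1 : 1 + |(ν j : ℝ)| ≤ multiWeight ν := by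
    have := Finset.single_le_sum (f := fun j => |(ν j : ℝ)|) (fun _ _ => abs_nonneg _)
      (Finset.mem_univ j)
    unfold multiWeight; linarith
  refine le_trans (Real.sqrt_le_iff.2 ⟨by positivity, ?_⟩) h1
  nlinarith [abs_nonneg (ν j : ℝ)]

lemma tame_of_le_exp {F : (Fin (r + 1) → ℤ) → ℂ} {L : (Fin r → ℤ) → ℝ} {C a c : ℝ} (hC : 0 ≤ C)
    (ha : 0 < a) (hac : a ≤ c) (h : ∀ μ, ‖F μ‖ ≤ C * Real.exp (-c * sqrtSum μ)) (s : ℕ) :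
    Tame L (fun ν => Real.exp (-a * sqrtSum ν)) s fun ν m => F (Fin.cons m ν) := by
  obtain ⟨A, hA, hb⟩ := exists_intWeight_pow_mul_exp_le ha s
  refine ⟨C * A, by positivity, 0, fun ν m => ?_⟩
  have h1 := sqrtSum_nonneg (Fin.cons m ν : Fin (r + 1) → ℤ)
  have hw := (intWeight_pos m).le
  calc ‖F (Fin.cons m ν)‖ * intWeight m ^ s
      ≤ C * Real.exp (-a * sqrtSum (Fin.cons m ν : Fin (r + 1) → ℤ)) * intWeight m ^ s := by
        refine mul_le_mul_of_nonneg_right ((h _).trans ?_) (by positivity)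
        gcongr
    _ = C * (intWeight m ^ s * Real.exp (-a * Real.sqrt |(m : ℝ)|)) *
        Real.exp (-a * sqrtSum ν) := by
        rw [sqrtSum_cons, mul_add, Real.exp_add]; ring
    _ ≤ C * A * Real.exp (-a * sqrtSum ν) := by gcongr; exact hb m
    _ = _ := by rw [pow_zero, mul_one]

lemma admissible_of_fibre_bound {c : (Fin r → ℤ) → ℕ → ℝ → ℤ → ℂ} (j : Fin r) {a C T : ℝ}
    (ha : 0 < a) (hC : 0 ≤ C) (hT : T ≤ 1) (hCT : C * T ≤ a / 2)
    (hd : ∀ p i t m, HasDerivAt (fun t => c p i t m) (c p (i + 1) t m) t)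
    (hb : ∀ i s, ∃ G ≥ 0, ∃ P : ℕ, ∀ p t m, |t| ≤ 1 →
      ‖c p i t m‖ * intWeight m ^ s ≤ G * Real.sqrt (1 + |(p j : ℝ)|) ^ P *
        (Real.exp (-a * sqrtSum p) * Real.exp (C * Real.sqrt (1 + |(p j : ℝ)|) * |t|))) :
    Admissible T fun i t (μ : Fin (r + 1) → ℤ) => c (Fin.tail μ) i t (μ 0) := by
  refine ⟨fun i t μ => hd _ i t _, fun i k => ?_⟩
  obtain ⟨G, hG, P, h⟩ := hb i (k + 2)
  have hsum := summable_cons summable_intWeight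
    ((summable_multiWeight_mul_exp (half_pos ha) (k + P) r).mul_left (G * Real.exp (a / 2)))
    (fun m => by positivity) (fun ν => by have := one_le_multiWeight ν; positivity)
  refine ⟨_, hsum, fun t μ ht => ?_⟩
  · obtain ⟨m, ν, rfl⟩ : ∃ m ν', μ = Fin.cons m ν' := ⟨μ 0, Fin.tail μ, (Fin.cons_self_tail μ).symm⟩
    rw [Fin.tail_cons, Fin.cons_zero]
    have h1 := h ν t m (ht.le.trans hT)
    have hw := intWeight_pos m
    have hM := one_le_multiWeight ν
    have hM' := one_le_multiWeight (Fin.cons m ν : Fin (r + 1) → ℤ)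
    have h2 : C * Real.sqrt (1 + |(ν j : ℝ)|) * |t| ≤ a / 2 * (1 + sqrtSum ν) := by
      calc C * Real.sqrt (1 + |(ν j : ℝ)|) * |t| ≤ C * (1 + sqrtSum ν) * T := by
            have := sqrtSum_nonneg ν
            gcongr
            exact sqrt_one_add_le_one_add_sqrtSum ν j
        _ = (C * T) * (1 + sqrtSum ν) := by ring
        _ ≤ _ := by
            have := sqrtSum_nonneg ν
            gcongr
    rw [inv_mul_eq_div, le_div_iff₀ (by positivity)]
    calc ‖c ν i t m‖ * multiWeight (Fin.cons m ν : Fin (r + 1) → ℤ) ^ k * intWeight m ^ 2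
        ≤ ‖c ν i t m‖ * (intWeight m * multiWeight ν) ^ k * intWeight m ^ 2 := by
          gcongr; exact multiWeight_cons_le m ν
      _ = ‖c ν i t m‖ * intWeight m ^ (k + 2) * multiWeight ν ^ k := by ring
      _ ≤ G * multiWeight ν ^ P * (Real.exp (-a * sqrtSum ν) *
          Real.exp (a / 2 * (1 + sqrtSum ν))) * multiWeight ν ^ k := by
          refine mul_le_mul_of_nonneg_right (h1.trans ?_) (by positivity)
          gcongr
          exact sqrt_one_add_le_multiWeight ν j
      _ = _ := by
          have : Real.exp (-a * sqrtSum ν) * Real.exp (a / 2 * (1 + sqrtSum ν)) =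
              Real.exp (a / 2) * Real.exp (-(a / 2) * sqrtSum ν) := by
            rw [← Real.exp_add, ← Real.exp_add]; congr 1; ring
          rw [this]; ring

lemma hasSum_fcoef_localization {u : (Fin r → ℝ) → ℂ} {w : (Fin r → ℝ) → ℝ} {C c : ℝ} (hc : 0 < c)
    (hw : CubeSmooth fun x => w x * u x) (hw1 : ∀ x, (∀ j, |x j| ≤ 1 / 8) → w x = 1)
    (hb : ∀ μ, ‖fcoef (fun x => w x * u x) μ‖ ≤ C * Real.exp (-c * sqrtSum μ)) {x : Fin r → ℝ}
    (hx : ∀ j, |x j| < 1 / 8) :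
    HasSum (fun μ => fcoef (fun x => w x * u x) μ * wave μ x) (u x) := by
  have h1 : Summable (fcoef fun x => w x * u x) := by
    refine Summable.of_norm_bounded
      ((summable_multiWeight_mul_exp hc 0 r).mul_left C) fun μ => ?_
    simpa using hb μ
  have h2 := hasSum_fcoef hw h1 (x := x) fun j => (hx j).trans (by norm_num)
  rwa [hw1 x fun j => (hx j).le, ofReal_one, one_mul] at h2

end CauchyProblem

/-- The Cauchy problem for `P` is locally solvable at the origin in the Gevrey class
of order `2`. -/
theorem gevrey_two_well_posed (n : ℕ) (hn : 2 ≤ n) (b₀ : ℝ)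
    (hb₀ : 0 < |b₀|) (hb₀' : |b₀| < 2 / (3 * Real.sqrt 3))
    (u₀ u₁ u₂ : (Fin n → ℝ) → ℂ)
    (h₀ : GevreyOn 2 u₀) (h₁ : GevreyOn 2 u₁) (h₂ : GevreyOn 2 u₂) :
    ∃ U : Set (Fin (n+1) → ℝ), IsOpen U ∧ (0 : Fin (n+1) → ℝ) ∈ U ∧
      ∃ u : (Fin (n+1) → ℝ) → ℂ, ContDiffOn ℝ (⊤ : ℕ∞) u U ∧
        (∀ x ∈ U, Pop n b₀ u x = 0) ∧
        (∀ x' : Fin n → ℝ, Fin.cons 0 x' ∈ U →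
          u (Fin.cons 0 x') = u₀ x' ∧
          Dop 0 u (Fin.cons 0 x') = u₁ x' ∧
          Dop 0 (Dop 0 u) (Fin.cons 0 x') = u₂ x') := by
  obtain ⟨d, rfl⟩ : ∃ d, n = d + 2 := ⟨n - 2, by omega⟩
  obtain ⟨w₀, hs₀, hw₀, C₀, hC₀, c₀, hc₀, hf₀⟩ := exists_gevrey_localization h₀
  obtain ⟨w₁, hs₁, hw₁, C₁, hC₁, c₁, hc₁, hf₁⟩ := exists_gevrey_localization h₁
  obtain ⟨w₂, hs₂, hw₂, C₂, hC₂, c₂, hc₂, hf₂⟩ := exists_gevrey_localization h₂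
  obtain ⟨K, hKs, ⟨CK, hCK, cK, hcK, hKb⟩, hKx⟩ := exists_kernel
  have hK := rapidDecay_of_le_exp hcK hCK hKb
  obtain ⟨C, hC, hsol⟩ := exists_fibre_solution hK hKs hb₀'
  set a := min c₀ (min c₁ c₂) with ha_def
  have ha : 0 < a := lt_min hc₀ (lt_min hc₁ hc₂)
  have ha0 : a ≤ c₀ := min_le_left _ _
  have ha1 : a ≤ c₁ := (min_le_right _ _).trans (min_le_left _ _)
  have ha2 : a ≤ c₂ := (min_le_right _ _).trans (min_le_right _ _)
  let j : Fin (d + 1) := Fin.last d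
  obtain ⟨c, hcd, hc0, hrec, hcb⟩ := hsol (Fin (d + 1) → ℤ) (fun ν => Real.sqrt (1 + |(ν j : ℝ)|))
    (fun ν => Real.exp (-a * sqrtSum ν)) (fun ν => 2 * Real.pi * ν j)
    (fun ν => Real.one_le_sqrt.2 (by linarith [abs_nonneg (ν j : ℝ)]))
    (fun ν => (Real.exp_nonneg _))
    (fun ν => by
      rw [Real.sq_sqrt (by positivity), abs_mul, abs_of_pos Real.two_pi_pos]
      have := Real.pi_pos
      gcongr
      linarith)
    (fun ν m => fcoef (fun x => w₀ x * u₀ x) (Fin.cons m ν))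
    (fun ν m => I * fcoef (fun x => w₁ x * u₁ x) (Fin.cons m ν))
    (fun ν m => -fcoef (fun x => w₂ x * u₂ x) (Fin.cons m ν))
    (tame_of_le_exp hC₀ ha ha0 hf₀)
    (tame_of_le_exp (F := fun μ => I * fcoef (fun x => w₁ x * u₁ x) μ) hC₁ ha ha1
      fun μ => by simpa using hf₁ μ)
    (tame_of_le_exp (F := fun μ => -fcoef (fun x => w₂ x * u₂ x) μ) hC₂ ha ha2
      fun μ => by simpa using hf₂ μ)
  let T := min 1 (a / 2 / (C + 1))
  have hT : 0 < T := lt_min one_pos (by positivity)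
  have hT1 : T ≤ 1 := min_le_left _ _
  have hCT : C * T ≤ a / 2 := by
    have h1 : T * (C + 1) ≤ a / 2 := (le_div_iff₀ (by positivity)).1 (min_le_right _ _)
    nlinarith
  have hg := admissible_of_fibre_bound j ha hC hT1 hCT hcd hcb
  set g : ℕ → ℝ → (Fin (d + 2) → ℤ) → ℂ := fun i t μ => c (Fin.tail μ) i t (μ 0) with hg_def
  have g0 : ∀ μ, g 0 0 μ = fcoef (fun x => w₀ x * u₀ x) μ := fun μ => by
    rw [hg_def]; simp only [(hc0 _).1, Fin.cons_self_tail]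
  have g1 : ∀ μ, g 1 0 μ = I * fcoef (fun x => w₁ x * u₁ x) μ := fun μ => by
    rw [hg_def]; simp only [(hc0 _).2.1, Fin.cons_self_tail]
  have g2 : ∀ μ, g 2 0 μ = -fcoef (fun x => w₂ x * u₂ x) μ := fun μ => by
    rw [hg_def]; simp only [(hc0 _).2.2, Fin.cons_self_tail]
  refine ⟨{x | |x 0| < T} ∩ ⋂ k : Fin (d + 2), {x | |x k.succ| < 1 / 8}, ?_, ?_, waveSeries g,
    hg.contDiffOn.mono Set.inter_subset_left, ?_, ?_⟩
  · exact (isOpen_abs_zero_lt T).inter (isOpen_iInter_of_finite fun k =>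
      isOpen_lt (continuous_apply _).abs continuous_const)
  · simp [hT]
  · rintro x ⟨hx0, hx⟩
    refine pop_waveSeries_eq_zero hg hx0 fun ν => ?_
    have hx1 : |x 1| ≤ 1 / 8 := (Set.mem_iInter.1 hx 0).le
    have hKsum : Summable K := Summable.of_norm (by simpa using hK 0)
    choose G hG P hb using fun i => hcb i 2
    have key := fibreRec_sum (f := fun i => c ν i (x 0)) hK (hKx hKsum (x 1) hx1)
      (fun i m => hb i ν (x 0) m (hx0.le.trans hT1)) (hrec ν (x 0))
    rw [← key]
    refine tsum_congr fun m => ?_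
    have hl : (Fin.cons m ν : Fin (d + 2) → ℤ) (Fin.last (d + 1)) = ν j := rfl
    have hgc : ∀ i, g i (x 0) (Fin.cons m ν) = c ν i (x 0) m := fun i => by
      rw [hg_def]; simp only [Fin.tail_cons, Fin.cons_zero]
    simp only [popCoeff, hl, hgc, Fin.cons_zero]
  · rintro x ⟨-, hx⟩
    have hx' : ∀ k, |x k| < 1 / 8 := fun k => by simpa using Set.mem_iInter.1 hx k
    have hmem : (Fin.cons 0 x : Fin (d + 3) → ℝ) ∈ {x : Fin (d + 3) → ℝ | |x 0| < T} := by
      simpa using hT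
    have e1 := eqOn_dop_waveSeries hg (fun _ _ => rfl) 0
    have e2 := eqOn_dop_waveSeries (hg.dopFamily 0) e1 0
    refine ⟨?_, ?_, ?_⟩
    · rw [waveSeries_cons_zero]
      simp only [g0]
      exact (hasSum_fcoef_localization hc₀ hs₀ hw₀ hf₀ hx').tsum_eq
    · rw [e1 hmem, waveSeries_cons_zero]
      simp only [dopFamily_zero, zero_add, g1, ← mul_assoc, neg_mul, I_mul_I, neg_neg, one_mul]
      exact (hasSum_fcoef_localization hc₁ hs₁ hw₁ hf₁ hx').tsum_eq
    · rw [e2 hmem, waveSeries_cons_zero]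
      simp only [dopFamily_zero, zero_add, Nat.reduceAdd, g2, ← mul_assoc, neg_mul, mul_neg,
        I_mul_I, neg_neg, one_mul]
      exact (hasSum_fcoef_localization hc₂ hs₂ hw₂ hf₂ hx').tsum_eq
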